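/- Let d, n be natural numbers and let ε > 0. There exist constants C, c > 0 depending only on d, n, ε such that the following holds: for every non-degenerate polynomial F ∈ ℂ[x₁,…,xₙ] of total degree d, every real K ≥ 1, and every finite non-empty set A ⊆ ℂ satisfying |A·A| ≤ K|A|, one has |F(A,…,A)| ≥ c · |A|ⁿ · 2^{−C (log₂(2K))^{3+ε}}. -/

import Mathlib

open MvPolynomial Pointwise

open scoped Classical

/-- The set of exponent vectors of monomials of `F`, viewed inside `ℚⁿ`. -/
noncomputable def expVecs {n : ℕ} (F : MvPolynomial (Fin n) ℂ) : Set (Fin n → ℚ) :=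
  (fun (m : Fin n →₀ ℕ) (i : Fin n) => (m i : ℚ)) '' (F.support : Set (Fin n →₀ ℕ))

/-- `d(F)`: the dimension of the `ℚ`-linear span of the exponent vectors of `F`. -/
noncomputable def dF {n : ℕ} (F : MvPolynomial (Fin n) ℂ) : ℕ :=
  Module.finrank ℚ (Submodule.span ℚ (expVecs F))

/-- `F(A, …, A)`, the image of the grid `Aⁿ` under `F`. -/
noncomputable def polyImage {n : ℕ} (F : MvPolynomial (Fin n) ℂ) (A : Finset ℂ) : Finset ℂ :=
  (Fintype.piFinset fun _ : Fin n => A).image fun a => eval a F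

structure PSys (K : Type) [Field K] where
  V : Type
  fV : Fintype V
  w : V → ℝ
  av : V → AbsoluteValue K ℝ
  arch : V → Prop
  w_pos : ∀ v, 0 < w v
  ultra : ∀ v, ¬ arch v → ∀ x y, av v (x + y) ≤ max (av v x) (av v y)
  arch_nat : ∀ v, arch v → ∀ n : ℕ, av v (n : K) = n
  arch_sum : ∑ v : V, (if arch v then w v else 0) = 1

attribute [instance] PSys.fV

namespace PSys
variable {K : Type} [Field K] (Z : PSys K)

noncomputable def L (x : Kˣ) (v : Z.V) : ℝ := Real.log (Z.av v (x : K))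

noncomputable def ht (x : Kˣ) : ℝ := ∑ v, Z.w v * |Z.L x v|

noncomputable def PF (x : Kˣ) : Prop := ∑ v, Z.w v * Z.L x v = 0

lemma av_pos (x : Kˣ) (v : Z.V) : 0 < Z.av v (x : K) := (Z.av v).pos x.ne_zero

lemma L_mul (x y : Kˣ) (v : Z.V) : Z.L (x * y) v = Z.L x v + Z.L y v := by
  unfold L
  rw [Units.val_mul, map_mul, Real.log_mul (Z.av_pos x v).ne' (Z.av_pos y v).ne']

lemma L_one (v : Z.V) : Z.L 1 v = 0 := by simp [L]

lemma L_inv (x : Kˣ) (v : Z.V) : Z.L x⁻¹ v = - Z.L x v := by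
  have := Z.L_mul x x⁻¹ v
  rw [mul_inv_cancel, L_one] at this; linarith

lemma L_div (x y : Kˣ) (v : Z.V) : Z.L (x / y) v = Z.L x v - Z.L y v := by
  rw [div_eq_mul_inv, L_mul, L_inv]; ring

lemma L_pow (x : Kˣ) (k : ℕ) (v : Z.V) : Z.L (x ^ k) v = k * Z.L x v := by
  induction k with
  | zero => simp [L_one]
  | succ k ih => rw [pow_succ, L_mul, ih]; push_cast; ring

lemma L_prod {ι : Type*} (s : Finset ι) (f : ι → Kˣ) (v : Z.V) :
    Z.L (∏ i ∈ s, f i) v = ∑ i ∈ s, Z.L (f i) v := by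
  induction s using Finset.induction_on with
  | empty => simp [L_one]
  | insert a s ha ih => rw [Finset.prod_insert ha, Finset.sum_insert ha, L_mul, ih]

lemma ht_nonneg (x : Kˣ) : 0 ≤ Z.ht x :=
  Finset.sum_nonneg fun v _ => mul_nonneg (Z.w_pos v).le (abs_nonneg _)

lemma ht_mul (x y : Kˣ) : Z.ht (x * y) ≤ Z.ht x + Z.ht y := by
  unfold ht
  rw [← Finset.sum_add_distrib]
  refine Finset.sum_le_sum fun v _ => ?_
  rw [← mul_add, L_mul]
  exact mul_le_mul_of_nonneg_left (abs_add_le _ _) (Z.w_pos v).le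

lemma ht_inv (x : Kˣ) : Z.ht x⁻¹ = Z.ht x := by
  unfold ht; simp [L_inv]

lemma ht_pow (x : Kˣ) (k : ℕ) : Z.ht (x ^ k) = k * Z.ht x := by
  unfold ht; rw [Finset.mul_sum]
  refine Finset.sum_congr rfl fun v _ => ?_
  rw [L_pow, abs_mul, Nat.abs_cast]; ring

lemma nonempty : Nonempty Z.V := by
  by_contra h
  rw [not_nonempty_iff] at h
  have := Z.arch_sum
  simp at this

end PSys

/-- fields carrying a height function coming from systems of places -/
class HField (K : Type) [Field K] where
  hgt : Kˣ → ℝ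
  good : ∀ G : Finset Kˣ, ∃ Z : PSys K, ∀ x ∈ Subgroup.closure (G : Set Kˣ),
    Z.PF x ∧ Z.ht x = hgt x

section HF
variable {K : Type} [Field K] [HField K]

noncomputable abbrev hgt (x : Kˣ) : ℝ := HField.hgt x

lemma hgt_pair (x y : Kˣ) : ∃ Z : PSys K, Z.ht x = hgt x ∧ Z.ht y = hgt y ∧
    Z.ht (x * y) = hgt (x * y) ∧ Z.ht x⁻¹ = hgt x⁻¹ ∧ ∀ k : ℕ, Z.ht (x ^ k) = hgt (x ^ k) := by
  obtain ⟨Z, hZ⟩ := HField.good ({x, y} : Finset Kˣ)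
  have hx : x ∈ Subgroup.closure ((({x, y} : Finset Kˣ)) : Set Kˣ) :=
    Subgroup.subset_closure (by simp)
  have hy : y ∈ Subgroup.closure ((({x, y} : Finset Kˣ)) : Set Kˣ) :=
    Subgroup.subset_closure (by simp)
  exact ⟨Z, (hZ _ hx).2, (hZ _ hy).2, (hZ _ (mul_mem hx hy)).2, (hZ _ (inv_mem hx)).2,
    fun k => (hZ _ (pow_mem hx k)).2⟩

lemma hgt_nonneg (x : Kˣ) : 0 ≤ hgt x := by
  obtain ⟨Z, h1, -⟩ := hgt_pair x x
  rw [← h1]; exact Z.ht_nonneg x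

lemma hgt_mul (x y : Kˣ) : hgt (x * y) ≤ hgt x + hgt y := by
  obtain ⟨Z, h1, h2, h3, -⟩ := hgt_pair x y
  rw [← h1, ← h2, ← h3]; exact Z.ht_mul x y

lemma hgt_inv (x : Kˣ) : hgt x⁻¹ = hgt x := by
  obtain ⟨Z, h1, h2, h3, h4, -⟩ := hgt_pair x x
  rw [← h1, ← h4]; exact Z.ht_inv x

lemma hgt_pow (x : Kˣ) (k : ℕ) : hgt (x ^ k) = k * hgt x := by
  obtain ⟨Z, h1, h2, h3, h4, h5⟩ := hgt_pair x x
  rw [← h1, ← h5]; exact Z.ht_pow x k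

lemma hgt_one : hgt (1 : Kˣ) = 0 := by
  have := hgt_pow (1 : Kˣ) 0
  simpa using this

lemma hgt_div (x y : Kˣ) : hgt (x / y) ≤ hgt x + hgt y := by
  rw [div_eq_mul_inv, ← hgt_inv y]; exact hgt_mul _ _

lemma hgt_div_comm (x y : Kˣ) : hgt (x / y) = hgt (y / x) := by
  rw [← hgt_inv, inv_div]

lemma hgt_tri (x y z : Kˣ) : hgt (x / z) ≤ hgt (x / y) + hgt (y / z) := by
  have := hgt_mul (x / y) (y / z)
  rwa [div_mul_div_cancel] at this

lemma hgt_prod {ι : Type*} (s : Finset ι) (f : ι → Kˣ) :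
    hgt (∏ i ∈ s, f i) ≤ ∑ i ∈ s, hgt (f i) := by
  induction s using Finset.induction_on with
  | empty => simp [hgt_one]
  | insert a s ha ih =>
    rw [Finset.prod_insert ha, Finset.sum_insert ha]
    exact (hgt_mul _ _).trans (by linarith)

end HF

section NF
open NumberField
variable (K : Type) [Field K] [NumberField K]

noncomputable def nfPSys (T : Finset (FinitePlace K)) : PSys K where
  V := InfinitePlace K ⊕ T
  fV := inferInstance
  w := Sum.elim (fun v => (v.mult : ℝ) / Module.finrank ℚ K) (fun _ => 1 / Module.finrank ℚ K)
  av := Sum.elim (fun v => v.val) (fun v => v.val.val)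
  arch := fun v => v.isLeft
  w_pos := by
    have h : (0 : ℝ) < Module.finrank ℚ K := by exact_mod_cast Module.finrank_pos
    rintro (v | v)
    · exact div_pos (by exact_mod_cast InfinitePlace.mult_pos) h
    · exact div_pos one_pos h
  ultra := by
    rintro (v | v) h x y
    · simp at h
    · exact FinitePlace.add_le v.val x y
  arch_nat := by
    rintro (v | v) h n
    · change v (n : K) = n
      simp
    · simp at h
  arch_sum := by
    have h : (0 : ℝ) < Module.finrank ℚ K := by exact_mod_cast Module.finrank_pos
    rw [Fintype.sum_sum_type]
    simp only [Sum.isLeft_inl, Sum.isLeft_inr, if_true, Sum.elim_inl]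
    simp only [Bool.false_eq_true, if_false, Finset.sum_const_zero, add_zero]
    rw [← Finset.sum_div, div_eq_one_iff_eq h.ne']
    exact_mod_cast InfinitePlace.sum_mult_eq

noncomputable def nfHgt (x : Kˣ) : ℝ :=
  ∑ v : InfinitePlace K, (v.mult : ℝ) / Module.finrank ℚ K * |Real.log (v (x : K))|
   + ∑ᶠ v : FinitePlace K, 1 / (Module.finrank ℚ K : ℝ) * |Real.log (v (x : K))|

lemma nf_good (T : Finset (FinitePlace K)) (x : Kˣ)
    (hx : ∀ v : FinitePlace K, v ∉ T → v (x : K) = 1) :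
    (nfPSys K T).PF x ∧ (nfPSys K T).ht x = nfHgt K x := by
  have h : (0 : ℝ) < Module.finrank ℚ K := by exact_mod_cast Module.finrank_pos
  constructor
  · have h1 := prod_abs_eq_one (K := K) x.ne_zero
    rw [finprod_eq_prod_of_mulSupport_subset (s := T)] at h1
    · have h2 := congrArg Real.log h1
      have hi : ∀ v : InfinitePlace K, v (x : K) ≠ 0 := fun v => by simp
      have hf : ∀ v : FinitePlace K, v (x : K) ≠ 0 := fun v =>
        (FinitePlace.pos_iff.2 x.ne_zero).ne'
      rw [Real.log_one, Real.log_mul, Real.log_prod, Real.log_prod] at h2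
      · unfold PSys.PF
        change ∑ v : InfinitePlace K ⊕ T, _ = _
        rw [Fintype.sum_sum_type]
        change ∑ v : InfinitePlace K, (v.mult : ℝ) / Module.finrank ℚ K * Real.log (v (x : K)) +
          ∑ v : T, 1 / (Module.finrank ℚ K : ℝ) * Real.log (v.val (x : K)) = 0
        have e2 : ∑ v : T, 1 / (Module.finrank ℚ K : ℝ) * Real.log (v.val (x : K)) =
          ∑ v ∈ T, 1 / (Module.finrank ℚ K : ℝ) * Real.log (v (x : K)) :=
          Finset.sum_coe_sort T (fun v => 1 / (Module.finrank ℚ K : ℝ) * Real.log (v (x : K)))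
        rw [e2, ← Finset.mul_sum]
        have e3 : ∑ v : InfinitePlace K, (v.mult : ℝ) / Module.finrank ℚ K * Real.log (v (x : K)) =
          1 / (Module.finrank ℚ K : ℝ) * ∑ v : InfinitePlace K, Real.log (v (x : K) ^ v.mult) := by
          rw [Finset.mul_sum]
          refine Finset.sum_congr rfl fun v _ => ?_
          rw [Real.log_pow]; ring
        rw [e3, ← mul_add, h2, mul_zero]
      · intro v _; exact hf v
      · intro v _; exact pow_ne_zero _ (hi v)
      · exact Finset.prod_ne_zero_iff.2 fun v _ => pow_ne_zero _ (hi v)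
      · exact Finset.prod_ne_zero_iff.2 fun v _ => hf v
    · intro v hv
      by_contra hc
      exact hv (hx v (by simpa using hc))
  · unfold PSys.ht nfHgt
    change ∑ v : InfinitePlace K ⊕ T, _ = _
    rw [Fintype.sum_sum_type]
    congr 1
    rw [finsum_eq_sum_of_support_subset (s := T)]
    · exact Finset.sum_coe_sort T (fun v => 1 / (Module.finrank ℚ K : ℝ) * |Real.log (v (x : K))|)
    · intro v hv
      by_contra hc
      exact hv (by simp [hx v (by simpa using hc)])

noncomputable instance nfHField : HField K where
  hgt := nfHgt K
  good := by
    intro G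
    have hfin : ∀ x : Kˣ, {v : FinitePlace K | v (x : K) ≠ 1}.Finite := fun x =>
      FinitePlace.hasFiniteMulSupport x.ne_zero
    refine ⟨nfPSys K (G.biUnion fun x => (hfin x).toFinset), fun x hx => nf_good K _ x ?_⟩
    intro v hv
    have hv' : ∀ y ∈ G, v (y : K) = 1 := by
      intro y hy
      by_contra hc
      exact hv (Finset.mem_biUnion.2 ⟨y, hy, by simpa using hc⟩)
    induction hx using Subgroup.closure_induction with
    | mem y hy => exact hv' y hy
    | one => simp
    | mul y z _ _ h1 h2 => simp [h1, h2]
    | inv y _ h1 => simp [h1]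

end NF

lemma exists_det_ne_zero {F : Type*} [Field F] {ι T : Type*} [Fintype ι] [DecidableEq ι]
    (x : T → ι → F) (h : ∀ c : ι → F, (∀ t, ∑ i, c i * x t i = 0) → c = 0) :
    ∃ t : ι → T, (Matrix.of fun i j => x (t i) j).det ≠ 0 := by
  have hs : ⊤ ≤ Submodule.span F (Set.range x) := by
    by_contra hc
    have hlt : Submodule.span F (Set.range x) < ⊤ := lt_top_iff_ne_top.2 (fun h => hc h.ge)
    obtain ⟨f, hf0, hf⟩ := Submodule.exists_le_ker_of_lt_top _ hlt
    apply hf0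
    have hfx : ∀ y : ι → F, f y = ∑ i, f (Pi.single i 1) * y i := by
      intro y
      conv_lhs => rw [← Finset.univ_sum_single y]
      rw [map_sum]
      refine Finset.sum_congr rfl fun i _ => ?_
      have : (Pi.single i (y i) : ι → F) = y i • Pi.single i 1 := by
        rw [← Pi.single_smul]; simp
      rw [this, map_smul, smul_eq_mul, mul_comm]
    have := h (fun i => f (Pi.single i 1)) (fun t => by
      rw [← hfx]; exact hf (Submodule.subset_span ⟨t, rfl⟩))
    ext i
    have := congrFun this i
    simpa using this
  let b := Module.Basis.ofSpan hs
  let e := (Pi.basisFun F ι).indexEquiv b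
  have hb : ∀ i, ∃ t, x t = b (e i) := fun i =>
    Module.Basis.ofSpan_subset hs ⟨e i, rfl⟩
  choose t ht using hb
  refine ⟨t, ?_⟩
  have hli : LinearIndependent F (Matrix.of fun i j => x (t i) j).row := by
    have h1 : LinearIndependent F (fun i => b (e i)) := b.linearIndependent.comp e e.injective
    convert h1 using 1
    ext i j
    rw [← ht]; rfl
  rw [Matrix.linearIndependent_rows_iff_isUnit, Matrix.isUnit_iff_isUnit_det] at hli
  exact hli.ne_zero

lemma cramer_expand {r : ℕ} {V : Type*} (e : Fin r → V → ℝ) (v : Fin r → V) (a : Fin r → ℝ)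
    (u : V) :
    (Matrix.of fun i j => e j (v i)).det * (∑ j, a j * e j u) =
    ∑ i, (Matrix.of fun k j => e j (Function.update v i u k)).det * ∑ j, a j * e j (v i) := by
  set M : Matrix (Fin r) (Fin r) ℝ := Matrix.of fun i j => e j (v i) with hM
  have h1 : ∀ i, (Matrix.of fun k j => e j (Function.update v i u k)).det =
      Matrix.cramer M.transpose (fun j => e j u) i := by
    intro i
    rw [Matrix.cramer_transpose_apply]
    congr 1
    ext k j
    by_cases hk : k = i
    · subst hk; simp
    · simp [hk, hM]
  have h2 := Matrix.mulVec_cramer M.transpose (fun j => e j u)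
  rw [Matrix.det_transpose] at h2
  simp_rw [h1]
  have h3 : ∀ j, ∑ i, e j (v i) * Matrix.cramer M.transpose (fun j => e j u) i = M.det * e j u := by
    intro j
    have := congrFun h2 j
    simpa [Matrix.mulVec, dotProduct, hM] using this
  rw [Finset.mul_sum]
  simp_rw [Finset.mul_sum]
  rw [Finset.sum_comm]
  refine Finset.sum_congr rfl fun j _ => ?_
  have := h3 j
  calc M.det * (a j * e j u) = a j * (M.det * e j u) := by ring
    _ = _ := by
      rw [← this, Finset.mul_sum]
      refine Finset.sum_congr rfl fun i _ => ?_
      ring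

/-- determinantal selection of coordinates -/
lemma lemD0 {V : Type*} [Fintype V] (w : V → ℝ) (hw : ∀ v, 0 < w v)
    (E : Submodule ℝ (V → ℝ)) (eb : V → ℝ) (heb : ∀ v, 0 ≤ eb v) :
    ∃ (v : Fin (Module.finrank ℝ E) → V) (c : Fin (Module.finrank ℝ E) → ℝ),
      (∀ i, 0 ≤ c i) ∧
      (∀ x ∈ E, ∑ u, w u * |x u| ≤ ∑ i, c i * |x (v i)|) ∧
      ∑ i, c i * eb (v i) ≤ Module.finrank ℝ E * ∑ u, w u * eb u := by
  set r := Module.finrank ℝ E with hr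
  let B : Module.Basis (Fin r) ℝ E := Module.finBasis ℝ E
  let e : Fin r → V → ℝ := fun j => (B j : V → ℝ)
  let D : (Fin r → V) → ℝ := fun v => (Matrix.of fun i j => e j (v i)).det
  let W : (Fin r → V) → ℝ := fun v => (∏ i, w (v i)) * |D v|
  let c : (Fin r → V) → Fin r → ℝ := fun v i =>
    (∑ u, w u * |D (Function.update v i u)|) / |D v|
  have hW0 : ∀ v, 0 ≤ W v := fun v =>
    mul_nonneg (Finset.prod_nonneg fun i _ => (hw _).le) (abs_nonneg _)
  have hc0 : ∀ v i, 0 ≤ c v i := fun v i =>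
    div_nonneg (Finset.sum_nonneg fun u _ => mul_nonneg (hw u).le (abs_nonneg _)) (abs_nonneg _)
  obtain ⟨v0, hv0⟩ : ∃ v : Fin r → V, D v ≠ 0 := by
    apply exists_det_ne_zero (fun (u : V) (j : Fin r) => e j u)
    intro a ha
    have h0 : ∑ j, a j • B j = 0 := by
      apply Subtype.ext
      ext u
      have := ha u
      simpa [e] using this
    exact funext fun j => Fintype.linearIndependent_iff.1 B.linearIndependent a h0 j
  have key : ∑ v, W v * ∑ i, c v i * eb (v i) ≤ (∑ v, W v) * (r * ∑ u, w u * eb u) := by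
    have h1 : ∀ i, ∑ v, W v * (c v i * eb (v i)) ≤ (∑ v, W v) * ∑ u, w u * eb u := by
      intro i
      let φ : (Fin r → V) × V → (Fin r → V) × V := fun p => (Function.update p.1 i p.2, p.1 i)
      have hφ : Function.Involutive φ := by
        rintro ⟨v, u⟩
        simp [φ]
      calc ∑ v, W v * (c v i * eb (v i))
          ≤ ∑ v, ∑ u, (∏ k, w (v k)) * w u * |D (Function.update v i u)| * eb (v i) := by
            refine Finset.sum_le_sum fun v _ => ?_
            rw [← Finset.sum_mul, ← mul_assoc]
            refine mul_le_mul_of_nonneg_right ?_ (heb _)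
            simp only [W]
            simp_rw [mul_assoc]
            rw [← Finset.mul_sum]
            refine mul_le_mul_of_nonneg_left ?_ (Finset.prod_nonneg fun i _ => (hw _).le)
            by_cases h : |D v| = 0
            · rw [h, zero_mul]
              exact Finset.sum_nonneg fun u _ => mul_nonneg (hw u).le (abs_nonneg _)
            · simp only [c]; rw [mul_div_cancel₀ _ h]
        _ = ∑ p : (Fin r → V) × V,
              (∏ k, w (p.1 k)) * w p.2 * |D (Function.update p.1 i p.2)| * eb (p.1 i) := by
            rw [Fintype.sum_prod_type]
        _ = ∑ p : (Fin r → V) × V, W p.1 * (w p.2 * eb p.2) := by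
            rw [← Equiv.sum_comp (Function.Involutive.toPerm φ hφ)
              (fun p : (Fin r → V) × V => W p.1 * (w p.2 * eb p.2))]
            refine Finset.sum_congr rfl fun p _ => ?_
            obtain ⟨v, u⟩ := p
            simp only [Function.Involutive.coe_toPerm, φ, W]
            have : (∏ k, w (Function.update v i u k)) * w (v i) = (∏ k, w (v k)) * w u := by
              rw [← Finset.mul_prod_erase _ _ (Finset.mem_univ i),
                ← Finset.mul_prod_erase Finset.univ (fun k => w (v k)) (Finset.mem_univ i)]
              rw [Function.update_self]
              have : ∏ x ∈ Finset.univ.erase i, w (Function.update v i u x) =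
                  ∏ x ∈ Finset.univ.erase i, w (v x) := by
                refine Finset.prod_congr rfl fun k hk => ?_
                rw [Function.update_of_ne (Finset.ne_of_mem_erase hk)]
              rw [this]; ring
            linear_combination (-|D (Function.update v i u)| * eb (v i)) * this
        _ = _ := by
            rw [Fintype.sum_prod_type, Finset.sum_mul]
            refine Finset.sum_congr rfl fun v _ => ?_
            rw [Finset.mul_sum]
    calc ∑ v, W v * ∑ i, c v i * eb (v i) = ∑ i, ∑ v, W v * (c v i * eb (v i)) := by
          rw [Finset.sum_comm]; simp_rw [Finset.mul_sum]
      _ ≤ ∑ i : Fin r, (∑ v, W v) * ∑ u, w u * eb u := Finset.sum_le_sum fun i _ => h1 i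
      _ = _ := by simp; ring
  have hex : ∃ v, D v ≠ 0 ∧ ∑ i, c v i * eb (v i) ≤ r * ∑ u, w u * eb u := by
    by_contra hcon
    push Not at hcon
    have : (∑ v, W v) * (r * ∑ u, w u * eb u) < ∑ v, W v * ∑ i, c v i * eb (v i) := by
      rw [Finset.sum_mul]
      refine Finset.sum_lt_sum (fun v _ => ?_) ⟨v0, Finset.mem_univ _, ?_⟩
      · by_cases h : D v = 0
        · simp [W, h]
        · exact mul_le_mul_of_nonneg_left (hcon v h).le (hW0 v)
      · exact mul_lt_mul_of_pos_left (hcon v0 hv0)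
          (mul_pos (Finset.prod_pos fun i _ => hw _) (abs_pos.2 hv0))
    linarith
  obtain ⟨v, hDv, hv⟩ := hex
  refine ⟨v, c v, hc0 v, ?_, hv⟩
  intro x hx
  obtain ⟨a, ha⟩ : ∃ a : Fin r → ℝ, ∀ u, x u = ∑ j, a j * e j u := by
    refine ⟨fun j => B.repr ⟨x, hx⟩ j, fun u => ?_⟩
    have := congrArg (fun y : E => (y : V → ℝ) u) (B.sum_repr ⟨x, hx⟩)
    simp only [Submodule.coe_sum, Submodule.coe_smul, Finset.sum_apply, Pi.smul_apply,
      smul_eq_mul] at this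
    exact this.symm
  have hb : ∀ u, |x u| ≤ ∑ i, |D (Function.update v i u)| / |D v| * |x (v i)| := by
    intro u
    have h1 := cramer_expand e v a u
    rw [← ha u] at h1
    simp_rw [← ha] at h1
    have h2 : |D v| * |x u| ≤ ∑ i, |D (Function.update v i u)| * |x (v i)| := by
      rw [← abs_mul]
      change |(Matrix.of fun i j => e j (v i)).det * x u| ≤ _
      rw [h1]
      refine (Finset.abs_sum_le_sum_abs _ _).trans (le_of_eq ?_)
      refine Finset.sum_congr rfl fun i _ => ?_
      rw [abs_mul]
    have h3 : 0 < |D v| := abs_pos.2 hDv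
    rw [← mul_le_mul_iff_right₀ h3]
    refine h2.trans (le_of_eq ?_)
    rw [Finset.mul_sum]
    refine Finset.sum_congr rfl fun i _ => ?_
    field_simp
  calc ∑ u, w u * |x u| ≤ ∑ u, w u * ∑ i, |D (Function.update v i u)| / |D v| * |x (v i)| :=
        Finset.sum_le_sum fun u _ => mul_le_mul_of_nonneg_left (hb u) (hw u).le
    _ = _ := by
        simp_rw [Finset.mul_sum]
        rw [Finset.sum_comm]
        refine Finset.sum_congr rfl fun i _ => ?_
        simp only [c]
        rw [Finset.sum_div, Finset.sum_mul]
        refine Finset.sum_congr rfl fun u _ => ?_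
        ring

lemma lemD {V : Type*} [Fintype V] (w : V → ℝ) (hw : ∀ v, 0 < w v)
    (E : Submodule ℝ (V → ℝ)) (r : ℕ) (hE : Module.finrank ℝ E ≤ r)
    (eb : V → ℝ) (heb : ∀ v, 0 ≤ eb v) :
    ∃ (k : ℕ) (v : Fin k → V) (c : Fin k → ℝ), k ≤ r ∧ (∀ i, 0 ≤ c i) ∧
      (∀ x ∈ E, ∑ u, w u * |x u| ≤ ∑ i, c i * |x (v i)|) ∧
      ∑ i, c i * eb (v i) ≤ r * ∑ u, w u * eb u := by
  obtain ⟨v, c, h1, h2, h3⟩ := lemD0 w hw E eb heb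
  refine ⟨_, v, c, hE, h1, h2, h3.trans ?_⟩
  refine mul_le_mul_of_nonneg_right (by exact_mod_cast hE) ?_
  exact Finset.sum_nonneg fun u _ => mul_nonneg (hw u).le (heb u)

lemma markov_half {α : Type*} (Y : Finset α) (f : α → ℝ) (hf : ∀ y ∈ Y, 0 ≤ f y) (B : ℝ)
    (h : ∑ y ∈ Y, f y ≤ Y.card * B) :
    Y.card ≤ 2 * (Y.filter fun y => f y ≤ 2 * B).card := by
  have hsplit := Finset.card_filter_add_card_filter_not (s := Y) (fun y => f y ≤ 2 * B)
  set Y1 := Y.filter fun y => f y ≤ 2 * B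
  set Y2 := Y.filter fun y => ¬ f y ≤ 2 * B with hY2
  have h1 : ∑ y ∈ Y2, f y ≤ ∑ y ∈ Y, f y :=
    Finset.sum_le_sum_of_subset_of_nonneg (Finset.filter_subset _ _) fun y hy _ => hf y hy
  rcases Y2.eq_empty_or_nonempty with h0 | h0
  · rw [h0] at hsplit; simp at hsplit; omega
  have h2 : (Y2.card : ℝ) * (2 * B) < ∑ y ∈ Y2, f y := by
    rw [← nsmul_eq_mul, ← Finset.sum_const]
    refine Finset.sum_lt_sum_of_nonempty h0 fun y hy => ?_
    exact not_le.1 (Finset.mem_filter.1 hy).2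
  have hB : 0 ≤ B := by
    by_contra hB
    obtain ⟨y, hy⟩ := h0
    have : 0 < (Y.card : ℝ) := by
      exact_mod_cast Finset.card_pos.2 ⟨y, (Finset.mem_filter.1 hy).1⟩
    have := Finset.sum_nonneg hf
    nlinarith
  have h3 : (Y2.card : ℝ) * 2 * B < Y.card * B := by linarith
  have h4 : (Y2.card : ℝ) * 2 < Y.card := lt_of_mul_lt_mul_right h3 hB
  have h5 : Y2.card * 2 < Y.card := by exact_mod_cast h4
  omega

lemma pigeon {α β : Type*} (Y : Finset α) (T : Finset β) (f : α → β) (hf : ∀ y ∈ Y, f y ∈ T)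
    (hY : Y.Nonempty) :
    ∃ b ∈ T, ∃ Y' ⊆ Y, (∀ y ∈ Y', f y = b) ∧ Y.card ≤ T.card * Y'.card := by
  obtain ⟨y, hy⟩ := hY
  have hT : T.Nonempty := ⟨_, hf y hy⟩
  obtain ⟨b, hb, hmax⟩ := T.exists_max_image (fun b => (Y.filter fun y => f y = b).card) hT
  refine ⟨b, hb, Y.filter fun y => f y = b, Finset.filter_subset _ _,
    fun y hy => (Finset.mem_filter.1 hy).2, ?_⟩
  rw [Finset.card_eq_sum_card_fiberwise hf, ← smul_eq_mul, ← Finset.sum_const]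
  exact Finset.sum_le_sum fun c hc => hmax c hc

lemma cov_vec {V α : Type*} [Fintype V] (w : V → ℝ) (hw : ∀ v, 0 < w v)
    (E : Submodule ℝ (V → ℝ)) (r : ℕ) (hr : 1 ≤ r) (hE : Module.finrank ℝ E ≤ r)
    (Y : Finset α) (hY : Y.Nonempty) (x : α → V → ℝ) (hx : ∀ y ∈ Y, x y ∈ E) (R ε : ℝ) (hε : 0 < ε)
    (hR : ∀ y ∈ Y, ∑ v, w v * |x y v| ≤ R) (X : ℕ) (hX : 2 * r ^ 2 * R ≤ X * ε) :
    ∃ Y' ⊆ Y, Y.card ≤ 2 * (2 * X + 1) ^ r * Y'.card ∧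
      ∀ y ∈ Y', ∀ y' ∈ Y', ∑ v, w v * |x y v - x y' v| ≤ ε := by
  obtain ⟨k, v, c, hE, hc, h1, h2⟩ := lemD w hw E r hE (fun v => ∑ y ∈ Y, |x y v|)
    (fun v => Finset.sum_nonneg fun y _ => abs_nonneg _)
  have hR0 : 0 ≤ R := by
    obtain ⟨y, hy⟩ := hY
    exact (Finset.sum_nonneg fun v _ => mul_nonneg (hw v).le (abs_nonneg _)).trans (hR y hy)
  have hkr : (k : ℝ) ≤ r := by exact_mod_cast hE
  have hr0 : (0 : ℝ) < r := by exact_mod_cast hr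
  have hm := markov_half Y (fun y => ∑ i, c i * |x y (v i)|)
    (fun y _ => Finset.sum_nonneg fun i _ => mul_nonneg (hc i) (abs_nonneg _)) (r * R) (by
      calc ∑ y ∈ Y, ∑ i, c i * |x y (v i)| = ∑ i, c i * ∑ y ∈ Y, |x y (v i)| := by
            rw [Finset.sum_comm]; simp_rw [Finset.mul_sum]
        _ ≤ r * ∑ u, w u * ∑ y ∈ Y, |x y u| := h2
        _ = r * ∑ y ∈ Y, ∑ u, w u * |x y u| := by
            rw [Finset.sum_comm]; simp_rw [Finset.mul_sum]
        _ ≤ r * ∑ y ∈ Y, R := by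
            exact mul_le_mul_of_nonneg_left (Finset.sum_le_sum hR) hr0.le
        _ = _ := by simp; ring)
  set Y1 := Y.filter fun y => ∑ i, c i * |x y (v i)| ≤ 2 * (r * R) with hY1
  have hY1n : Y1.Nonempty := by
    rw [← Finset.card_pos]
    have := Finset.card_pos.2 hY
    omega
  let f : α → Fin k → ℤ := fun y i => ⌊c i * x y (v i) * r / ε⌋
  obtain ⟨b, hb, Y2, hY2, hfb, hcard⟩ := pigeon Y1 (Fintype.piFinset fun _ : Fin k => Finset.Icc (-(X : ℤ)) X) f
    (by
      intro y hy
      rw [Fintype.mem_piFinset]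
      intro i
      have hy2 := (Finset.mem_filter.1 hy).2
      have h3 : c i * |x y (v i)| ≤ 2 * (r * R) :=
        (Finset.single_le_sum (f := fun i => c i * |x y (v i)|)
          (fun i _ => mul_nonneg (hc i) (abs_nonneg _)) (Finset.mem_univ i)).trans hy2
      have h4 : |c i * x y (v i) * r / ε| ≤ X := by
        rw [abs_div, abs_mul, abs_mul, abs_of_nonneg (hc i), abs_of_pos hε, abs_of_pos hr0,
          div_le_iff₀ hε]
        calc c i * |x y (v i)| * r ≤ 2 * (r * R) * r := mul_le_mul_of_nonneg_right h3 hr0.le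
          _ = 2 * r ^ 2 * R := by ring
          _ ≤ _ := hX
      rw [abs_le] at h4
      rw [Finset.mem_Icc]
      constructor
      · rw [Int.le_floor]; push_cast; linarith
      · have : (⌊c i * x y (v i) * r / ε⌋ : ℝ) ≤ X := (Int.floor_le _).trans h4.2
        exact_mod_cast this) hY1n
  refine ⟨Y2, hY2.trans (Finset.filter_subset _ _), ?_, ?_⟩
  · rw [Fintype.card_piFinset] at hcard
    simp only [Int.card_Icc, Finset.prod_const, Finset.card_univ, Fintype.card_fin] at hcard
    have e1 : ((X : ℤ) + 1 - -(X : ℤ)).toNat = 2 * X + 1 := by omega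
    rw [e1] at hcard
    have h5 : (2 * X + 1) ^ k ≤ (2 * X + 1) ^ r := Nat.pow_le_pow_right (by omega) hE
    calc Y.card ≤ 2 * Y1.card := hm
      _ ≤ 2 * ((2 * X + 1) ^ r * _) :=
        Nat.mul_le_mul_left _ (hcard.trans (Nat.mul_le_mul_right _ h5))
      _ = _ := (mul_assoc _ _ _).symm
  · intro y hy y' hy'
    have hyY := hx y (Finset.mem_filter.1 (hY2 hy)).1
    have hyY' := hx y' (Finset.mem_filter.1 (hY2 hy')).1
    have h6 := h1 (x y - x y') (E.sub_mem hyY hyY')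
    refine h6.trans ?_
    have h7 : ∀ i, c i * |(x y - x y') (v i)| ≤ ε / r := by
      intro i
      have e1 : f y i = f y' i := by rw [hfb y hy, hfb y' hy']
      have := Int.abs_sub_lt_one_of_floor_eq_floor e1
      rw [← sub_div, ← sub_mul, ← mul_sub, abs_div, abs_mul, abs_mul, abs_of_nonneg (hc i),
        abs_of_pos hε, abs_of_pos hr0, div_lt_iff₀ hε, one_mul] at this
      rw [Pi.sub_apply, le_div_iff₀ hr0]
      exact this.le
    calc ∑ i, c i * |(x y - x y') (v i)| ≤ ∑ i : Fin k, ε / r := Finset.sum_le_sum fun i _ => h7 i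
      _ = k * (ε / r) := by simp
      _ ≤ r * (ε / r) := mul_le_mul_of_nonneg_right hkr (by positivity)
      _ = ε := by field_simp

def Rk {G : Type*} [CommGroup G] (P : Finset G) (r : ℕ) : Prop :=
  ∃ h : Fin r → G, ∀ p ∈ P, ∀ q ∈ P, ∃ N : ℕ, 0 < N ∧
    (p / q) ^ N ∈ Subgroup.closure (Set.range h)

lemma Rk.mono {G : Type*} [CommGroup G] {P Q : Finset G} {r : ℕ} (h : Rk P r) (hQ : Q ⊆ P) :
    Rk Q r := by
  obtain ⟨h, hh⟩ := h
  exact ⟨h, fun p hp q hq => hh p (hQ hp) q (hQ hq)⟩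

section
variable {K : Type} [Field K]

lemma PSys.rk_space (Z : PSys K) {P : Finset Kˣ} {r : ℕ} (h : Rk P r) :
    ∃ E : Submodule ℝ (Z.V → ℝ), Module.finrank ℝ E ≤ r ∧
      ∀ p ∈ P, ∀ q ∈ P, (fun v => Z.L (p / q) v) ∈ E := by
  obtain ⟨h, hh⟩ := h
  refine ⟨Submodule.span ℝ (Set.range fun i => Z.L (h i)), ?_, ?_⟩
  · refine (finrank_range_le_card (R := ℝ) (fun i => Z.L (h i))).trans ?_
    simp
  · intro p hp q hq
    obtain ⟨N, hN, hmem⟩ := hh p hp q hq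
    have key : ∀ x ∈ Subgroup.closure (Set.range h),
        (fun v => Z.L x v) ∈ Submodule.span ℝ (Set.range fun i => Z.L (h i)) := by
      intro x hx
      induction hx using Subgroup.closure_induction with
      | mem y hy =>
        obtain ⟨i, rfl⟩ := hy
        exact Submodule.subset_span ⟨i, rfl⟩
      | one =>
        simp only [PSys.L_one]
        exact Submodule.zero_mem _
      | mul y z _ _ h1 h2 =>
        have := Submodule.add_mem _ h1 h2
        convert this using 1
        ext v; exact Z.L_mul y z v
      | inv y _ h1 =>
        have := Submodule.neg_mem _ h1
        convert this using 1
        ext v; exact Z.L_inv y v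
    have h1 := key _ hmem
    have h2 := Submodule.smul_mem _ ((N : ℝ)⁻¹) h1
    convert h2 using 1
    ext v
    have : (N : ℝ) ≠ 0 := by exact_mod_cast hN.ne'
    simp only [Pi.smul_apply, smul_eq_mul, PSys.L_pow]
    field_simp

variable [HField K]

lemma cov_hgt {P Y : Finset Kˣ} {r : ℕ} (hr : 1 ≤ r) (hRk : Rk P r) (hYP : Y ⊆ P)
    (hY : Y.Nonempty) {y0 : Kˣ} (hy0 : y0 ∈ P) {R ε : ℝ} (hε : 0 < ε)
    (hR : ∀ y ∈ Y, hgt (y / y0) ≤ R) (X : ℕ) (hX : 2 * r ^ 2 * R ≤ X * ε) :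
    ∃ Y' ⊆ Y, Y.card ≤ 2 * (2 * X + 1) ^ r * Y'.card ∧
      ∀ y ∈ Y', ∀ y' ∈ Y', hgt (y / y') ≤ ε := by
  obtain ⟨Z, hZ⟩ := HField.good P
  have hmem : ∀ p ∈ P, ∀ q ∈ P, p / q ∈ Subgroup.closure (P : Set Kˣ) := fun p hp q hq =>
    div_mem (Subgroup.subset_closure hp) (Subgroup.subset_closure hq)
  obtain ⟨E, hE, hEm⟩ := Z.rk_space hRk
  obtain ⟨Y', h1, h2, h3⟩ := cov_vec Z.w Z.w_pos E r hr hE Y hY (fun y v => Z.L (y / y0) v)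
    (fun y hy => hEm y (hYP hy) y0 hy0) R ε hε (fun y hy => by
      have := (hZ _ (hmem y (hYP hy) y0 hy0)).2
      have h4 := hR y hy
      rw [hgt, ← this] at h4
      exact h4) X hX
  refine ⟨Y', h1, h2, fun y hy y' hy' => ?_⟩
  have h4 := h3 y hy y' hy'
  have := (hZ _ (hmem y (hYP (h1 hy)) y' (hYP (h1 hy')))).2
  rw [hgt, ← this]
  refine le_trans (le_of_eq ?_) h4
  unfold PSys.ht
  refine Finset.sum_congr rfl fun v _ => ?_
  simp only [PSys.L_div]
  congr 2; ring


lemma PSys.av_sum_le (Z : PSys K) (v : Z.V) {ι : Type*} (J : Finset ι) (z : ι → K) (B : ℝ)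
    (hB : 0 ≤ B) (h : ∀ m ∈ J, Z.av v (z m) ≤ B) :
    Z.av v (∑ m ∈ J, z m) ≤ (if Z.arch v then (J.card : ℝ) else 1) * B := by
  split_ifs with ha
  · refine ((Z.av v).sum_le J z).trans ?_
    rw [← nsmul_eq_mul]
    exact Finset.sum_le_card_nsmul _ _ _ h
  · rw [one_mul]
    induction J using Finset.induction_on with
    | empty => simpa using hB
    | insert a s has ih =>
      rw [Finset.sum_insert has]
      refine (Z.ultra v ha _ _).trans (max_le (h a (by simp)) (ih fun m hm => h m (by simp [hm])))


lemma PSys.near_pair (Z : PSys K) (v : Z.V) {ι : Type*} (I : Finset ι) (hI : I.Nonempty)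
    (z : ι → K) (hz : ∀ m ∈ I, z m ≠ 0) (hsum : ∑ m ∈ I, z m = 0) (s : ℕ) (hs : I.card ≤ s) :
    ∃ m ∈ I, ∃ m' ∈ I, m ≠ m' ∧
      |Real.log (Z.av v (z m)) - Real.log (Z.av v (z m'))| ≤
        if Z.arch v then Real.log s else 0 := by
  obtain ⟨m, hm, hmax⟩ := I.exists_max_image (fun m => Z.av v (z m)) hI
  have h1 : z m + ∑ k ∈ I.erase m, z k = 0 := by rw [Finset.add_sum_erase _ _ hm, hsum]
  have hne : (I.erase m).Nonempty := by
    by_contra h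
    rw [Finset.not_nonempty_iff_eq_empty] at h
    rw [h] at h1
    simp at h1
    exact hz m hm h1
  obtain ⟨m', hm', hmax'⟩ := (I.erase m).exists_max_image (fun m => Z.av v (z m)) hne
  have hm'I := Finset.mem_of_mem_erase hm'
  refine ⟨m, hm, m', hm'I, (Finset.ne_of_mem_erase hm').symm, ?_⟩
  have p1 : 0 < Z.av v (z m) := (Z.av v).pos (hz m hm)
  have p2 : 0 < Z.av v (z m') := (Z.av v).pos (hz m' hm'I)
  have h2 : Real.log (Z.av v (z m')) ≤ Real.log (Z.av v (z m)) :=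
    Real.log_le_log p2 (hmax m' hm'I)
  rw [abs_of_nonneg (by linarith)]
  have h3 : Z.av v (z m) ≤ (if Z.arch v then ((I.erase m).card : ℝ) else 1) * Z.av v (z m') := by
    rw [eq_neg_of_add_eq_zero_left h1, AbsoluteValue.map_neg]
    exact Z.av_sum_le v _ _ _ p2.le hmax'
  have hc1 : 1 ≤ (I.erase m).card := Finset.card_pos.2 hne
  have hc2 : (I.erase m).card ≤ s := (Finset.card_le_card (Finset.erase_subset _ _)).trans hs
  have h4 := Real.log_le_log p1 h3
  split_ifs at h4 ⊢ with ha
  · rw [Real.log_mul (by positivity) p2.ne'] at h4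
    have : Real.log ((I.erase m).card : ℝ) ≤ Real.log s :=
      Real.log_le_log (by exact_mod_cast hc1) (by exact_mod_cast hc2)
    linarith
  · rw [one_mul] at h4; linarith

lemma hgt_sub (u u' β : Kˣ) (h : (β : K) = u - u') :
    hgt β ≤ 2 * Real.log 2 + 2 * hgt u + 2 * hgt u' := by
  obtain ⟨Z, hZ⟩ := HField.good ({u, u', β} : Finset Kˣ)
  have hm : ∀ x ∈ ({u, u', β} : Finset Kˣ), Z.PF x ∧ Z.ht x = hgt x := fun x hx =>
    hZ x (Subgroup.subset_closure hx)
  have h1 := (hm u (by simp)).2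
  have h2 := (hm u' (by simp)).2
  have h3 := hm β (by simp)
  rw [← h1, ← h2, ← h3.2]
  have key : ∀ v, |Z.L β v| ≤ 2 * ((if Z.arch v then Real.log 2 else 0) + |Z.L u v| + |Z.L u' v|)
      - Z.L β v := by
    intro v
    have hl2 : 0 ≤ Real.log 2 := Real.log_nonneg (by norm_num)
    have h4 : Z.L β v ≤ (if Z.arch v then Real.log 2 else 0) + |Z.L u v| + |Z.L u' v| := by
      have hB : ∀ x : Kˣ, Z.av v (x : K) = Real.exp (Z.L x v) := fun x => by
        unfold PSys.L; rw [Real.exp_log (Z.av_pos x v)]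
      have e1 : Z.av v (u : K) ≤ Real.exp (|Z.L u v| + |Z.L u' v|) := by
        rw [hB]; apply Real.exp_le_exp.2
        have := le_abs_self (Z.L u v); have := abs_nonneg (Z.L u' v); linarith
      have e2 : Z.av v (-u' : K) ≤ Real.exp (|Z.L u v| + |Z.L u' v|) := by
        rw [AbsoluteValue.map_neg, hB]; apply Real.exp_le_exp.2
        have := le_abs_self (Z.L u' v); have := abs_nonneg (Z.L u v); linarith
      unfold PSys.L
      rw [h, sub_eq_add_neg]
      have hpos : 0 < Z.av v ((u : K) + -u') := by
        rw [← sub_eq_add_neg, ← h]; exact Z.av_pos β v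
      rw [Real.log_le_iff_le_exp hpos]
      change _ ≤ Real.exp (_ + |Z.L u v| + |Z.L u' v|)
      split_ifs with ha
      · rw [add_assoc, Real.exp_add, Real.exp_log (by norm_num)]
        refine ((Z.av v).add_le _ _).trans ?_
        linarith
      · rw [zero_add]
        exact (Z.ultra v ha _ _).trans (max_le e1 e2)
    have h5 : 0 ≤ (if Z.arch v then Real.log 2 else 0) + |Z.L u v| + |Z.L u' v| := by
      split_ifs <;> positivity
    rcases abs_cases (Z.L β v) with ⟨h6, _⟩ | ⟨h6, _⟩ <;> rw [h6] <;> linarith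
  have hPF := h3.1
  unfold PSys.PF at hPF
  have harch := Z.arch_sum
  calc Z.ht β ≤ ∑ v, Z.w v * (2 * ((if Z.arch v then Real.log 2 else 0) + |Z.L u v| + |Z.L u' v|)
      - Z.L β v) := Finset.sum_le_sum fun v _ => mul_le_mul_of_nonneg_left (key v) (Z.w_pos v).le
    _ = 2 * Real.log 2 * (∑ v : Z.V, (if Z.arch v then Z.w v else 0)) + 2 * Z.ht u + 2 * Z.ht u'
        - ∑ v, Z.w v * Z.L β v := by
      unfold PSys.ht
      rw [Finset.mul_sum, Finset.mul_sum, Finset.mul_sum, ← Finset.sum_add_distrib,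
        ← Finset.sum_add_distrib, ← Finset.sum_sub_distrib]
      refine Finset.sum_congr rfl fun v _ => ?_
      split_ifs <;> ring
    _ = _ := by rw [harch, hPF]; ring
end

noncomputable def mon {n : ℕ} {M : Type*} [CommMonoid M] (m : Fin n →₀ ℕ) (p : Fin n → M) : M :=
  ∏ j, p j ^ m j

section
variable {K : Type} [Field K] [HField K]

lemma hgt_mon_le {n d : ℕ} (m : Fin n →₀ ℕ) (hm : ∑ j, m j ≤ d) (p : Fin n → Kˣ) (ε : ℝ)
    (hε : 0 ≤ ε) (h : ∀ j, hgt (p j) ≤ ε) : hgt (mon m p) ≤ d * ε := by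
  unfold mon
  refine (hgt_prod _ _).trans ?_
  calc ∑ j, hgt (p j ^ m j) ≤ ∑ j, (m j : ℝ) * ε := by
        refine Finset.sum_le_sum fun j _ => ?_
        rw [hgt_pow]
        exact mul_le_mul_of_nonneg_left (h j) (Nat.cast_nonneg _)
    _ = (∑ j, m j : ℕ) * ε := by rw [← Finset.sum_mul]; push_cast; rfl
    _ ≤ _ := mul_le_mul_of_nonneg_right (by exact_mod_cast hm) hε

lemma mon_div {n : ℕ} {G : Type*} [CommGroup G] (m : Fin n →₀ ℕ) (p q : Fin n → G) :
    mon m (p / q) = mon m p / mon m q := by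
  unfold mon
  rw [← Finset.prod_div_distrib]
  refine Finset.prod_congr rfl fun j _ => ?_
  rw [Pi.div_apply, div_pow]

lemma PSys.L_mon (Z : PSys K) {n : ℕ} (m : Fin n →₀ ℕ) (p : Fin n → Kˣ) (v : Z.V) :
    Z.L (mon m p) v = ∑ j, (m j : ℝ) * Z.L (p j) v := by
  unfold mon
  rw [Z.L_prod]
  exact Finset.sum_congr rfl fun j _ => Z.L_pow _ _ _

lemma scale_exists (P : Finset Kˣ) (hP : P.Nonempty) (τ : ℝ) (hτ : τ < 1) (ρ0 : ℝ) (hρ0 : 0 < ρ0)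
    (hNC : ∀ g ∈ P, ((P.filter fun p => hgt (p / g) ≤ ρ0).card : ℝ) ≤ τ * P.card) :
    ∃ ρ ≥ ρ0, (∀ g ∈ P, ((P.filter fun p => hgt (p / g) ≤ ρ).card : ℝ) ≤ τ * P.card) ∧
      ∃ g ∈ P, τ * P.card < ((P.filter fun p => hgt (p / g) ≤ 2 * ρ).card : ℝ) := by
  have hex : ∃ k : ℕ, ∃ g ∈ P,
      τ * P.card < ((P.filter fun p => hgt (p / g) ≤ 2 ^ k * ρ0).card : ℝ) := by
    obtain ⟨g, hg⟩ := hP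
    obtain ⟨M, hM⟩ : ∃ M : ℝ, ∀ p ∈ P, hgt (p / g) ≤ M := by
      obtain ⟨p, hp, hmax⟩ := P.exists_max_image (fun p => hgt (p / g)) ⟨g, hg⟩
      exact ⟨_, hmax⟩
    obtain ⟨k, hk⟩ := pow_unbounded_of_one_lt (M / ρ0) (one_lt_two (α := ℝ))
    refine ⟨k, g, hg, ?_⟩
    rw [Finset.filter_true_of_mem]
    · have : (0 : ℝ) < P.card := by exact_mod_cast Finset.card_pos.2 ⟨g, hg⟩
      nlinarith
    · intro p hp
      refine (hM p hp).trans ?_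
      rw [div_lt_iff₀ hρ0] at hk
      exact hk.le
  have hmin := fun {m} => Nat.find_min hex (m := m)
  obtain ⟨g, hg, hgt1⟩ := Nat.find_spec hex
  set k := Nat.find hex
  have hk : k ≠ 0 := by
    intro h0
    rw [h0] at hgt1
    have := hNC g hg
    simp only [pow_zero, one_mul] at hgt1
    linarith
  obtain ⟨j, hj⟩ := Nat.exists_eq_succ_of_ne_zero hk
  refine ⟨2 ^ j * ρ0, ?_, ?_, g, hg, ?_⟩
  · have : (1 : ℝ) ≤ 2 ^ j := one_le_pow₀ (by norm_num)
    nlinarith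
  · intro g' hg'
    by_contra hc
    exact hmin (m := j) (by omega) ⟨g', hg', not_le.1 hc⟩
  · rw [hj, pow_succ'] at hgt1
    rwa [← mul_assoc]

lemma pop_half (P : Finset Kˣ) (r : ℕ) (hr : 1 ≤ r) (hRk : Rk P r) (hP : P.Nonempty)
    (K1 : ℝ) (hK1 : 1 ≤ K1) (hPP : ((P * P).card : ℝ) ≤ K1 * P.card) (τ : ℝ) (hτ : 0 < τ)
    (ρ ε : ℝ) (hε : 0 < ε) (X : ℕ) (hX : 8 * r ^ 2 * ρ ≤ X * ε)
    (g : Kˣ) (hg : τ * P.card < ((P.filter fun p => hgt (p / g) ≤ 2 * ρ).card : ℝ)) :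
    P.card ≤ 2 * (P.filter fun g => τ * P.card ≤
      4 * K1 * (2 * X + 1) ^ r * ((P.filter fun p => hgt (p / g) ≤ ε).card : ℝ)).card := by
  by_contra hcon
  push Not at hcon
  have hPc : (0 : ℝ) < P.card := by exact_mod_cast Finset.card_pos.2 hP
  have hsplit := Finset.card_filter_add_card_filter_not (s := P) (fun g => τ * P.card ≤
      4 * K1 * (2 * X + 1) ^ r * ((P.filter fun p => hgt (p / g) ≤ ε).card : ℝ))
  set Bad := P.filter fun g => ¬ (τ * P.card ≤
      4 * K1 * (2 * X + 1) ^ r * ((P.filter fun p => hgt (p / g) ≤ ε).card : ℝ)) with hBad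
  have hBadc : P.card < 2 * Bad.card := by omega
  set B0 := P.filter fun p => hgt (p / g) ≤ 2 * ρ with hB0
  have hB0c : 0 < (B0.card : ℝ) := (by positivity : 0 ≤ τ * P.card).trans_lt hg
  have hB0n : B0.Nonempty := Finset.card_pos.1 (by exact_mod_cast hB0c)
  obtain ⟨F, hFP, hFc, hcov⟩ := Finset.ruzsa_covering_mul (A := P) (B := B0) (K := K1 / τ) hB0n (by
    calc ((P * B0).card : ℝ) ≤ (P * P).card := by
          exact_mod_cast Finset.card_le_card (Finset.mul_subset_mul_left (Finset.filter_subset _ _))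
      _ ≤ K1 * P.card := hPP
      _ = K1 / τ * (τ * P.card) := by field_simp
      _ ≤ K1 / τ * B0.card := mul_le_mul_of_nonneg_left hg.le (by positivity))
  have hBadn : Bad.Nonempty := by
    rw [← Finset.card_pos]; omega
  have hch : ∀ p : Kˣ, ∃ f, p ∈ P → f ∈ F ∧ hgt (p / f) ≤ 4 * ρ := by
    intro p
    by_cases hp : p ∈ P
    · obtain ⟨f, hf, x, hx, hfx⟩ := Finset.mem_mul.1 (hcov hp)
      obtain ⟨a, ha, b, hb, hab⟩ := Finset.mem_div.1 hx
      refine ⟨f, fun _ => ⟨hf, ?_⟩⟩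
      rw [← hfx, mul_div_cancel_left, ← hab]
      refine (hgt_tri a g b).trans ?_
      have h1 := (Finset.mem_filter.1 ha).2
      have h2 := (Finset.mem_filter.1 hb).2
      rw [hgt_div_comm] at h2
      linarith
    · exact ⟨1, fun h => absurd h hp⟩
  choose f hf using hch
  obtain ⟨b, hbF, Y, hYB, hYb, hYc⟩ := pigeon Bad F f
    (fun y hy => (hf y (Finset.mem_filter.1 hy).1).1) hBadn
  have hYP : Y ⊆ P := hYB.trans (Finset.filter_subset _ _)
  have hYn : Y.Nonempty := by
    rw [← Finset.card_pos]
    rcases Nat.eq_zero_or_pos Y.card with h0 | h0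
    · rw [h0] at hYc; omega
    · exact h0
  obtain ⟨Y', hY'Y, hY'c, hY'd⟩ := cov_hgt hr hRk hYP hYn (hFP hbF) hε (R := 4 * ρ)
    (fun y hy => by
      have := (hf y (hYP hy)).2
      rwa [hYb y hy] at this) X (by linarith)
  have hY'n : Y'.Nonempty := by
    rw [← Finset.card_pos]
    have := Finset.card_pos.2 hYn
    rcases Nat.eq_zero_or_pos Y'.card with h0 | h0
    · rw [h0] at hY'c; omega
    · exact h0
  obtain ⟨y, hy⟩ := hY'n
  have hyB := (Finset.mem_filter.1 (hYB (hY'Y hy))).2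
  apply hyB
  have h1 : (Y'.card : ℝ) ≤ ((P.filter fun p => hgt (p / y) ≤ ε).card : ℝ) := by
    have : Y' ⊆ P.filter fun p => hgt (p / y) ≤ ε := fun y' hy' =>
      Finset.mem_filter.2 ⟨hYP (hY'Y hy'), hY'd y' hy' y hy⟩
    exact_mod_cast Finset.card_le_card this
  have h2 : (Y.card : ℝ) ≤ 2 * (2 * X + 1) ^ r * Y'.card := by exact_mod_cast hY'c
  have h3 : (Bad.card : ℝ) ≤ F.card * Y.card := by exact_mod_cast hYc
  have h4 : (P.card : ℝ) ≤ 2 * Bad.card := by exact_mod_cast hBadc.le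
  have h5 : (P.card : ℝ) ≤ 2 * (K1 / τ * (2 * (2 * X + 1) ^ r * Y'.card)) := by
    refine h4.trans (mul_le_mul_of_nonneg_left ?_ (by norm_num))
    refine h3.trans (mul_le_mul hFc h2 (by positivity) (by positivity))
  calc τ * P.card ≤ τ * (2 * (K1 / τ * (2 * (2 * X + 1) ^ r * Y'.card))) :=
        mul_le_mul_of_nonneg_left h5 hτ.le
    _ = 4 * K1 * (2 * X + 1) ^ r * Y'.card := by field_simp; ring
    _ ≤ _ := mul_le_mul_of_nonneg_left h1 (by positivity)

lemma bad_pairs {n d s : ℕ} (hs1 : 1 ≤ s) (S : Finset (Fin n →₀ ℕ)) (hSd : ∀ m ∈ S, ∑ j, m j ≤ d)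
    (hs : S.card ≤ s) (c : (Fin n →₀ ℕ) → K) (hc : ∀ m ∈ S, c m ≠ 0) (ε : ℝ) (hε : 0 < ε)
    (g p q : Fin n → Kˣ) (hp : ∀ j, hgt (p j / g j) ≤ ε) (hq : ∀ j, hgt (q j / g j) ≤ ε)
    (J : Finset (Fin n →₀ ℕ)) (hJ : J ⊆ S)
    (hsum : ∑ m ∈ J, c m * ((mon m p : Kˣ) - (mon m q : Kˣ) : K) = 0)
    (hne : ∃ m ∈ J, mon m p ≠ mon m q)
    (Z : PSys K) (hZ : ∀ m ∈ S, ∀ β : Kˣ, (β : K) = (mon m p : Kˣ) - (mon m q : Kˣ) →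
      Z.ht (β / mon m g) = hgt (β / mon m g)) :
    ∃ π : Z.V → (Fin n →₀ ℕ) × (Fin n →₀ ℕ),
      (∀ v, (π v).1 ∈ S ∧ (π v).2 ∈ S ∧ (π v).1 ≠ (π v).2) ∧
      ∑ v, Z.w v * |Real.log (Z.av v (c (π v).1)) - Real.log (Z.av v (c (π v).2))
        + ∑ j, (((π v).1 j : ℝ) - ((π v).2 j : ℝ)) * Z.L (g j) v| ≤ 4 * s * (d + 1) * (ε + 1) := by
  set I := J.filter fun m => mon m p ≠ mon m q with hI
  have hIS : I ⊆ S := (Finset.filter_subset _ _).trans hJ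
  have hIn : I.Nonempty := by
    obtain ⟨m, hm, h⟩ := hne
    exact ⟨m, Finset.mem_filter.2 ⟨hm, h⟩⟩
  have hα : ∀ m ∈ I, ((mon m p : Kˣ) - (mon m q : Kˣ) : K) ≠ 0 := by
    intro m hm h
    exact (Finset.mem_filter.1 hm).2 (Units.ext (sub_eq_zero.1 h))
  have hβ : ∀ m, ∃ β : Kˣ, m ∈ I → (β : K) = (mon m p : Kˣ) - (mon m q : Kˣ) := by
    intro m
    by_cases h : m ∈ I
    · exact ⟨Units.mk0 _ (hα m h), fun _ => rfl⟩
    · exact ⟨1, fun h' => absurd h' h⟩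
  choose β hβ using hβ
  have hsumI : ∑ m ∈ I, c m * (β m : K) = 0 := by
    rw [← hsum]
    rw [Finset.sum_congr rfl (fun m hm => by rw [hβ m hm])]
    refine Finset.sum_subset (Finset.filter_subset _ _) ?_
    intro m hm hm'
    have : mon m p = mon m q := by
      by_contra h
      exact hm' (Finset.mem_filter.2 ⟨hm, h⟩)
    rw [this, sub_self, mul_zero]
  have hpair := fun v => Z.near_pair v I hIn (fun m => c m * (β m : K))
    (fun m hm => mul_ne_zero (hc m (hIS hm)) (β m).ne_zero) hsumI s
    ((Finset.card_le_card hIS).trans hs)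
  choose m1 hm1 m2 hm2 hm12 hlog using hpair
  refine ⟨fun v => (m1 v, m2 v), fun v => ⟨hIS (hm1 v), hIS (hm2 v), hm12 v⟩, ?_⟩
  simp only
  have hlogs : 0 ≤ Real.log s := Real.log_nonneg (by exact_mod_cast hs1)
  have hterm : ∀ v, |Real.log (Z.av v (c (m1 v))) - Real.log (Z.av v (c (m2 v)))
        + ∑ j, ((m1 v j : ℝ) - (m2 v j : ℝ)) * Z.L (g j) v| ≤
      (if Z.arch v then Real.log s else 0) + ∑ m ∈ I, |Z.L (β m / mon m g) v| := by
    intro v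
    have e : ∀ m ∈ I, Real.log (Z.av v (c m * (β m : K))) =
        Real.log (Z.av v (c m)) + Z.L (β m) v := by
      intro m hm
      rw [map_mul, Real.log_mul ((Z.av v).pos (hc m (hIS hm))).ne' (Z.av_pos _ v).ne']; rfl
    have h1 := hlog v
    rw [e _ (hm1 v), e _ (hm2 v)] at h1
    have h2 : |Z.L (β (m1 v) / mon (m1 v) g) v| + |Z.L (β (m2 v) / mon (m2 v) g) v| ≤
        ∑ m ∈ I, |Z.L (β m / mon m g) v| := by
      rw [← Finset.sum_pair (f := fun m => |Z.L (β m / mon m g) v|) (hm12 v)]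
      refine Finset.sum_le_sum_of_subset_of_nonneg ?_ fun _ _ _ => abs_nonneg _
      intro m hm
      rcases Finset.mem_insert.1 hm with rfl | hm
      · exact hm1 v
      · rw [Finset.mem_singleton.1 hm]; exact hm2 v
    rw [Z.L_div, Z.L_div, Z.L_mon, Z.L_mon] at h2
    simp_rw [sub_mul]
    rw [Finset.sum_sub_distrib]
    set a := Real.log (Z.av v (c (m1 v)))
    set b := Real.log (Z.av v (c (m2 v)))
    set u1 := ∑ j, (m1 v j : ℝ) * Z.L (g j) v
    set u2 := ∑ j, (m2 v j : ℝ) * Z.L (g j) v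
    have h3 : |a - b + (u1 - u2)| ≤ |a + Z.L (β (m1 v)) v - (b + Z.L (β (m2 v)) v)| +
        (|Z.L (β (m1 v)) v - u1| + |Z.L (β (m2 v)) v - u2|) := by
      have e3 : a - b + (u1 - u2) = (a + Z.L (β (m1 v)) v - (b + Z.L (β (m2 v)) v)) -
        ((Z.L (β (m1 v)) v - u1) - (Z.L (β (m2 v)) v - u2)) := by ring
      rw [e3]
      refine (abs_sub _ _).trans ?_
      have := abs_sub (Z.L (β (m1 v)) v - u1) (Z.L (β (m2 v)) v - u2)
      linarith
    linarith
  have hd0 : (0 : ℝ) ≤ d := Nat.cast_nonneg _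
  have hs0 : (1 : ℝ) ≤ s := by exact_mod_cast hs1
  have hht : ∀ m ∈ I, Z.ht (β m / mon m g) ≤ 2 + 4 * d * ε := by
    intro m hm
    rw [hZ m (hIS hm) (β m) (hβ m hm)]
    have h1 := hgt_sub (mon m (p / g)) (mon m (q / g)) (β m / mon m g) (by
      rw [mon_div, mon_div]
      simp only [Units.val_div_eq_div_val]
      rw [hβ m hm, sub_div])
    have h2 := hgt_mon_le m (hSd m (hIS hm)) (p / g) ε hε.le hp
    have h3 := hgt_mon_le m (hSd m (hIS hm)) (q / g) ε hε.le hq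
    have h4 := Real.log_two_lt_d9
    linarith
  have hIc : (I.card : ℝ) ≤ s := by exact_mod_cast (Finset.card_le_card hIS).trans hs
  calc ∑ v, Z.w v * |Real.log (Z.av v (c (m1 v))) - Real.log (Z.av v (c (m2 v)))
        + ∑ j, ((m1 v j : ℝ) - (m2 v j : ℝ)) * Z.L (g j) v|
      ≤ ∑ v, Z.w v * ((if Z.arch v then Real.log s else 0) + ∑ m ∈ I, |Z.L (β m / mon m g) v|) :=
        Finset.sum_le_sum fun v _ => mul_le_mul_of_nonneg_left (hterm v) (Z.w_pos v).le
    _ = Real.log s * (∑ v : Z.V, (if Z.arch v then Z.w v else 0)) +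
        ∑ m ∈ I, Z.ht (β m / mon m g) := by
        unfold PSys.ht
        rw [Finset.sum_comm, Finset.mul_sum, ← Finset.sum_add_distrib]
        refine Finset.sum_congr rfl fun v _ => ?_
        rw [mul_add, Finset.mul_sum]
        congr 1
        split_ifs <;> ring
    _ ≤ s + ∑ m ∈ I, (2 + 4 * d * ε) := by
        rw [Z.arch_sum, mul_one]
        refine add_le_add ?_ (Finset.sum_le_sum hht)
        exact (Real.log_le_sub_one_of_pos (by linarith)).trans (by linarith)
    _ = s + I.card * (2 + 4 * d * ε) := by rw [Finset.sum_const, nsmul_eq_mul]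
    _ ≤ s + s * (2 + 4 * d * ε) := by
        have : 0 ≤ 2 + 4 * d * ε := by positivity
        nlinarith
    _ ≤ _ := by
        have h1 : 0 ≤ (s : ℝ) * d := by positivity
        have h2 : 0 ≤ (s : ℝ) * ε := by positivity
        nlinarith
end

lemma digits_ne {n d : ℕ} (a b : Fin n →₀ ℕ) (ha : ∀ j, a j ≤ d) (hb : ∀ j, b j ≤ d)
    (hab : a ≠ b) : (1 : ℝ) ≤ |∑ j, ((a j : ℝ) - (b j : ℝ)) * ((d + 1 : ℕ) : ℝ) ^ (j : ℕ)| := by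
  have key : ∑ j, a j * (d + 1) ^ (j : ℕ) ≠ ∑ j, b j * (d + 1) ^ (j : ℕ) := by
    intro h
    apply hab
    let a' : Fin n → Fin (d + 1) := fun j => ⟨a j, by have := ha j; omega⟩
    let b' : Fin n → Fin (d + 1) := fun j => ⟨b j, by have := hb j; omega⟩
    have : a' = b' := by
      apply finFunctionFinEquiv.injective
      apply Fin.ext
      rw [finFunctionFinEquiv_apply, finFunctionFinEquiv_apply]
      exact h
    ext j
    exact congrArg Fin.val (congrFun this j)
  have e : ∑ j, ((a j : ℝ) - (b j : ℝ)) * ((d + 1 : ℕ) : ℝ) ^ (j : ℕ) =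
      (((∑ j, a j * (d + 1) ^ (j : ℕ) : ℕ) : ℤ) - ((∑ j, b j * (d + 1) ^ (j : ℕ) : ℕ) : ℤ) : ℤ) := by
    push_cast
    simp_rw [sub_mul]
    rw [Finset.sum_sub_distrib]
  rw [e]
  have h1 : (1 : ℤ) ≤ |((∑ j, a j * (d + 1) ^ (j : ℕ) : ℕ) : ℤ) -
      ((∑ j, b j * (d + 1) ^ (j : ℕ) : ℕ) : ℤ)| := by
    apply Int.one_le_abs
    rw [sub_ne_zero]
    exact_mod_cast key
  exact_mod_cast h1

lemma pow_div_card {G : Type*} [CommGroup G] [DecidableEq G] (P : Finset G) (hP : P.Nonempty) (K1 : ℝ)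
    (hPP : ((P * P).card : ℝ) ≤ K1 * P.card) (a b : ℕ) :
    ((P ^ a / P ^ b).card : ℝ) ≤ K1 ^ (a + b) * P.card := by
  have h := Finset.pluennecke_ruzsa_inequality_pow_div_pow_mul hP P a b
  have hPc : (0 : ℝ) < P.card := by exact_mod_cast Finset.card_pos.2 hP
  have h' : ((P ^ a / P ^ b).card : ℝ) ≤ ((P * P).card / P.card : ℝ) ^ (a + b) * P.card := by
    have h2 := (NNRat.cast_le (K := ℝ)).mpr h
    push_cast at h2
    exact h2
  refine h'.trans ?_
  refine mul_le_mul_of_nonneg_right ?_ hPc.le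
  refine pow_le_pow_left₀ (by positivity) ?_ _
  rwa [div_le_iff₀ hPc]

lemma aux_eps (r C2 ρ : ℝ) (hr : 0 < r) (hC : 0 < C2) :
    2 * (r * (C2 * (ρ / (8 * r * C2) + 1))) + 2 * (r * (C2 * (ρ / (8 * r * C2) + 1))) =
    ρ / 2 + 4 * r * C2 := by
  field_simp; ring

section
variable {K : Type} [Field K] [HField K]

set_option maxHeartbeats 1600000 in
theorem largeL {n d s r : ℕ} (P : Finset Kˣ) (hP : P.Nonempty) (K1 : ℝ) (hK1 : 1 ≤ K1)
    (hPP : ((P * P).card : ℝ) ≤ K1 * P.card) (hr : 1 ≤ r) (hRk : Rk P r)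
    (S : Finset (Fin (n + 1) →₀ ℕ)) (hSd : ∀ m ∈ S, ∑ j, m j ≤ d) (hs : S.card ≤ s) (hs1 : 1 ≤ s)
    (c : (Fin (n + 1) →₀ ℕ) → K) (hc : ∀ m ∈ S, c m ≠ 0) (τ : ℝ)
    (hτ : τ = 1 / (2 ^ (n + 3) * s ^ (2 * r) * K1 ^ ((1 + (d + 1) ^ n) * n)))
    (hNC : ∀ g ∈ P, ((P.filter fun p => hgt (p / g) ≤ 32 * r * s * (d + 1)).card : ℝ)
      ≤ τ * P.card) :
    ∃ Q : Fin (n + 1) → Finset Kˣ, (∀ i, Q i ⊆ P ∧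
        τ * P.card ≤ 4 * K1 * (2 * (256 * r ^ 3 * s * (d + 1) : ℕ) + 1) ^ r * (Q i).card) ∧
      ∀ J ⊆ S, ∀ p q : Fin (n + 1) → Kˣ, (∀ i, p i ∈ Q i) → (∀ i, q i ∈ Q i) →
        ∑ m ∈ J, c m * ((mon m p : Kˣ) - (mon m q : Kˣ) : K) = 0 →
        ∀ m ∈ J, mon m p = mon m q := by
  have hPc : (0 : ℝ) < P.card := by exact_mod_cast Finset.card_pos.2 hP
  have hs0 : (1 : ℝ) ≤ s := by exact_mod_cast hs1
  have hr0 : (1 : ℝ) ≤ r := by exact_mod_cast hr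
  have hd0 : (0 : ℝ) ≤ d := Nat.cast_nonneg _
  set DD : ℝ := 2 ^ (n + 3) * s ^ (2 * r) * K1 ^ ((1 + (d + 1) ^ n) * n) with hDD
  have hDD8 : 8 ≤ DD := by
    have h1 : (8 : ℝ) ≤ 2 ^ (n + 3) := by
      rw [pow_add]; have : (1 : ℝ) ≤ 2 ^ n := one_le_pow₀ (by norm_num)
      linarith
    have h2 : (1 : ℝ) ≤ s ^ (2 * r) := one_le_pow₀ hs0
    have h3 : (1 : ℝ) ≤ K1 ^ ((1 + (d + 1) ^ n) * n) := one_le_pow₀ hK1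
    calc (8 : ℝ) = 8 * 1 * 1 := by norm_num
      _ ≤ DD := by rw [hDD]; gcongr
  have hτ0 : 0 < τ := by rw [hτ]; positivity
  have hτ1 : τ < 1 := by rw [hτ, div_lt_one (by linarith)]; linarith
  obtain ⟨ρ, hρ, hρNC, g0, hg0P, hg0⟩ := scale_exists P hP τ hτ1 (32 * r * s * (d + 1))
    (by positivity) hNC
  have hρ0 : 0 < ρ := lt_of_lt_of_le (by positivity) hρ
  set C2 : ℝ := 4 * s * (d + 1) with hC2
  have hC20 : 0 < C2 := by positivity
  set ε : ℝ := ρ / (8 * r * C2) with hε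
  have hε0 : 0 < ε := by positivity
  set X : ℕ := 256 * r ^ 3 * s * (d + 1) with hX
  have hpop := pop_half P r hr hRk hP K1 hK1 hPP τ hτ0 ρ ε hε0 X (by
    rw [hε, hX, hC2]; push_cast
    have : (0 : ℝ) < r := by linarith
    have : (0 : ℝ) < s := by linarith
    apply le_of_eq
    field_simp
    ring) g0 hg0
  set Pop := P.filter fun g => τ * P.card ≤
      4 * K1 * (2 * X + 1) ^ r * ((P.filter fun p => hgt (p / g) ≤ ε).card : ℝ) with hPop
  by_contra hcon
  -- every `g` in `Pop ^ (n+1)` fails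
  have hfail : ∀ g : Fin (n + 1) → Kˣ, (∀ i, g i ∈ Pop) → ∃ J ⊆ S, ∃ p q : Fin (n + 1) → Kˣ,
      (∀ i, p i ∈ P ∧ hgt (p i / g i) ≤ ε) ∧ (∀ i, q i ∈ P ∧ hgt (q i / g i) ≤ ε) ∧
      ∑ m ∈ J, c m * ((mon m p : Kˣ) - (mon m q : Kˣ) : K) = 0 ∧
      ∃ m ∈ J, mon m p ≠ mon m q := by
    intro g hg
    by_contra hno
    apply hcon
    refine ⟨fun i => P.filter fun p => hgt (p / g i) ≤ ε, fun i => ⟨Finset.filter_subset _ _,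
      (Finset.mem_filter.1 (hg i)).2⟩, ?_⟩
    intro J hJ p q hp hq hsum m hm
    by_contra hne
    exact hno ⟨J, hJ, p, q, fun i => Finset.mem_filter.1 (hp i), fun i => Finset.mem_filter.1 (hq i),
      hsum, m, hm, hne⟩
  let box := Fintype.piFinset fun _ : Fin (n + 1) => P
  let un : (Fin (n + 1) →₀ ℕ) × (Fin (n + 1) → Kˣ) × (Fin (n + 1) → Kˣ) → Kˣ := fun t =>
    if h : ((mon t.1 t.2.1 : Kˣ) - (mon t.1 t.2.2 : Kˣ) : K) ≠ 0 then Units.mk0 _ h else 1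
  obtain ⟨Z, hZ⟩ := HField.good (P ∪ (S ×ˢ box ×ˢ box).image un)
  have hGP : ∀ p ∈ P, p ∈ Subgroup.closure
      ((P ∪ (S ×ˢ box ×ˢ box).image un : Finset Kˣ) : Set Kˣ) := fun p hp =>
    Subgroup.subset_closure (Finset.mem_union_left _ hp)
  have hGmon : ∀ m, ∀ g : Fin (n + 1) → Kˣ, (∀ i, g i ∈ P) → mon m g ∈ Subgroup.closure
      ((P ∪ (S ×ˢ box ×ˢ box).image un : Finset Kˣ) : Set Kˣ) := fun m g hg =>
    Subgroup.prod_mem _ fun j _ => pow_mem (hGP _ (hg j)) _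
  have hPopP : Pop ⊆ P := Finset.filter_subset _ _
  have hpi : ∀ g : Fin (n + 1) → Kˣ, ∃ π : Z.V → (Fin (n + 1) →₀ ℕ) × (Fin (n + 1) →₀ ℕ),
      (∀ i, g i ∈ Pop) → (∀ v, (π v).1 ∈ S ∧ (π v).2 ∈ S ∧ (π v).1 ≠ (π v).2) ∧
      ∑ v, Z.w v * |Real.log (Z.av v (c (π v).1)) - Real.log (Z.av v (c (π v).2))
        + ∑ j, (((π v).1 j : ℝ) - ((π v).2 j : ℝ)) * Z.L (g j) v| ≤ C2 * (ε + 1) := by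
    intro g
    by_cases hg : ∀ i, g i ∈ Pop
    · obtain ⟨J, hJ, p, q, hp, hq, hsum, hne⟩ := hfail g hg
      obtain ⟨π, h1, h2⟩ := bad_pairs hs1 S hSd hs c hc ε hε0 g p q (fun j => (hp j).2)
        (fun j => (hq j).2) J hJ hsum hne Z (by
          intro m hm β hβ
          refine (hZ _ (div_mem ?_ (hGmon m g fun i => hPopP (hg i)))).2
          apply Subgroup.subset_closure
          apply Finset.mem_union_right
          rw [Finset.mem_image]
          refine ⟨(m, p, q), ?_, ?_⟩
          · simp only [Finset.mem_product, box, Fintype.mem_piFinset]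
            exact ⟨hm, fun i => (hp i).1, fun i => (hq i).1⟩
          · have h0 : ((mon m p : Kˣ) - (mon m q : Kˣ) : K) ≠ 0 := by
              rw [← hβ]; exact β.ne_zero
            simp only [un]
            rw [dif_pos h0]
            exact Units.ext hβ.symm)
      exact ⟨π, fun _ => ⟨h1, h2⟩⟩
    · exact ⟨fun _ => (0, 0), fun h => absurd h hg⟩
  choose π hπ using hpi
  let e : (Fin (n + 1) → Kˣ) → Z.V → ℝ := fun g v =>
    |Real.log (Z.av v (c (π g v).1)) - Real.log (Z.av v (c (π g v).2))
        + ∑ j, (((π g v).1 j : ℝ) - ((π g v).2 j : ℝ)) * Z.L (g j) v|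
  let Y := Fintype.piFinset fun _ : Fin (n + 1) => Pop
  have hYm : ∀ g, g ∈ Y → ∀ i, g i ∈ Pop := fun g hg => Fintype.mem_piFinset.1 hg
  obtain ⟨E, hE, hEm⟩ := Z.rk_space hRk
  obtain ⟨k, v, cc, hk, hcc, hD1, hD2⟩ := lemD Z.w Z.w_pos E r hE (fun v => ∑ g ∈ Y, e g v)
    (fun v => Finset.sum_nonneg fun g _ => abs_nonneg _)
  have hm := markov_half Y (fun g => ∑ i, cc i * e g (v i))
    (fun g _ => Finset.sum_nonneg fun i _ => mul_nonneg (hcc i) (abs_nonneg _))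
    (r * (C2 * (ε + 1))) (by
      calc ∑ g ∈ Y, ∑ i, cc i * e g (v i) = ∑ i, cc i * ∑ g ∈ Y, e g (v i) := by
            rw [Finset.sum_comm]; simp_rw [Finset.mul_sum]
        _ ≤ r * ∑ u, Z.w u * ∑ g ∈ Y, e g u := hD2
        _ = r * ∑ g ∈ Y, ∑ u, Z.w u * e g u := by
            rw [Finset.sum_comm]; simp_rw [Finset.mul_sum]
        _ ≤ r * ∑ g ∈ Y, C2 * (ε + 1) := by
            refine mul_le_mul_of_nonneg_left (Finset.sum_le_sum fun g hg => ?_) (by linarith)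
            exact (hπ g (hYm g hg)).2
        _ = _ := by rw [Finset.sum_const, nsmul_eq_mul]; ring)
  set Y1 := Y.filter fun g => ∑ i, cc i * e g (v i) ≤ 2 * (r * (C2 * (ε + 1))) with hY1
  have hYc : Y.card = Pop.card ^ (n + 1) := by simp [Y]
  have hPopc : 0 < Pop.card := by have := Finset.card_pos.2 hP; omega
  have hYpos : 0 < Y.card := by rw [hYc]; positivity
  have hY1n : Y1.Nonempty := by rw [← Finset.card_pos]; omega
  let B := d + 1
  let f : (Fin (n + 1) → Kˣ) →
      (Fin k → (Fin (n + 1) →₀ ℕ) × (Fin (n + 1) →₀ ℕ)) × (Fin n → Kˣ) := fun g =>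
    (fun i => π g (v i), fun j => g j.succ / g 0 ^ (B ^ (j.succ : ℕ)))
  obtain ⟨b, hb, Y2, hY2, hfb, hY2c⟩ := pigeon Y1
    ((Fintype.piFinset fun _ : Fin k => S ×ˢ S) ×ˢ
      (Fintype.piFinset fun j : Fin n => P ^ 1 / P ^ (B ^ (j.succ : ℕ)))) f (by
      intro g hg
      have hgY := hYm g (Finset.mem_filter.1 hg).1
      rw [Finset.mem_product, Fintype.mem_piFinset, Fintype.mem_piFinset]
      refine ⟨fun i => ?_, fun j => ?_⟩
      · have := (hπ g hgY).1 (v i)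
        exact Finset.mem_product.2 ⟨this.1, this.2.1⟩
      · refine Finset.div_mem_div ?_ (Finset.pow_mem_pow (hPopP (hgY 0)))
        rw [pow_one]; exact hPopP (hgY _)) hY1n
  have hY2n : Y2.Nonempty := by
    rw [← Finset.card_pos]
    have := Finset.card_pos.2 hY1n
    rcases Nat.eq_zero_or_pos Y2.card with h0 | h0
    · rw [h0] at hY2c; omega
    · exact h0
  obtain ⟨gs, hgs⟩ := hY2n
  have hY2Y : Y2 ⊆ Y := hY2.trans (Finset.filter_subset _ _)
  have hcoord : ∀ g ∈ Y2, ∀ j : Fin (n + 1), g j / gs j = (g 0 / gs 0) ^ (B ^ (j : ℕ)) := by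
    intro g hg j
    refine Fin.cases ?_ (fun j => ?_) j
    · simp
    · have h1 := congrFun (congrArg Prod.snd ((hfb g hg).trans (hfb gs hgs).symm)) j
      simp only [f] at h1
      rw [div_eq_div_iff_mul_eq_mul] at h1
      rw [div_pow, div_eq_div_iff_mul_eq_mul, h1, mul_comm]
  have hpiS : ∀ g ∈ Y2, ∀ i, π g (v i) = b.1 i := fun g hg i =>
    congrFun (congrArg Prod.fst (hfb g hg)) i
  have hball : ∀ g ∈ Y2, hgt (g 0 / gs 0) ≤ ρ := by
    intro g hg
    have hg0P' := hPopP (hYm g (hY2Y hg) 0)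
    have hgs0P' := hPopP (hYm gs (hY2Y hgs) 0)
    have hx := hEm _ hg0P' _ hgs0P'
    rw [hgt, ← (hZ _ (div_mem (hGP _ hg0P') (hGP _ hgs0P'))).2]
    refine (hD1 _ hx).trans ?_
    have hi : ∀ i, |Z.L (g 0 / gs 0) (v i)| ≤ e g (v i) + e gs (v i) := by
      intro i
      have hS := (hπ g (hYm g (hY2Y hg))).1 (v i)
      simp only [e]
      rw [hpiS gs hgs i, hpiS g hg i]
      rw [hpiS g hg i] at hS
      set m1 := (b.1 i).1
      set m2 := (b.1 i).2
      set a0 := Real.log (Z.av (v i) (c m1)) - Real.log (Z.av (v i) (c m2))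
      have hle : ∀ m ∈ S, ∀ j, m j ≤ d := fun m hm j =>
        (Finset.single_le_sum (f := fun j => m j) (fun _ _ => Nat.zero_le _)
          (Finset.mem_univ j)).trans (hSd m hm)
      have h1 := digits_ne m1 m2 (hle m1 hS.1) (hle m2 hS.2.1) hS.2.2
      have h2 : ∑ j, ((m1 j : ℝ) - (m2 j : ℝ)) * Z.L (g j) (v i) -
          ∑ j, ((m1 j : ℝ) - (m2 j : ℝ)) * Z.L (gs j) (v i) =
          (∑ j, ((m1 j : ℝ) - (m2 j : ℝ)) * ((d + 1 : ℕ) : ℝ) ^ (j : ℕ)) *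
            Z.L (g 0 / gs 0) (v i) := by
        rw [← Finset.sum_sub_distrib, Finset.sum_mul]
        refine Finset.sum_congr rfl fun j _ => ?_
        rw [← mul_sub, ← Z.L_div, hcoord g hg j, Z.L_pow]
        simp only [B]
        push_cast
        ring
      calc |Z.L (g 0 / gs 0) (v i)| = 1 * |Z.L (g 0 / gs 0) (v i)| := (one_mul _).symm
        _ ≤ _ := mul_le_mul_of_nonneg_right h1 (abs_nonneg _)
        _ = |(a0 + ∑ j, ((m1 j : ℝ) - (m2 j : ℝ)) * Z.L (g j) (v i)) -
          (a0 + ∑ j, ((m1 j : ℝ) - (m2 j : ℝ)) * Z.L (gs j) (v i))| := by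
            rw [← abs_mul, ← h2]; congr 1; ring
        _ ≤ _ := abs_sub _ _
    calc ∑ i, cc i * |Z.L (g 0 / gs 0) (v i)| ≤ ∑ i, cc i * (e g (v i) + e gs (v i)) :=
          Finset.sum_le_sum fun i _ => mul_le_mul_of_nonneg_left (hi i) (hcc i)
      _ = ∑ i, cc i * e g (v i) + ∑ i, cc i * e gs (v i) := by
          rw [← Finset.sum_add_distrib]
          exact Finset.sum_congr rfl fun i _ => mul_add _ _ _
      _ ≤ 2 * (r * (C2 * (ε + 1))) + 2 * (r * (C2 * (ε + 1))) :=
          add_le_add (Finset.mem_filter.1 (hY2 hg)).2 (Finset.mem_filter.1 (hY2 hgs)).2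
      _ = ρ / 2 + 4 * r * C2 := by
          exact aux_eps _ _ _ (by linarith) hC20
      _ ≤ ρ := by rw [hC2]; linarith
  have hY2le : (Y2.card : ℝ) ≤ τ * P.card := by
    refine le_trans ?_ (hρNC (gs 0) (hPopP (hYm gs (hY2Y hgs) 0)))
    have : Y2.card ≤ (P.filter fun p => hgt (p / gs 0) ≤ ρ).card := by
      refine Finset.card_le_card_of_injOn (fun g => g 0) ?_ ?_
      · intro g hg
        exact Finset.mem_filter.2 ⟨hPopP (hYm g (hY2Y hg) 0), hball g hg⟩
      · intro g hg g' hg' h0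
        simp only at h0
        ext1 j
        have h1 := hcoord g hg j
        have h2 := hcoord g' hg' j
        rw [h0, ← h2] at h1
        exact div_left_injective h1
    exact_mod_cast this
  have hTc : (((Fintype.piFinset fun _ : Fin k => S ×ˢ S) ×ˢ
      (Fintype.piFinset fun j : Fin n => P ^ 1 / P ^ (B ^ (j.succ : ℕ)))).card : ℝ) ≤
      s ^ (2 * r) * (K1 ^ ((1 + (d + 1) ^ n) * n) * (P.card : ℝ) ^ n) := by
    rw [Finset.card_product, Fintype.card_piFinset, Fintype.card_piFinset]
    push_cast
    refine mul_le_mul ?_ ?_ (Finset.prod_nonneg fun _ _ => Nat.cast_nonneg _)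
      (pow_nonneg (by linarith) _)
    · rw [Finset.prod_const, Finset.card_univ, Fintype.card_fin, Finset.card_product]
      push_cast
      have : (S.card : ℝ) ≤ s := by exact_mod_cast hs
      calc ((S.card : ℝ) * S.card) ^ k ≤ ((s : ℝ) * s) ^ k := by gcongr
        _ ≤ ((s : ℝ) * s) ^ r := pow_le_pow_right₀ (by nlinarith) hk
        _ = _ := by rw [pow_mul, pow_two]
    · calc ∏ j : Fin n, ((P ^ 1 / P ^ (B ^ (j.succ : ℕ))).card : ℝ)
          ≤ ∏ j : Fin n, (K1 ^ (1 + (d + 1) ^ n) * P.card) := by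
            refine Finset.prod_le_prod (fun _ _ => Nat.cast_nonneg _) fun j _ => ?_
            refine (pow_div_card P hP K1 hPP _ _).trans ?_
            refine mul_le_mul_of_nonneg_right ?_ hPc.le
            refine pow_le_pow_right₀ hK1 ?_
            have : B ^ (j.succ : ℕ) ≤ (d + 1) ^ n := by
              refine Nat.pow_le_pow_right (by omega) ?_
              rw [Fin.val_succ]; omega
            omega
        _ = _ := by
            rw [Finset.prod_const, Finset.card_univ, Fintype.card_fin, mul_pow, ← pow_mul]
  -- final count
  have f1 : (P.card : ℝ) ^ (n + 1) ≤ 2 ^ (n + 1) * (Y.card : ℝ) := by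
    rw [hYc]; push_cast
    rw [← mul_pow]
    refine pow_le_pow_left₀ hPc.le ?_ _
    exact_mod_cast hpop
  have f2 : (Y.card : ℝ) ≤ 2 * Y1.card := by exact_mod_cast hm
  have f3 : (Y1.card : ℝ) ≤ (s ^ (2 * r) * (K1 ^ ((1 + (d + 1) ^ n) * n) * (P.card : ℝ) ^ n)) *
      (τ * P.card) := by
    have : (Y1.card : ℝ) ≤ (((Fintype.piFinset fun _ : Fin k => S ×ˢ S) ×ˢ
      (Fintype.piFinset fun j : Fin n => P ^ 1 / P ^ (B ^ (j.succ : ℕ)))).card : ℝ) * Y2.card := by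
      exact_mod_cast hY2c
    refine this.trans (mul_le_mul hTc hY2le (Nat.cast_nonneg _) (by positivity))
  have f4 : (P.card : ℝ) ^ (n + 1) ≤ 2 ^ (n + 2) *
      ((s ^ (2 * r) * (K1 ^ ((1 + (d + 1) ^ n) * n) * (P.card : ℝ) ^ n)) * (τ * P.card)) := by
    calc (P.card : ℝ) ^ (n + 1) ≤ 2 ^ (n + 1) * (2 * Y1.card) := f1.trans (by gcongr)
      _ = 2 ^ (n + 2) * Y1.card := by ring
      _ ≤ _ := by gcongr
  have f5 : 2 ^ (n + 2) *
      ((s ^ (2 * r) * (K1 ^ ((1 + (d + 1) ^ n) * n) * (P.card : ℝ) ^ n)) * (τ * P.card))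
      = (P.card : ℝ) ^ (n + 1) / 2 := by
    have : τ * DD = 1 := by rw [hτ]; field_simp
    calc _ = (P.card : ℝ) ^ (n + 1) / 2 * (τ * DD) := by rw [hDD]; ring
      _ = _ := by rw [this, mul_one]
  have f6 : (0 : ℝ) < (P.card : ℝ) ^ (n + 1) := by positivity
  rw [f5] at f4
  linarith
end

lemma sum_pow_prime_eq {R ι : Type*} [CommRing R] {ℓ : ℕ} (hℓ : ℓ.Prime) (J : Finset ι) (x : ι → R) :
    ∃ r, (∑ i ∈ J, x i) ^ ℓ = ∑ i ∈ J, x i ^ ℓ + ℓ * r := by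
  induction J using Finset.induction_on with
  | empty => exact ⟨0, by simp [hℓ.ne_zero]⟩
  | insert a s ha ih =>
    obtain ⟨r, hr⟩ := ih
    obtain ⟨r', hr'⟩ := exists_add_pow_prime_eq hℓ (x a) (∑ i ∈ s, x i)
    refine ⟨r + x a * (∑ i ∈ s, x i) * r', ?_⟩
    rw [Finset.sum_insert ha, Finset.sum_insert ha, hr', hr]
    ring

section
variable {K : Type} [Field K] [HField K]

def PSys.ring (Z : PSys K) (v : Z.V) (hv : ¬ Z.arch v) : Subring K where
  carrier := {x | Z.av v x ≤ 1}
  mul_mem' := by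
    intro a b ha hb
    simp only [Set.mem_setOf_eq, map_mul] at *
    exact mul_le_one₀ ha ((Z.av v).nonneg _) hb
  one_mem' := by simp
  add_mem' := by
    intro a b ha hb
    exact (Z.ultra v hv a b).trans (max_le ha hb)
  zero_mem' := by simp
  neg_mem' := by
    intro a ha
    simpa using ha

lemma PSys.frob_nonarch (Z : PSys K) (v : Z.V) (hv : ¬ Z.arch v) {ι : Type*} [Fintype ι]
    (x : ι → K) (B : Kˣ) (hx : ∀ i, Z.av v (x i) ≤ Z.av v B) {ℓ : ℕ} (hℓ : ℓ.Prime)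
    (h0 : ∑ i, x i = 0) : Z.av v (∑ i, x i ^ ℓ) ≤ Z.av v ℓ * Z.av v B ^ ℓ := by
  have hB := Z.av_pos B v
  let y : ι → Z.ring v hv := fun i => ⟨x i / B, by
    change Z.av v _ ≤ 1
    rw [map_div₀, div_le_one hB]; exact hx i⟩
  obtain ⟨r, hr⟩ := sum_pow_prime_eq hℓ Finset.univ y
  have h1 : ((∑ i, y i : Z.ring v hv) : K) = 0 := by
    push_cast
    simp only [y]
    rw [← Finset.sum_div, h0, zero_div]
  have h2 : (∑ i, y i : Z.ring v hv) = 0 := Subtype.ext h1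
  rw [h2, zero_pow hℓ.ne_zero] at hr
  have h3 := congrArg (Subtype.val) hr
  push_cast at h3
  simp only [y, div_pow] at h3
  rw [← Finset.sum_div] at h3
  have h4 : ∑ i, x i ^ ℓ = - (ℓ * r * B ^ ℓ) := by
    have : ((B : K) ^ ℓ) ≠ 0 := pow_ne_zero _ B.ne_zero
    have h5 : (∑ i, x i ^ ℓ) / (B : K) ^ ℓ = - (ℓ * r) := by linear_combination - h3
    rw [div_eq_iff this] at h5
    rw [h5]; ring
  rw [h4, map_neg_eq_map, map_mul, map_mul, map_pow]
  have hr1 : Z.av v r ≤ 1 := r.2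
  have := (Z.av v).nonneg (ℓ : K)
  have h6 := pow_nonneg hB.le ℓ
  calc Z.av v ℓ * Z.av v r * Z.av v B ^ ℓ ≤ Z.av v ℓ * 1 * Z.av v B ^ ℓ := by gcongr
    _ = _ := by rw [mul_one]

lemma frob [CharZero K] {ι : Type*} [Fintype ι] (T : ℕ) (hT : Fintype.card ι ≤ T) (hT2 : 2 ≤ T)
    (M : ι → Kˣ) (e : ι → ℤ) (he : ∀ i, e i = 1 ∨ e i = -1) {ℓ : ℕ} (hℓ : ℓ.Prime) (hℓT : T < ℓ)
    (δ : ℝ) (hδ : ∀ i, hgt (M i) ≤ δ) (hδℓ : ℓ * T * δ < Real.log ℓ - Real.log T)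
    (h0 : ∑ i, (e i : K) * (M i : K) = 0) : ∑ i, (e i : K) * (M i : K) ^ ℓ = 0 := by
  by_contra hy
  have hℓ0 : (ℓ : K) ≠ 0 := by exact_mod_cast hℓ.ne_zero
  let y : Kˣ := Units.mk0 _ hy
  let lu : Kˣ := Units.mk0 _ hℓ0
  have hodd : Odd ℓ := hℓ.odd_of_ne_two (by omega)
  have hee : ∀ i, (e i : K) = (e i : K) ^ ℓ := by
    intro i
    rcases he i with h | h
    · simp [h]
    · rw [h]; push_cast; rw [hodd.neg_one_pow]
  have hyy : ∑ i, (e i : K) * (M i : K) ^ ℓ = ∑ i, ((e i : K) * (M i : K)) ^ ℓ :=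
    Finset.sum_congr rfl fun i _ => by rw [mul_pow, ← hee]
  have hne : (Finset.univ : Finset ι).Nonempty := by
    rw [Finset.nonempty_iff_ne_empty]; intro h
    rw [h] at hy; simp at hy
  obtain ⟨Z, hZ⟩ := HField.good (Finset.univ.image M ∪ {y, lu})
  have hM : ∀ i, Z.ht (M i) = hgt (M i) := fun i => (hZ _ (Subgroup.subset_closure (by simp))).2
  have hPy : Z.PF y := (hZ _ (Subgroup.subset_closure (by simp))).1
  have hPl : Z.PF lu := (hZ _ (Subgroup.subset_closure (by simp))).1
  have hav : ∀ v i, Z.av v ((e i : K) * (M i : K)) = Z.av v (M i) := by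
    intro v i
    rcases he i with h | h <;> simp [h]
  have hℓpos : (0 : ℝ) < ℓ := by exact_mod_cast hℓ.pos
  have hTpos : (0 : ℝ) < T := by exact_mod_cast (by omega : 0 < T)
  have hloc : ∀ v, Z.L y v ≤ (if Z.arch v then Real.log T else Z.L lu v) + ℓ * ∑ i, |Z.L (M i) v| := by
    intro v
    obtain ⟨i0, -, hi0⟩ := Finset.exists_max_image Finset.univ (fun i => Z.av v (M i)) hne
    have hmax : ∀ i, Z.av v ((e i : K) * (M i : K)) ≤ Z.av v (M i0) := fun i => by
      rw [hav]; exact hi0 i (Finset.mem_univ _)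
    have hB := Z.av_pos (M i0) v
    have hLi0 : Z.L (M i0) v ≤ ∑ i, |Z.L (M i) v| :=
      (le_abs_self _).trans (Finset.single_le_sum (f := fun i => |Z.L (M i) v|)
        (fun _ _ => abs_nonneg _) (Finset.mem_univ i0))
    have hyv : (y : K) = ∑ i, ((e i : K) * (M i : K)) ^ ℓ := hyy
    have key : Z.L y v ≤ (if Z.arch v then Real.log T else Z.L lu v) + ℓ * Z.L (M i0) v := by
      unfold PSys.L
      rw [← Real.log_pow]
      split_ifs with ha
      · rw [← Real.log_mul (by positivity) (by positivity)]
        refine Real.log_le_log (Z.av_pos y v) ?_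
        rw [hyv]
        refine (Z.av_sum_le v Finset.univ _ (Z.av v (M i0) ^ ℓ) (by positivity) ?_).trans ?_
        · intro i _
          rw [map_pow]
          exact pow_le_pow_left₀ ((Z.av v).nonneg _) (hmax i) _
        · rw [if_pos ha]
          gcongr
          exact hT
      · rw [← Real.log_mul (Z.av_pos lu v).ne' (by positivity)]
        refine Real.log_le_log (Z.av_pos y v) ?_
        rw [hyv]
        exact Z.frob_nonarch v ha _ (M i0) hmax hℓ h0
    have := mul_le_mul_of_nonneg_left hLi0 hℓpos.le
    linarith
  have hsum : (0 : ℝ) ≤ ∑ v, Z.w v * ((if Z.arch v then Real.log T else Z.L lu v) +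
      ℓ * ∑ i, |Z.L (M i) v|) := by
    rw [← hPy]
    exact Finset.sum_le_sum fun v _ => mul_le_mul_of_nonneg_left (hloc v) (Z.w_pos v).le
  have hl : ∀ v, (if Z.arch v then Real.log T else Z.L lu v) =
      Z.L lu v + (if Z.arch v then 1 else 0) * (Real.log T - Real.log ℓ) := by
    intro v
    split_ifs with ha
    · have : Z.L lu v = Real.log ℓ := by
        unfold PSys.L
        rw [← Z.arch_nat v ha ℓ]; rfl
      rw [this]; ring
    · ring
  have e1 : ∑ v, Z.w v * ((if Z.arch v then Real.log T else Z.L lu v) +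
      ℓ * ∑ i, |Z.L (M i) v|) = (Real.log T - Real.log ℓ) + ℓ * ∑ i, Z.ht (M i) := by
    have e2 : ∀ v, Z.w v * ((if Z.arch v then Real.log T else Z.L lu v) +
      ℓ * ∑ i, |Z.L (M i) v|) = Z.w v * Z.L lu v + (if Z.arch v then Z.w v else 0) *
        (Real.log T - Real.log ℓ) + ℓ * ∑ i, Z.w v * |Z.L (M i) v| := by
      intro v
      rw [hl, ← Finset.mul_sum]
      split_ifs <;> ring
    rw [Finset.sum_congr rfl fun v _ => e2 v, Finset.sum_add_distrib, Finset.sum_add_distrib,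
      hPl, ← Finset.sum_mul, Z.arch_sum, ← Finset.mul_sum, Finset.sum_comm]
    unfold PSys.ht
    ring
  rw [e1] at hsum
  have hδ0 : 0 ≤ δ := by
    obtain ⟨i, _⟩ := hne
    exact (hgt_nonneg _).trans (hδ i)
  have hs : ∑ i, Z.ht (M i) ≤ T * δ := by
    calc ∑ i, Z.ht (M i) ≤ ∑ _i : ι, δ := Finset.sum_le_sum fun i _ => by rw [hM]; exact hδ i
      _ = Fintype.card ι * δ := by rw [Finset.sum_const, nsmul_eq_mul, Finset.card_univ]
      _ ≤ T * δ := by gcongr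
  have := mul_le_mul_of_nonneg_left hs hℓpos.le
  linarith
end

section
variable {K : Type} [Field K] [HField K]

lemma frobN [CharZero K] {ι : Type*} [Fintype ι] (T : ℕ) (hT : Fintype.card ι ≤ T) (hT2 : 2 ≤ T)
    (e : ι → ℤ) (he : ∀ i, e i = 1 ∨ e i = -1) (N : ℕ) :
    (∀ p, p.Prime → p ∣ N → T < p) → ∀ (M : ι → Kˣ) (δ : ℝ), (∀ i, hgt (M i) ≤ δ) → 0 ≤ δ →
    N * T * δ < 1 / (T + 1) → N ≠ 0 → 
    ∑ i, (e i : K) * (M i : K) = 0 → ∑ i, (e i : K) * (M i : K) ^ N = 0 := by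
  induction N using induction_on_primes with
  | zero => intro _ _ _ _ _ _ h; exact absurd rfl h
  | one => intro _ M _ _ _ _ _ h; simpa using h
  | prime_mul p a hp ih =>
    intro hN M δ hδ hδ0 hlt hne h0
    have ha : a ≠ 0 := by rintro rfl; simp at hne
    have hTp : T < p := hN p hp (dvd_mul_right _ _)
    have hT0 : (0 : ℝ) < T := by exact_mod_cast (by omega : 0 < T)
    have ha1 : (1 : ℝ) ≤ a := by exact_mod_cast Nat.one_le_iff_ne_zero.2 ha
    have hp0 : (0 : ℝ) < p := by exact_mod_cast hp.pos
    push_cast at hlt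
    have h1 := frob T hT hT2 M e he hp hTp δ hδ (by
      have hl : 1 / ((T : ℝ) + 1) ≤ Real.log p - Real.log T := by
        rw [← Real.log_div hp0.ne' hT0.ne']
        have h2 := Real.one_sub_inv_le_log_of_pos (x := (p : ℝ) / T) (by positivity)
        refine le_trans ?_ h2
        rw [inv_div]
        have h3 : (T : ℝ) / p ≤ T / (T + 1) := by
          gcongr; exact_mod_cast hTp
        have h4 : 1 / ((T : ℝ) + 1) = 1 - T / (T + 1) := by field_simp; ring
        linarith
      have h5 : (p : ℝ) * T * δ * 1 ≤ p * T * δ * a := by gcongr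
      nlinarith) h0
    have h2 := ih (fun q hq hqa => hN q hq (hqa.mul_left p)) (fun i => M i ^ p) (p * δ)
      (fun i => by rw [hgt_pow]; exact mul_le_mul_of_nonneg_left (hδ i) hp0.le) (by positivity)
      (by nlinarith) ha (by simpa using h1)
    simpa [pow_mul] using h2

lemma lemF [CharZero K] (σ : K →+* ℂ) {ι : Type*} [Fintype ι] (T : ℕ) (hT : Fintype.card ι ≤ T)
    (hT2 : 2 ≤ T) (e : ι → ℤ) (he : ∀ i, e i = 1 ∨ e i = -1) (M : ι → Kˣ) (δ : ℝ)
    (hδ : ∀ i, hgt (M i) ≤ δ) (hδ0 : 0 ≤ δ) 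
    (hlt : ((1 + T * T.factorial : ℕ) : ℝ) * T * δ < 1 / (T + 1)) (Lg : ι → ℂ)
    (hLg : ∀ i, Complex.exp (Lg i) = σ (M i)) (hIm : ∀ i, |(Lg i).im| * T.factorial < Real.pi)
    (h0 : ∑ i, (e i : K) * (M i : K) = 0) (f : ℂ → ℚ) : ∑ i, (e i : ℚ) * f (Lg i) = 0 := by
  set Q := T.factorial with hQ
  have hQ0 : 0 < Q := Nat.factorial_pos _
  have h1 : ∀ j, j ≤ T → ∑ i, (e i : K) * (M i : K) * ((M i : K) ^ Q) ^ j = 0 := by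
    intro j hj
    have := frobN T hT hT2 e he (1 + j * Q) (by
      intro p hp hpd
      by_contra hpT
      have : p ∣ Q := (hp.dvd_factorial).2 (by omega)
      have h3 : p ∣ 1 := (Nat.dvd_add_left (this.mul_left j)).1 hpd
      exact hp.one_lt.ne' (Nat.dvd_one.1 h3)) M δ hδ hδ0 (lt_of_le_of_lt (by gcongr) hlt) (by omega) h0
    rw [← this]
    refine Finset.sum_congr rfl fun i _ => ?_
    ring
  have h2 : ∀ p : Polynomial K, p.natDegree ≤ T →
      ∑ i, (e i : K) * (M i : K) * p.eval ((M i : K) ^ Q) = 0 := by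
    intro p hp
    simp_rw [Polynomial.eval_eq_sum_range, Finset.mul_sum]
    rw [Finset.sum_comm]
    refine Finset.sum_eq_zero fun j hj => ?_
    rw [Finset.mem_range] at hj
    have := h1 j (by omega)
    calc _ = p.coeff j * ∑ i, (e i : K) * (M i : K) * ((M i : K) ^ Q) ^ j := by
          rw [Finset.mul_sum]; exact Finset.sum_congr rfl fun i _ => by ring
      _ = 0 := by rw [this, mul_zero]
  let X := Finset.univ.image fun i => (M i : K) ^ Q
  have h3 : ∀ x ∈ X, ∑ i with (M i : K) ^ Q = x, (e i : K) * (M i : K) = 0 := by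
    intro x hx
    have hinj : Set.InjOn (id : K → K) X := Set.injOn_id _
    have hp := h2 (Lagrange.basis X id x) (by
      rw [Lagrange.natDegree_basis hinj hx]
      have : X.card ≤ Fintype.card ι := Finset.card_image_le
      omega)
    rw [Finset.sum_filter]
    refine Eq.trans ?_ hp
    refine Finset.sum_congr rfl fun i _ => ?_
    split_ifs with h
    · have := Lagrange.eval_basis_self hinj hx
      rw [id] at this
      rw [h, this, mul_one]
    · have := Lagrange.eval_basis_of_ne (s := X) (v := id) (i := x) (j := (M i : K) ^ Q)
        (Ne.symm h) (Finset.mem_image_of_mem _ (Finset.mem_univ i))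
      rw [id] at this
      rw [this, mul_zero]
  have h4 : ∀ i j, (M i : K) ^ Q = (M j : K) ^ Q → Lg i = Lg j := by
    intro i j hij
    have h5 : Complex.exp (Q * Lg i) = Complex.exp (Q * Lg j) := by
      rw [Complex.exp_nat_mul, Complex.exp_nat_mul, hLg, hLg, ← map_pow, ← map_pow, hij]
    rw [Complex.exp_eq_exp_iff_exists_int] at h5
    obtain ⟨k, hk⟩ := h5
    have him := congrArg Complex.im hk
    simp at him
    have hi := hIm i
    have hj := hIm j
    have hQ1 : (0 : ℝ) < Q := by exact_mod_cast hQ0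
    have hk0 : k = 0 := by
      by_contra hk0
      have hk1 : (1 : ℝ) ≤ |(k : ℝ)| := by exact_mod_cast Int.one_le_abs hk0
      have hb : |(Q : ℝ) * (Lg i).im - Q * (Lg j).im| < 2 * Real.pi := by
        calc _ ≤ |(Q : ℝ) * (Lg i).im| + |(Q : ℝ) * (Lg j).im| := abs_sub _ _
          _ = |(Lg i).im| * Q + |(Lg j).im| * Q := by
            rw [abs_mul, abs_mul, Nat.abs_cast]; ring
          _ < _ := by linarith
      have : (Q : ℝ) * (Lg i).im - Q * (Lg j).im = k * (2 * Real.pi) := by linarith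
      rw [this, abs_mul, abs_of_pos Real.two_pi_pos] at hb
      nlinarith [Real.two_pi_pos]
    rw [hk0] at hk
    simp at hk
    rcases hk with h | h
    · exact h
    · omega
  have h5 : ∀ i j, (M i : K) ^ Q = (M j : K) ^ Q → (M i : K) = M j := by
    intro i j hij
    apply σ.injective
    rw [← hLg, ← hLg, h4 i j hij]
  rw [← Finset.sum_fiberwise_of_maps_to (s := Finset.univ) (t := X) (g := fun i => (M i : K) ^ Q)
    (fun i _ => Finset.mem_image_of_mem _ (Finset.mem_univ i))]
  refine Finset.sum_eq_zero fun x hx => ?_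
  obtain ⟨i0, -, hi0⟩ := Finset.mem_image.1 hx
  have h6 := h3 x hx
  have h7 : ∑ i with (M i : K) ^ Q = x, (e i : K) * (M i : K) =
      ((∑ i with (M i : K) ^ Q = x, e i : ℤ) : K) * M i0 := by
    push_cast
    rw [Finset.sum_mul]
    refine Finset.sum_congr rfl fun i hi => ?_
    rw [h5 i i0 ((Finset.mem_filter.1 hi).2.trans hi0.symm)]
  rw [h7] at h6
  have h8 : (∑ i with (M i : K) ^ Q = x, e i : ℤ) = 0 := by
    have := (mul_eq_zero.1 h6).resolve_right (M i0).ne_zero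
    exact_mod_cast this
  have h9 : ∑ i with (M i : K) ^ Q = x, (e i : ℚ) * f (Lg i) =
      ((∑ i with (M i : K) ^ Q = x, e i : ℤ) : ℚ) * f (Lg i0) := by
    push_cast
    rw [Finset.sum_mul]
    refine Finset.sum_congr rfl fun i hi => ?_
    rw [h4 i i0 ((Finset.mem_filter.1 hi).2.trans hi0.symm)]
  rw [h9, h8]; simp
end

lemma zpow_sum' {G ι : Type*} [CommGroup G] (u : G) (s : Finset ι) (f : ι → ℤ) :
    u ^ (∑ i ∈ s, f i) = ∏ i ∈ s, u ^ f i := by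
  induction s using Finset.induction_on with
  | empty => simp
  | insert a s ha ih => rw [Finset.sum_insert ha, Finset.prod_insert ha, zpow_add, ih]

lemma det_expand {ι R : Type*} [Fintype ι] [DecidableEq ι] [CommRing R] (u w : ι → ι → R) :
    (Matrix.of fun i j => u i j - w i j).det =
      ∑ x : Equiv.Perm ι × (ι → Bool), (((Equiv.Perm.sign x.1 : ℤ) *
        ∏ i, (if x.2 i then 1 else -1) : ℤ) : R) * ∏ i, (if x.2 i then u (x.1 i) i else w (x.1 i) i) := by
  rw [Matrix.det_apply', Fintype.sum_prod_type]
  refine Finset.sum_congr rfl fun τ _ => ?_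
  have h1 : ∀ i, (Matrix.of fun i j => u i j - w i j) (τ i) i =
      ∑ b : Bool, ((if b then 1 else -1 : ℤ) : R) * (if b then u (τ i) i else w (τ i) i) := by
    intro i
    simp [sub_eq_add_neg]
  rw [Finset.prod_congr rfl fun i _ => h1 i, Finset.prod_univ_sum, Finset.mul_sum]
  rw [Fintype.piFinset_univ]
  refine Finset.sum_congr rfl fun B _ => ?_
  rw [Finset.prod_mul_distrib]
  push_cast
  ring

section
variable {K : Type} [Field K] [HField K] [CharZero K]

lemma rank_claim {n d s T : ℕ} (hs : 1 ≤ s) (hTs : T = s.factorial * 2 ^ s) (σ : K →+* ℂ) {X : Type*}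
    (y : X → Kˣ) (lg : X → ℂ) (a : X → ℤ) (lam : ℂ →ₗ[ℚ] ℚ) (δ η : ℝ) (hδ0 : 0 ≤ δ) (hη0 : 0 ≤ η)
    (hy : ∀ x, hgt (y x) ≤ δ) (hlg : ∀ x, Complex.exp (lg x) = σ (y x))
    (him : ∀ x, |(lg x).im| ≤ η) (hlam : ∀ x, lam (lg x) = a x)
    (hδ : ((1 + T * T.factorial : ℕ) : ℝ) * T * (s * d * δ) < 1 / (T + 1))
    (hη : s * d * η * T.factorial < Real.pi) (S : Finset (Fin n →₀ ℕ))
    (hSd : ∀ m ∈ S, ∑ j, m j ≤ d) (hSs : S.card ≤ s) (b : (Fin n →₀ ℕ) → K)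
    (hb : ∃ m ∈ S, b m ≠ 0) (u2 : ℚˣ) (hu2 : (u2 : ℚ) = 2) :
    ∃ c : (Fin n →₀ ℕ) → ℚ, (∃ m ∈ S, c m ≠ 0) ∧ ∀ p q : Fin n → X,
      ∑ m ∈ S, b m * ((mon m fun j => y (p j) : Kˣ) - (mon m fun j => y (q j) : Kˣ) : K) = 0 →
      ∑ m ∈ S, c m * ((mon m fun j => u2 ^ a (p j) : ℚˣ) - (mon m fun j => u2 ^ a (q j) : ℚˣ) : ℚ)
        = 0 := by
  let W := {t : (Fin n → X) × (Fin n → X) //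
    ∑ m ∈ S, b m * ((mon m fun j => y (t.1 j) : Kˣ) - (mon m fun j => y (t.2 j) : Kˣ) : K) = 0}
  by_contra hcon
  obtain ⟨t, ht⟩ := exists_det_ne_zero (F := ℚ) (ι := S) (T := W) (fun t m =>
    ((mon m.1 fun j => u2 ^ a (t.1.1 j) : ℚˣ) - (mon m.1 fun j => u2 ^ a (t.1.2 j) : ℚˣ) : ℚ)) (by
    intro c hc
    by_contra hc0
    apply hcon
    refine ⟨fun m => if h : m ∈ S then c ⟨m, h⟩ else 0, ?_, ?_⟩
    · obtain ⟨m, hm⟩ := Function.ne_iff.1 hc0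
      refine ⟨m.1, m.2, ?_⟩
      simpa using hm
    · intro p q hpq
      have := hc ⟨(p, q), hpq⟩
      rw [← Finset.sum_coe_sort]
      refine Eq.trans (Finset.sum_congr rfl fun m _ => ?_) this
      simp)
  apply ht
  have hdet : (Matrix.of fun (i j : S) =>
      ((mon j.1 fun k => y ((t i).1.1 k) : Kˣ) - (mon j.1 fun k => y ((t i).1.2 k) : Kˣ) : K)).det = 0 := by
    rw [← Matrix.exists_mulVec_eq_zero_iff]
    obtain ⟨m, hm, hbm⟩ := hb
    refine ⟨fun j => b j.1, fun h => hbm (congrFun h ⟨m, hm⟩), ?_⟩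
    ext i
    have := (t i).2
    rw [← Finset.sum_coe_sort] at this
    rw [Matrix.mulVec, dotProduct, Pi.zero_apply]
    refine Eq.trans (Finset.sum_congr rfl fun j _ => ?_) this
    rw [Matrix.of_apply, mul_comm]
  rw [det_expand] at hdet
  rw [det_expand]
  let P : Equiv.Perm S × (S → Bool) → S → Fin n → X := fun x i =>
    if x.2 i then (t (x.1 i)).1.1 else (t (x.1 i)).1.2
  let e : Equiv.Perm S × (S → Bool) → ℤ := fun x => (Equiv.Perm.sign x.1 : ℤ) *
        ∏ i, (if x.2 i then 1 else -1)
  let M : Equiv.Perm S × (S → Bool) → Kˣ := fun x => ∏ i, mon i.1 fun j => y (P x i j)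
  let Lg : Equiv.Perm S × (S → Bool) → ℂ := fun x => ∑ i : S, ∑ j, (i.1 j : ℂ) * lg (P x i j)
  have hSc : Fintype.card S = S.card := by simp
  have hdn : ∀ i : S, ∑ j, (i.1 j : ℝ) ≤ d := fun i => by exact_mod_cast hSd i.1 i.2
  have hSs' : (S.card : ℝ) ≤ s := by exact_mod_cast hSs
  have hTle : Fintype.card (Equiv.Perm S × (S → Bool)) ≤ T := by
    rw [Fintype.card_prod, Fintype.card_perm, Fintype.card_fun, hSc, Fintype.card_bool, hTs]
    exact Nat.mul_le_mul (Nat.factorial_le hSs) (Nat.pow_le_pow_right (by norm_num) hSs)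
  have hT2 : 2 ≤ T := by
    rw [hTs]
    calc 2 = 1 * 2 ^ 1 := by norm_num
      _ ≤ _ := Nat.mul_le_mul (Nat.factorial_pos _) (Nat.pow_le_pow_right (by norm_num) hs)
  have hQ : (0 : ℝ) < T.factorial := by exact_mod_cast Nat.factorial_pos T
  have key := lemF (K := K) σ T hTle hT2 e (by
      intro x
      apply Int.isUnit_iff.1
      refine IsUnit.mul (Units.isUnit _) ?_
      refine IsUnit.prod_univ_iff.2 fun i => ?_
      split_ifs
      · exact isUnit_one
      · exact isUnit_one.neg) M (s * d * δ) (by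
      intro x
      refine (hgt_prod _ _).trans ?_
      calc ∑ i : S, hgt (mon i.1 fun j => y (P x i j)) ≤ ∑ _i : S, d * δ := by
            refine Finset.sum_le_sum fun i _ => ?_
            refine (hgt_prod _ _).trans ?_
            calc ∑ j, hgt (y (P x i j) ^ i.1 j) ≤ ∑ j, (i.1 j : ℝ) * δ := by
                  refine Finset.sum_le_sum fun j _ => ?_
                  rw [hgt_pow]
                  exact mul_le_mul_of_nonneg_left (hy _) (Nat.cast_nonneg _)
              _ ≤ d * δ := by
                  rw [← Finset.sum_mul]
                  exact mul_le_mul_of_nonneg_right (hdn i) hδ0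
        _ = S.card * (d * δ) := by
            rw [Finset.sum_const, nsmul_eq_mul, Finset.card_univ, hSc]
        _ ≤ s * (d * δ) := by gcongr
        _ = _ := by ring) (by positivity) hδ Lg (by
      intro x
      simp only [Lg, M]
      rw [Complex.exp_sum, Units.coe_prod, map_prod]
      refine Finset.prod_congr rfl fun i _ => ?_
      rw [Complex.exp_sum, mon, Units.coe_prod, map_prod]
      refine Finset.prod_congr rfl fun j _ => ?_
      rw [Complex.exp_nat_mul, hlg, Units.val_pow_eq_pow_val, map_pow]) (by
      intro x
      refine lt_of_le_of_lt (mul_le_mul_of_nonneg_right ?_ hQ.le) hη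
      simp only [Lg]
      rw [Complex.im_sum]
      refine (Finset.abs_sum_le_sum_abs _ _).trans ?_
      calc ∑ i : S, |(∑ j, (i.1 j : ℂ) * lg (P x i j)).im| ≤ ∑ _i : S, d * η := by
            refine Finset.sum_le_sum fun i _ => ?_
            rw [Complex.im_sum]
            refine (Finset.abs_sum_le_sum_abs _ _).trans ?_
            calc ∑ j, |((i.1 j : ℂ) * lg (P x i j)).im| ≤ ∑ j, (i.1 j : ℝ) * η := by
                  refine Finset.sum_le_sum fun j _ => ?_
                  have : ((i.1 j : ℂ) * lg (P x i j)).im = (i.1 j : ℝ) * (lg (P x i j)).im := by simp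
                  rw [this, abs_mul, Nat.abs_cast]
                  exact mul_le_mul_of_nonneg_left (him _) (Nat.cast_nonneg _)
              _ ≤ d * η := by
                  rw [← Finset.sum_mul]
                  exact mul_le_mul_of_nonneg_right (hdn i) hη0
        _ = S.card * (d * η) := by
            rw [Finset.sum_const, nsmul_eq_mul, Finset.card_univ, hSc]
        _ ≤ s * (d * η) := by gcongr
        _ = _ := by ring) (by
      refine Eq.trans (Finset.sum_congr rfl fun x _ => ?_) hdet
      congr 1
      simp only [M, P]
      rw [Units.coe_prod]
      refine Finset.prod_congr rfl fun i _ => ?_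
      split_ifs <;> rfl) (fun z => (2 : ℚ) ^ ⌊lam z⌋)
  refine Eq.trans (Finset.sum_congr rfl fun x _ => ?_) key
  congr 1
  have h1 : lam (Lg x) = ((∑ i : S, ∑ j, (i.1 j : ℤ) * a (P x i j) : ℤ) : ℚ) := by
    simp only [Lg]
    push_cast
    rw [map_sum]
    refine Finset.sum_congr rfl fun i _ => ?_
    rw [map_sum]
    refine Finset.sum_congr rfl fun j _ => ?_
    rw [← nsmul_eq_mul, map_nsmul, hlam, nsmul_eq_mul]
  rw [h1, Int.floor_intCast, ← hu2, ← Units.val_zpow_eq_zpow_val, zpow_sum',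
    Units.coe_prod]
  refine Finset.prod_congr rfl fun i _ => ?_
  rw [zpow_sum']
  have h2 : (∏ j, u2 ^ ((i.1 j : ℤ) * a (P x i j))) = mon i.1 fun j => u2 ^ a (P x i j) := by
    rw [mon]
    refine Finset.prod_congr rfl fun j _ => ?_
    rw [mul_comm, zpow_mul, zpow_natCast]
  rw [h2]
  simp only [P]
  split_ifs <;> rfl

lemma all_c {n d s T : ℕ} (hs : 1 ≤ s) (hTs : T = s.factorial * 2 ^ s) (σ : K →+* ℂ) {X : Type*}
    (y : X → Kˣ) (lg : X → ℂ) (a : X → ℤ) (lam : ℂ →ₗ[ℚ] ℚ) (δ η : ℝ) (hδ0 : 0 ≤ δ) (hη0 : 0 ≤ η)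
    (hy : ∀ x, hgt (y x) ≤ δ) (hlg : ∀ x, Complex.exp (lg x) = σ (y x))
    (him : ∀ x, |(lg x).im| ≤ η) (hlam : ∀ x, lam (lg x) = a x)
    (hδ : ((1 + T * T.factorial : ℕ) : ℝ) * T * (s * d * δ) < 1 / (T + 1))
    (hη : s * d * η * T.factorial < Real.pi) (S0 : Finset (Fin n →₀ ℕ))
    (hSd : ∀ m ∈ S0, ∑ j, m j ≤ d) (hSs : S0.card ≤ s) (b : (Fin n →₀ ℕ) → K)
    (hb : ∀ m ∈ S0, b m ≠ 0) (u2 : ℚˣ) (hu2 : (u2 : ℚ) = 2)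
    (hinj : ∀ m ∈ S0, ∀ p q : Fin n → X, (mon m fun j => u2 ^ a (p j)) = (mon m fun j => u2 ^ a (q j)) →
      (mon m fun j => y (p j)) = (mon m fun j => y (q j))) (N : ℕ) :
    ∀ S ⊆ S0, S.card ≤ N → ∃ c : (Fin n →₀ ℕ) → ℚ, (∀ m ∈ S, c m ≠ 0) ∧ ∀ p q : Fin n → X,
      ∑ m ∈ S, b m * ((mon m fun j => y (p j) : Kˣ) - (mon m fun j => y (q j) : Kˣ) : K) = 0 →
      (∀ J ⊆ S, 
      ∑ m ∈ J, c m * ((mon m fun j => u2 ^ a (p j) : ℚˣ) - (mon m fun j => u2 ^ a (q j) : ℚˣ) : ℚ)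
        = 0 → ∀ m ∈ J, (mon m fun j => u2 ^ a (p j)) = (mon m fun j => u2 ^ a (q j))) →
      ∀ m ∈ S, (mon m fun j => u2 ^ a (p j)) = (mon m fun j => u2 ^ a (q j)) := by
  induction N with
  | zero =>
    intro S _ hS
    have : S = ∅ := Finset.card_eq_zero.1 (by omega)
    subst this
    exact ⟨fun _ => 1, by simp, by simp⟩
  | succ N ih =>
    intro S hSS hS
    rcases S.eq_empty_or_nonempty with rfl | ⟨m0, hm0⟩
    · exact ⟨fun _ => 1, by simp, by simp⟩
    obtain ⟨c0, ⟨m1, hm1, hc1⟩, hc0⟩ := rank_claim hs hTs σ y lg a lam δ η hδ0 hη0 hy hlg him hlam hδ hη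
      S (fun m hm => hSd m (hSS hm)) ((Finset.card_le_card hSS).trans hSs) b
      ⟨m0, hm0, hb m0 (hSS hm0)⟩ u2 hu2
    let J0 := S.filter fun m => c0 m ≠ 0
    have hJ0S : J0 ⊆ S := Finset.filter_subset _ _
    have hm1J : m1 ∈ J0 := Finset.mem_filter.2 ⟨hm1, hc1⟩
    have hlt : (S \ J0).card < S.card := Finset.card_lt_card
      (Finset.sdiff_ssubset hJ0S ⟨m1, hm1J⟩)
    obtain ⟨c1, hc1, hc1'⟩ := ih (S \ J0) (Finset.sdiff_subset.trans hSS) (by omega)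
    refine ⟨fun m => if m ∈ J0 then c0 m else c1 m, ?_, ?_⟩
    · intro m hm
      simp only
      split_ifs with h
      · exact (Finset.mem_filter.1 h).2
      · exact hc1 m (Finset.mem_sdiff.2 ⟨hm, h⟩)
    · intro p q hsum hJ
      have h1 := hc0 p q hsum
      have h2 : ∀ m ∈ J0, (mon m fun j => u2 ^ a (p j)) = (mon m fun j => u2 ^ a (q j)) := by
        apply hJ J0 hJ0S
        refine Eq.trans ?_ h1
        rw [← Finset.sum_sdiff hJ0S]
        have h5 : ∑ m ∈ S \ J0, c0 m * ((mon m fun j => u2 ^ a (p j) : ℚˣ) -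
            (mon m fun j => u2 ^ a (q j) : ℚˣ) : ℚ) = 0 := by
          refine Finset.sum_eq_zero fun m hm => ?_
          have : c0 m = 0 := by
            by_contra h0
            exact (Finset.mem_sdiff.1 hm).2 (Finset.mem_filter.2 ⟨(Finset.mem_sdiff.1 hm).1, h0⟩)
          rw [this, zero_mul]
        rw [h5, zero_add]
        exact Finset.sum_congr rfl fun m hm => by beta_reduce; rw [if_pos hm]
      have h3 : ∀ m ∈ S \ J0, (mon m fun j => u2 ^ a (p j)) = (mon m fun j => u2 ^ a (q j)) := by
        apply hc1' p q
        · rw [← Finset.sum_sdiff hJ0S] at hsum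
          have h4 : ∑ m ∈ J0, b m * ((mon m fun j => y (p j) : Kˣ) - (mon m fun j => y (q j) : Kˣ) : K) = 0 := by
            refine Finset.sum_eq_zero fun m hm => ?_
            rw [hinj m (hSS (hJ0S hm)) p q (h2 m hm), sub_self, mul_zero]
          rwa [h4, add_zero] at hsum
        · intro J hJS hJsum
          apply hJ J (hJS.trans Finset.sdiff_subset)
          rw [← hJsum]
          refine Finset.sum_congr rfl fun m hm => ?_
          beta_reduce; rw [if_neg (Finset.mem_sdiff.1 (hJS hm)).2]
      intro m hm
      by_cases h : m ∈ J0
      · exact h2 m h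
      · exact h3 m (Finset.mem_sdiff.2 ⟨hm, h⟩)
end

lemma exists_int_dual {X : Type*} [Finite X] (lg : X → ℂ) (V : Set ℂ) (hV : V.Finite) :
    ∃ (lam : ℂ →ₗ[ℚ] ℚ) (a : X → ℤ), (∀ x, lam (lg x) = a x) ∧ ∀ v ∈ V, lam v = 0 → v = 0 := by
  have := Fintype.ofFinite X
  have hfin : Finite {v // v ∈ V ∧ v ≠ 0} := (hV.subset (fun v hv => hv.1) : {v | v ∈ V ∧ v ≠ 0}.Finite)
  obtain ⟨f, hf⟩ := Module.exists_dual_forall_apply_ne_zero (K := ℚ)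
    (fun v : {v // v ∈ V ∧ v ≠ 0} => (v : ℂ)) (fun v => v.2.2)
  let N : ℕ := ∏ x, (f (lg x)).den
  have hN : N ≠ 0 := Finset.prod_ne_zero_iff.2 fun x _ => (f (lg x)).den_ne_zero
  have hint : ∀ x, ∃ k : ℤ, (N : ℚ) * f (lg x) = k := by
    intro x
    obtain ⟨c, hc⟩ : (f (lg x)).den ∣ N := Finset.dvd_prod_of_mem _ (Finset.mem_univ x)
    refine ⟨c * (f (lg x)).num, ?_⟩
    rw [hc]; push_cast
    have := Rat.den_mul_eq_num (f (lg x))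
    linear_combination (c : ℚ) * this
  choose a ha using hint
  refine ⟨(N : ℚ) • f, a, fun x => ?_, fun v hv h0 => ?_⟩
  · rw [LinearMap.smul_apply, smul_eq_mul, ha]
  · by_contra hne
    rw [LinearMap.smul_apply, smul_eq_mul, mul_eq_zero] at h0
    rcases h0 with h | h
    · exact hN (by exact_mod_cast h)
    · exact hf ⟨v, hv, hne⟩ h

lemma card_image_le_of_factor {I A B : Type*} [DecidableEq A] [DecidableEq B] (s : Finset I)
    (f : I → A) (g : I → B)
    (h : ∀ i ∈ s, ∀ j ∈ s, f i = f j → g i = g j) : (s.image g).card ≤ (s.image f).card := by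
  rcases s.eq_empty_or_nonempty with rfl | ⟨i0, _⟩
  · simp
  have : Nonempty I := ⟨i0⟩
  have : ∀ x ∈ s.image f, ∃ i ∈ s, f i = x := fun x hx => Finset.mem_image.1 hx
  choose! k hk hk' using this
  calc (s.image g).card ≤ ((s.image f).image fun x => g (k x)).card := by
        refine Finset.card_le_card fun y hy => ?_
        obtain ⟨i, hi, rfl⟩ := Finset.mem_image.1 hy
        have hm := Finset.mem_image_of_mem f hi
        exact Finset.mem_image.2 ⟨f i, hm, h _ (hk _ hm) _ hi (hk' _ hm)⟩
    _ ≤ _ := Finset.card_image_le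

section
variable {K : Type} [Field K] [HField K]
lemma hgt_zpow (x : Kˣ) (k : ℤ) : hgt (x ^ k) = k.natAbs * hgt x := by
  rcases Int.natAbs_eq k with h | h
  · conv_lhs => rw [h]
    rw [zpow_natCast, hgt_pow]
  · conv_lhs => rw [h]
    rw [zpow_neg, zpow_natCast, hgt_inv, hgt_pow]

lemma hgt_two (x : Kˣ) (hx : (x : K) = 2) : Real.log 2 ≤ hgt x := by
  obtain ⟨Z, hZ⟩ := HField.good ({x} : Finset Kˣ)
  rw [hgt, ← (hZ x (Subgroup.subset_closure (by simp))).2]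
  unfold PSys.ht
  calc Real.log 2 = (∑ v : Z.V, (if Z.arch v then Z.w v else 0)) * Real.log 2 := by
        rw [Z.arch_sum, one_mul]
    _ = ∑ v : Z.V, (if Z.arch v then Z.w v else 0) * Real.log 2 := Finset.sum_mul _ _ _
    _ ≤ _ := by
      refine Finset.sum_le_sum fun v _ => ?_
      split_ifs with h
      · refine mul_le_mul_of_nonneg_left ?_ (Z.w_pos v).le
        unfold PSys.L
        have := Z.arch_nat v h 2
        push_cast at this
        rw [hx, this]
        exact le_abs_self _
      · rw [zero_mul]; exact mul_nonneg (Z.w_pos v).le (abs_nonneg _)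

lemma mon_const_mul {n : ℕ} {G : Type*} [CommGroup G] (m : Fin n →₀ ℕ) (g : G) (p : Fin n → G) :
    mon m p = g ^ (∑ j, m j) * mon m (fun j => p j / g) := by
  unfold mon
  rw [← Finset.prod_pow_eq_pow_sum, ← Finset.prod_mul_distrib]
  refine Finset.prod_congr rfl fun j _ => ?_
  rw [← mul_pow, mul_div_cancel]

lemma mon_zpow {n : ℕ} {G : Type*} [CommGroup G] (m : Fin n →₀ ℕ) (g : G) (a : Fin n → ℤ) :
    mon m (fun j => g ^ a j) = g ^ (∑ j, (m j : ℤ) * a j) := by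
  rw [zpow_sum', mon]
  refine Finset.prod_congr rfl fun j _ => ?_
  rw [mul_comm, zpow_mul, zpow_natCast]

variable [CharZero K]

theorem smallA {n d s T : ℕ} (hs1 : 1 ≤ s) (hTs : T = s.factorial * 2 ^ s) (σ : K →+* ℂ)
    (P : Finset Kˣ) (K1 : ℝ) (hK1 : 1 ≤ K1)
    (hPP : ((P * P).card : ℝ) ≤ K1 * P.card) (g : Kˣ) (hg : g ∈ P) (δ η : ℝ) (hδ0 : 0 ≤ δ) (hη0 : 0 ≤ η)
    (hδP : ∀ p ∈ P, hgt (p / g) ≤ δ) 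
    (hηP : ∀ p ∈ P, |(Complex.log (σ p)).im - (Complex.log (σ g)).im| ≤ η)
    (hδ : ((1 + T * T.factorial : ℕ) : ℝ) * T * (s * d * δ) < 1 / (T + 1))
    (hη : s * d * η * T.factorial < Real.pi) (hη1 : 2 * η < Real.pi) 
    (S : Finset (Fin (n + 1) →₀ ℕ)) (hSd : ∀ m ∈ S, ∑ j, m j ≤ d) (hs : S.card ≤ s)
    (b : (Fin (n + 1) →₀ ℕ) → K) (hb : ∀ m ∈ S, b m ≠ 0) :
    ∃ Q : Fin (n + 1) → Finset Kˣ, (∀ i, Q i ⊆ P ∧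
        (P.card : ℝ) ≤ 2 ^ (n + 5) * s ^ 2 * (512 * s * (d + 1) + 1) *
          K1 ^ ((1 + (d + 1) ^ n) * n + 1) * (Q i).card) ∧
      ∀ p q : Fin (n + 1) → Kˣ, (∀ i, p i ∈ Q i) → (∀ i, q i ∈ Q i) →
        ∑ m ∈ S, b m * ((mon m p : Kˣ) - (mon m q : Kˣ) : K) = 0 →
        ∀ m ∈ S, mon m p = mon m q := by
  let X := {p // p ∈ P}
  let y : X → Kˣ := fun x => x.1 / g
  let lg : X → ℂ := fun x => Complex.log (σ x.1) - Complex.log (σ g)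
  have hσ : ∀ u : Kˣ, σ u ≠ 0 := fun u => (map_ne_zero σ).2 u.ne_zero
  have hlg : ∀ x, Complex.exp (lg x) = σ (y x) := by
    intro x
    simp only [lg, y]
    rw [Complex.exp_sub, Complex.exp_log (hσ _), Complex.exp_log (hσ _), Units.val_div_eq_div_val,
      map_div₀]
  have him : ∀ x, |(lg x).im| ≤ η := fun x => by
    simp only [lg, Complex.sub_im]; exact hηP x.1 x.2
  let V1 : Set ℂ := Set.range fun t : X × X => lg t.1 - lg t.2
  let V2 : Set ℂ := Set.range fun t : S × (Fin (n + 1) → X) × (Fin (n + 1) → X) =>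
    ∑ j, (t.1.1 j : ℂ) * (lg (t.2.1 j) - lg (t.2.2 j))
  obtain ⟨lam, a, hlam, hV⟩ := exists_int_dual lg (V1 ∪ V2)
    ((Set.finite_range _).union (Set.finite_range _))
  let u2 : ℚˣ := Units.mk0 2 (by norm_num)
  have hu2 : (u2 : ℚ) = 2 := rfl
  have hu2inj : Function.Injective fun k : ℤ => u2 ^ k := by
    intro k k' h
    have h1 := congrArg Units.val h
    simp only [Units.val_zpow_eq_zpow_val, hu2] at h1
    exact zpow_right_injective₀ (by norm_num) (by norm_num) h1
  have hinj : ∀ m ∈ S, ∀ p q : Fin (n + 1) → X, (mon m fun j => u2 ^ a (p j)) =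
      (mon m fun j => u2 ^ a (q j)) → (mon m fun j => y (p j)) = (mon m fun j => y (q j)) := by
    intro m hm p q h
    rw [mon_zpow, mon_zpow] at h
    have h1 := hu2inj h
    have h2 : lam (∑ j, (m j : ℂ) * (lg (p j) - lg (q j))) = 0 := by
      rw [map_sum]
      have : ∀ j, lam ((m j : ℂ) * (lg (p j) - lg (q j))) = (m j : ℚ) * a (p j) - (m j : ℚ) * a (q j) := by
        intro j
        rw [← nsmul_eq_mul, map_nsmul, map_sub, hlam, hlam, nsmul_eq_mul, mul_sub]
      rw [Finset.sum_congr rfl fun j _ => this j, Finset.sum_sub_distrib, sub_eq_zero]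
      exact_mod_cast h1
    have h3 := hV _ (Or.inr ⟨(⟨m, hm⟩, p, q), rfl⟩) h2
    simp_rw [mul_sub] at h3
    rw [Finset.sum_sub_distrib, sub_eq_zero] at h3
    have h4 : ∀ p : Fin (n + 1) → X, Complex.exp (∑ j, (m j : ℂ) * lg (p j)) =
        σ (mon m fun j => y (p j) : Kˣ) := by
      intro p
      rw [Complex.exp_sum, mon, Units.coe_prod, map_prod]
      refine Finset.prod_congr rfl fun j _ => ?_
      rw [Complex.exp_nat_mul, hlg, Units.val_pow_eq_pow_val, map_pow]
    apply Units.ext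
    apply σ.injective
    rw [← h4, ← h4, h3]
  let yh : X → ℚˣ := fun x => u2 ^ a x
  have hyh : Function.Injective yh := by
    intro x x' h
    have h1 : a x = a x' := hu2inj h
    have h2 : lam (lg x - lg x') = 0 := by rw [map_sub, hlam, hlam, h1, sub_self]
    have h3 := sub_eq_zero.1 (hV _ (Or.inl ⟨(x, x'), rfl⟩) h2)
    have h4 : (y x : K) = y x' := σ.injective (by rw [← hlg, ← hlg, h3])
    have h5 : y x = y x' := Units.ext h4
    exact Subtype.ext (div_left_injective h5)
  let Y : Finset ℚˣ := Finset.univ.image yh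
  have hYc : Y.card = P.card := by
    rw [Finset.card_image_of_injective _ hyh, Finset.card_univ, Fintype.card_coe]
  have hPn : P.Nonempty := ⟨g, hg⟩
  have hPc : (0 : ℝ) < P.card := by exact_mod_cast Finset.card_pos.2 hPn
  have hYn : Y.Nonempty := by rw [← Finset.card_pos, hYc]; exact Finset.card_pos.2 hPn
  have hYY : (Y * Y).card ≤ (P * P).card := by
    have h1 : Y * Y = (Finset.univ : Finset (X × X)).image fun t => yh t.1 * yh t.2 := by
      ext z
      simp only [Y, Finset.mem_mul, Finset.mem_image, Finset.mem_univ, true_and, Prod.exists]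
      constructor
      · rintro ⟨_, ⟨x, rfl⟩, _, ⟨x', rfl⟩, rfl⟩
        exact ⟨x, x', rfl⟩
      · rintro ⟨x, x', rfl⟩
        exact ⟨_, ⟨x, rfl⟩, _, ⟨x', rfl⟩, rfl⟩
    have h2 : P * P = (Finset.univ : Finset (X × X)).image fun t => t.1.1 * t.2.1 := by
      ext z
      simp only [Finset.mem_mul, Finset.mem_image, Finset.mem_univ, true_and, Prod.exists]
      constructor
      · rintro ⟨x, hx, x', hx', rfl⟩
        exact ⟨⟨x, hx⟩, ⟨x', hx'⟩, rfl⟩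
      · rintro ⟨x, x', rfl⟩
        exact ⟨_, x.2, _, x'.2, rfl⟩
    rw [h1, h2]
    refine card_image_le_of_factor _ _ _ ?_
    rintro ⟨x, x'⟩ - ⟨z, z'⟩ - h
    simp only at h
    simp only [yh]
    rw [← zpow_add, ← zpow_add]
    congr 1
    have h3 : Complex.exp (lg x + lg x') = Complex.exp (lg z + lg z') := by
      rw [Complex.exp_add, Complex.exp_add, hlg, hlg, hlg, hlg, ← map_mul, ← map_mul,
        ← Units.val_mul, ← Units.val_mul]
      simp only [y]
      rw [div_mul_div_comm, div_mul_div_comm, h]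
    rw [Complex.exp_eq_exp_iff_exists_int] at h3
    obtain ⟨k, hk⟩ := h3
    have hi := congrArg Complex.im hk
    simp at hi
    have hk0 : k = 0 := by
      by_contra hk0
      have hk1 : (1 : ℝ) ≤ |(k : ℝ)| := by exact_mod_cast Int.one_le_abs hk0
      have e1 : (k : ℝ) * (2 * Real.pi) = (lg x).im + (lg x').im - (lg z).im - (lg z').im := by linarith
      have e2 : |(k : ℝ) * (2 * Real.pi)| ≤ 4 * η := by
        rw [e1, abs_le]
        have h1 := abs_le.1 (him x)
        have h2 := abs_le.1 (him x')
        have h3 := abs_le.1 (him z)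
        have h4 := abs_le.1 (him z')
        constructor <;> linarith
      rw [abs_mul, abs_of_pos Real.two_pi_pos] at e2
      nlinarith [Real.two_pi_pos]
    rw [hk0] at hk
    simp at hk
    have := congrArg lam hk
    rw [map_add, map_add, hlam, hlam, hlam, hlam] at this
    exact_mod_cast this
  obtain ⟨c, hc0, hc⟩ := all_c hs1 hTs σ y lg a lam δ η hδ0 hη0 (fun x => hδP x.1 x.2) hlg him hlam hδ hη
    S hSd hs (fun m => b m * ((g ^ (∑ j, m j) : Kˣ) : K))
    (fun m hm => mul_ne_zero (hb m hm) (Units.ne_zero _)) u2 hu2 hinj S.card S subset_rfl le_rfl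
  set E := (1 + (d + 1) ^ n) * n with hE
  set τ : ℝ := 1 / (2 ^ (n + 3) * s ^ (2 * 1) * K1 ^ E) with hτ
  have hs0 : (1 : ℝ) ≤ s := by exact_mod_cast hs1
  have hDpos : (0 : ℝ) < 2 ^ (n + 3) * s ^ (2 * 1) * K1 ^ E := by positivity
  have hτ0 : 0 < τ := by positivity
  by_cases hbig : (96 * s * (d + 1) + 1 : ℝ) ≤ τ * P.card
  · obtain ⟨Q, hQ, hQ'⟩ := largeL (K := ℚ) (r := 1) (d := d) (s := s) Y hYn K1 hK1 (by
      rw [hYc]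
      refine le_trans ?_ hPP
      have : ((Y * Y).card : ℝ) ≤ (P * P).card := by exact_mod_cast hYY
      refine le_trans (le_of_eq ?_) this
      congr!) le_rfl (by
        refine ⟨fun _ => u2, ?_⟩
        intro p hp q hq
        obtain ⟨x, -, rfl⟩ := Finset.mem_image.1 hp
        obtain ⟨x', -, rfl⟩ := Finset.mem_image.1 hq
        refine ⟨1, one_pos, ?_⟩
        have hu : u2 ∈ Subgroup.closure (Set.range fun _ : Fin 1 => u2) :=
          Subgroup.subset_closure ⟨0, rfl⟩
        exact pow_mem (div_mem (zpow_mem hu _) (zpow_mem hu _)) _) S hSd hs hs1 c hc0 τ hτ (by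
        intro g' hg'
        rw [hYc]
        refine le_trans ?_ hbig
        obtain ⟨x', -, rfl⟩ := Finset.mem_image.1 hg'
        have hsub : (Y.filter fun p => hgt (p / yh x') ≤ 32 * (1 : ℕ) * s * (d + 1)) ⊆
            (Finset.Icc (-(48 * s * (d + 1) : ℕ) : ℤ) ((48 * s * (d + 1) : ℕ) : ℤ)).image
              fun k => u2 ^ k * yh x' := by
          intro p hp
          obtain ⟨hpY, hph⟩ := Finset.mem_filter.1 hp
          obtain ⟨x, -, rfl⟩ := Finset.mem_image.1 hpY
          rw [Finset.mem_image]
          refine ⟨a x - a x', ?_, ?_⟩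
          · have h1 : yh x / yh x' = u2 ^ (a x - a x') := by
              simp only [yh]; rw [zpow_sub, div_eq_mul_inv]
            rw [h1, hgt_zpow] at hph
            have h2 := hgt_two u2 hu2
            have h3 : (2 / 3 : ℝ) ≤ hgt u2 := by
              have := Real.log_two_gt_d9; linarith
            have h4 : ((a x - a x').natAbs : ℝ) * (2 / 3) ≤ (a x - a x').natAbs * hgt u2 := by gcongr
            have h5 : ((a x - a x').natAbs : ℝ) ≤ (48 * s * (d + 1) : ℕ) := by
              push_cast at *
              linarith
            have h6 : (a x - a x').natAbs ≤ 48 * s * (d + 1) := by exact_mod_cast h5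
            rw [Finset.mem_Icc]
            generalize 48 * s * (d + 1) = B at *
            omega
          · simp only [yh]
            rw [← zpow_add]; congr 1; ring
        have h1 := (Finset.card_le_card hsub).trans Finset.card_image_le
        rw [Int.card_Icc] at h1
        have h2 : (Y.filter fun p => hgt (p / yh x') ≤ 32 * (1 : ℕ) * s * (d + 1)).card ≤
            2 * (48 * s * (d + 1)) + 1 := by
          generalize 48 * s * (d + 1) = B at *
          omega
        have h3 : ((Y.filter fun p => hgt (p / yh x') ≤ 32 * (1 : ℕ) * s * (d + 1)).card : ℝ) ≤
            ((2 * (48 * s * (d + 1)) + 1 : ℕ) : ℝ) := by exact_mod_cast h2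
        refine h3.trans ?_
        push_cast
        linarith)
    refine ⟨fun i => (Finset.univ.filter fun x : X => yh x ∈ Q i).map (Function.Embedding.subtype _),
      ?_, ?_⟩
    · intro i
      constructor
      · intro z hz
        obtain ⟨x, -, rfl⟩ := Finset.mem_map.1 hz
        exact x.2
      · have h1 : (Q i).card ≤ (Finset.univ.filter fun x : X => yh x ∈ Q i).card := by
          rw [← Finset.card_image_of_injective _ hyh]
          refine Finset.card_le_card fun z hz => ?_
          obtain ⟨x, -, rfl⟩ := Finset.mem_image.1 ((hQ i).1 hz)
          exact Finset.mem_image_of_mem _ (Finset.mem_filter.2 ⟨Finset.mem_univ _, hz⟩)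
        rw [Finset.card_map]
        have h2 := (hQ i).2
        rw [hYc, hτ, one_div, inv_mul_le_iff₀ hDpos] at h2
        refine h2.trans ?_
        have h3 : ((Q i).card : ℝ) ≤ ((Finset.univ.filter fun x : X => yh x ∈ Q i).card : ℝ) := by
          exact_mod_cast h1
        push_cast
        calc _ = 2 ^ (n + 5) * s ^ 2 * (512 * s * (d + 1) + 1) * K1 ^ (E + 1) * (Q i).card := by ring
          _ ≤ _ := by gcongr
    · intro p q hp hq hsum m hm
      have hp' : ∀ i, ∃ x : X, x.1 = p i ∧ yh x ∈ Q i := by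
        intro i
        obtain ⟨x, hx, hx'⟩ := Finset.mem_map.1 (hp i)
        exact ⟨x, hx', (Finset.mem_filter.1 hx).2⟩
      have hq' : ∀ i, ∃ x : X, x.1 = q i ∧ yh x ∈ Q i := by
        intro i
        obtain ⟨x, hx, hx'⟩ := Finset.mem_map.1 (hq i)
        exact ⟨x, hx', (Finset.mem_filter.1 hx).2⟩
      choose p' hp1 hp2 using hp'
      choose q' hq1 hq2 using hq'
      have hmp : ∀ m, mon m p = g ^ (∑ j, m j) * mon m (fun j => y (p' j)) := by
        intro m
        rw [mon_const_mul m g p]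
        simp only [y, hp1]
      have hmq : ∀ m, mon m q = g ^ (∑ j, m j) * mon m (fun j => y (q' j)) := by
        intro m
        rw [mon_const_mul m g q]
        simp only [y, hq1]
      have h1 := hc p' q' (by
        rw [← hsum]
        refine Finset.sum_congr rfl fun m _ => ?_
        rw [hmp, hmq]
        push_cast
        ring) (fun J hJ hJs m hm => hQ' J hJ _ _ hp2 hq2 hJs m hm) m hm
      rw [hmp, hmq, hinj m hm p' q' h1]
  · refine ⟨fun _ => {g}, fun i => ⟨by simpa using hg, ?_⟩, ?_⟩
    · push Not at hbig
      rw [hτ, one_div, inv_mul_lt_iff₀ hDpos] at hbig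
      refine hbig.le.trans ?_
      rw [Finset.card_singleton]
      push_cast
      have h1 : (1 : ℝ) ≤ K1 ^ E := one_le_pow₀ hK1
      calc (2 : ℝ) ^ (n + 3) * s ^ (2 * 1) * K1 ^ E * (96 * s * (d + 1) + 1) 
          ≤ (4 * 2 ^ (n + 3)) * s ^ (2 * 1) * (K1 ^ E * K1) * (512 * s * (d + 1) + 1) := by
            have h2 : (2 : ℝ) ^ (n + 3) ≤ 4 * 2 ^ (n + 3) := by
              have : (0 : ℝ) < 2 ^ (n + 3) := by positivity
              linarith
            have h3 : K1 ^ E ≤ K1 ^ E * K1 := le_mul_of_one_le_right (by positivity) hK1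
            gcongr
            norm_num
        _ = _ := by ring
    · intro p q hp hq _ m _
      have : p = q := by
        ext1 i
        rw [Finset.mem_singleton.1 (hp i), Finset.mem_singleton.1 (hq i)]
      rw [this]
end

lemma theta_a (r s : ℕ) (hr : 1 ≤ r) : s ^ (2 * r) ≤ ((r + 1) ^ r) ^ (2 * s) := by
  have h1 : s ≤ 2 ^ s := Nat.lt_two_pow_self.le
  calc s ^ (2 * r) ≤ (2 ^ s) ^ (2 * r) := Nat.pow_le_pow_left h1 _
    _ = (2 ^ r) ^ (2 * s) := by rw [← pow_mul, ← pow_mul]; congr 1; ring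
    _ ≤ _ := Nat.pow_le_pow_left (Nat.pow_le_pow_left (by omega) _) _

lemma theta_b (r A : ℕ) (hr : 1 ≤ r) : (A * r ^ 3 + 1) ^ r ≤ ((r + 1) ^ r) ^ (A + 3) := by
  have h1 : A + 1 ≤ 2 ^ A := Nat.lt_two_pow_self
  have h2 : 1 ≤ r ^ 3 := Nat.one_le_pow _ _ hr
  calc (A * r ^ 3 + 1) ^ r ≤ ((A + 1) * r ^ 3) ^ r := Nat.pow_le_pow_left (by nlinarith) _
    _ ≤ ((r + 1) ^ A * (r + 1) ^ 3) ^ r := by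
      apply Nat.pow_le_pow_left
      exact Nat.mul_le_mul (h1.trans (Nat.pow_le_pow_left (by omega) _))
        (Nat.pow_le_pow_left (by omega) _)
    _ = _ := by rw [← pow_add, ← pow_mul, ← pow_mul, mul_comm]

section
variable {K : Type} [Field K] [HField K] [CharZero K]

theorem smallB {n d s r T Δ W : ℕ} (hs1 : 1 ≤ s) (hTs : T = s.factorial * 2 ^ s) 
    (hΔ : Δ = (1 + T * T.factorial) * T * (s * d) * (T + 1) + 1) (hW : W = s * d * T.factorial + 1)
    (σ : K →+* ℂ)
    (P : Finset Kˣ) (K1 : ℝ) (hK1 : 1 ≤ K1)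
    (hPP : ((P * P).card : ℝ) ≤ K1 * P.card) (hr : 1 ≤ r) (hRk : Rk P r)
    (S : Finset (Fin (n + 1) →₀ ℕ)) (hSd : ∀ m ∈ S, ∑ j, m j ≤ d) (hs : S.card ≤ s)
    (b : (Fin (n + 1) →₀ ℕ) → K) (hb : ∀ m ∈ S, b m ≠ 0) (D : ℝ) (hD : 1 ≤ D)
    (g : Kˣ) (hg : g ∈ P) 
    (hC : (P.card : ℝ) < D * ((P.filter fun p => hgt (p / g) ≤ 32 * r * s * (d + 1)).card : ℝ)) 
    (H : ℝ) (hH : H = D * (2 * (2 * (64 * r ^ 3 * s * (d + 1) * Δ : ℕ) + 1) ^ r) * (8 * W + 1)) :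
    ∃ Q : Fin (n + 1) → Finset Kˣ, (∀ i, Q i ⊆ P ∧
        (P.card : ℝ) ≤ H * (2 ^ (n + 5) * s ^ 2 * (512 * s * (d + 1) + 1) *
          (K1 * H) ^ ((1 + (d + 1) ^ n) * n + 1)) * (Q i).card) ∧
      ∀ p q : Fin (n + 1) → Kˣ, (∀ i, p i ∈ Q i) → (∀ i, q i ∈ Q i) →
        ∑ m ∈ S, b m * ((mon m p : Kˣ) - (mon m q : Kˣ) : K) = 0 →
        ∀ m ∈ S, mon m p = mon m q := by
  set Y := P.filter fun p => hgt (p / g) ≤ 32 * r * s * (d + 1) with hYdef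
  have hYP : Y ⊆ P := Finset.filter_subset _ _
  have hYn : Y.Nonempty := ⟨g, Finset.mem_filter.2 ⟨hg, by
    rw [div_self', hgt_one]; positivity⟩⟩
  have hΔ1 : 1 ≤ Δ := by omega
  have hΔ0 : (0 : ℝ) < Δ := by exact_mod_cast hΔ1
  obtain ⟨Y', hY'Y, hY'c, hY'd⟩ := cov_hgt hr hRk hYP hYn hg (ε := 1 / Δ) (by positivity)
    (fun y hy => (Finset.mem_filter.1 hy).2) (64 * r ^ 3 * s * (d + 1) * Δ) (by
      push_cast
      apply le_of_eq
      field_simp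
      ring)
  have hY'n : Y'.Nonempty := by
    rw [← Finset.card_pos]
    have := Finset.card_pos.2 hYn
    rcases Nat.eq_zero_or_pos Y'.card with h0 | h0
    · rw [h0] at hY'c; omega
    · exact h0
  have hW1 : 1 ≤ W := by omega
  have hW0 : (0 : ℝ) < W := by exact_mod_cast hW1
  obtain ⟨k, hk, P2, hP2, hP2k, hP2c⟩ := pigeon Y' (Finset.Icc (-(4 * W : ℕ) : ℤ) ((4 * W : ℕ) : ℤ))
    (fun p => ⌊(Complex.log (σ p)).im * W⌋) (by
      intro p _
      have h1 := Complex.neg_pi_lt_log_im (σ p)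
      have h2 := Complex.log_im_le_pi (σ p)
      have h3 := Real.pi_lt_four
      rw [Finset.mem_Icc]
      constructor
      · rw [Int.le_floor]; push_cast; nlinarith
      · have : ⌊(Complex.log (σ p)).im * W⌋ ≤ ((4 * W : ℕ) : ℝ) := 
          (Int.floor_le _).trans (by push_cast; nlinarith)
        exact_mod_cast this) hY'n
  have hP2n : P2.Nonempty := by
    rw [← Finset.card_pos]
    have := Finset.card_pos.2 hY'n
    rcases Nat.eq_zero_or_pos P2.card with h0 | h0
    · rw [h0] at hP2c; omega
    · exact h0
  obtain ⟨g2, hg2⟩ := hP2n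
  have hcardI : (Finset.Icc (-(4 * W : ℕ) : ℤ) ((4 * W : ℕ) : ℤ)).card = 8 * W + 1 := by
    rw [Int.card_Icc]; omega
  rw [hcardI] at hP2c
  have hP2P : P2 ⊆ P := hP2.trans (hY'Y.trans hYP)
  have hH1 : 1 ≤ H := by
    have h1 : (1 : ℝ) ≤ (2 * (64 * r ^ 3 * s * (d + 1) * Δ : ℕ) + 1) ^ r := one_le_pow₀ (by
      have : (0 : ℝ) ≤ (64 * r ^ 3 * s * (d + 1) * Δ : ℕ) := Nat.cast_nonneg _
      linarith)
    rw [hH]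
    calc (1 : ℝ) = 1 * (1 * 1) * 1 := by norm_num
      _ ≤ _ := by gcongr <;> linarith
  have hPH : (P.card : ℝ) ≤ H * P2.card := by
    have h1 : (Y.card : ℝ) ≤ 2 * (2 * (64 * r ^ 3 * s * (d + 1) * Δ : ℕ) + 1) ^ r * Y'.card := by
      exact_mod_cast hY'c
    have h2 : (Y'.card : ℝ) ≤ (8 * W + 1) * P2.card := by exact_mod_cast hP2c
    calc (P.card : ℝ) ≤ D * Y.card := hC.le
      _ ≤ D * (2 * (2 * (64 * r ^ 3 * s * (d + 1) * Δ : ℕ) + 1) ^ r * ((8 * W + 1) * P2.card)) := by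
        gcongr; exact h1.trans (by gcongr)
      _ = _ := by rw [hH]; ring
  obtain ⟨Q, hQ, hQ'⟩ := smallA (d := d) hs1 hTs σ P2 (K1 * H) (by nlinarith) (by
      calc ((P2 * P2).card : ℝ) ≤ (P * P).card := by
            exact_mod_cast Finset.card_le_card (Finset.mul_subset_mul hP2P hP2P)
        _ ≤ K1 * P.card := hPP
        _ ≤ K1 * (H * P2.card) := by gcongr
        _ = _ := by ring) g2 hg2 (1 / Δ) (1 / W) (by positivity) (by positivity)
    (fun p hp => hY'd p (hP2 hp) g2 (hP2 hg2)) (by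
      intro p hp
      have h1 := (hP2k p hp).trans (hP2k g2 hg2).symm
      have h2 := Int.abs_sub_lt_one_of_floor_eq_floor h1
      rw [← sub_mul, abs_mul, abs_of_pos hW0] at h2
      rw [le_div_iff₀ hW0]; exact h2.le) (by
      have e : (Δ : ℝ) = ((1 + T * T.factorial : ℕ) : ℝ) * T * (s * d) * (T + 1) + 1 := by
        rw [hΔ]; push_cast; ring
      have hT1 : (0 : ℝ) < T + 1 := by positivity
      rw [lt_div_iff₀ hT1]
      calc _ = (((1 + T * T.factorial : ℕ) : ℝ) * T * (s * d) * (T + 1)) / Δ := by ring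
        _ < 1 := by rw [div_lt_one hΔ0, e]; linarith) (by
      have e : (W : ℝ) = s * d * T.factorial + 1 := by
        rw [hW]; push_cast; ring
      calc _ = (s * d * T.factorial : ℝ) / W := by ring
        _ < 1 := by rw [div_lt_one hW0, e]; linarith
        _ < Real.pi := by have := Real.pi_gt_three; linarith) (by
      have : 1 / (W : ℝ) ≤ 1 := by rw [div_le_one hW0]; exact_mod_cast hW1
      have := Real.pi_gt_three; linarith) S hSd hs b hb
  refine ⟨Q, fun i => ⟨(hQ i).1.trans hP2P, ?_⟩, hQ'⟩
  calc (P.card : ℝ) ≤ H * P2.card := hPH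
    _ ≤ H * _ := mul_le_mul_of_nonneg_left (hQ i).2 (by linarith)
    _ = _ := by ring
end

theorem box_thm (n d s : ℕ) (hs1 : 1 ≤ s) : ∃ c e : ℕ, ∀ (K : Type) [Field K] [HField K] [CharZero K]
    (_ : K →+* ℂ) (P : Finset Kˣ) (_ : P.Nonempty) (K1 : ℝ) (_ : 1 ≤ K1)
    (_ : ((P * P).card : ℝ) ≤ K1 * P.card) (r : ℕ) (_ : 1 ≤ r) (_ : Rk P r)
    (S : Finset (Fin (n + 1) →₀ ℕ)) (_ : ∀ m ∈ S, ∑ j, m j ≤ d) (_ : S.card ≤ s)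
    (b : (Fin (n + 1) →₀ ℕ) → K) (_ : ∀ m ∈ S, b m ≠ 0),
    ∃ Q : Fin (n + 1) → Finset Kˣ, (∀ i, Q i ⊆ P ∧
        (P.card : ℝ) ≤ c * (K1 * (r + 1) ^ r) ^ e * (Q i).card) ∧
      ∀ p q : Fin (n + 1) → Kˣ, (∀ i, p i ∈ Q i) → (∀ i, q i ∈ Q i) →
        ∑ m ∈ S, b m * ((mon m p : Kˣ) - (mon m q : Kˣ) : K) = 0 →
        ∀ m ∈ S, mon m p = mon m q := by
  obtain ⟨T, hT⟩ : ∃ T, T = s.factorial * 2 ^ s := ⟨_, rfl⟩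
  obtain ⟨Δ, hΔ⟩ : ∃ Δ, Δ = (1 + T * T.factorial) * T * (s * d) * (T + 1) + 1 := ⟨_, rfl⟩
  obtain ⟨W, hW⟩ : ∃ W, W = s * d * T.factorial + 1 := ⟨_, rfl⟩
  obtain ⟨E, hE⟩ : ∃ E, E = (1 + (d + 1) ^ n) * n := ⟨_, rfl⟩
  -- exponents
  obtain ⟨eL, heL⟩ : ∃ eL, eL = E + 2 * s + 1 + (512 * s * (d + 1) + 3) := ⟨_, rfl⟩
  obtain ⟨eH, heH⟩ : ∃ eH, eH = E + 2 * s + (128 * s * (d + 1) * Δ + 3) := ⟨_, rfl⟩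
  obtain ⟨cH, hcH⟩ : ∃ cH, cH = 2 ^ (n + 3) * 2 * (8 * W + 1) := ⟨_, rfl⟩
  obtain ⟨cS, hcS⟩ : ∃ cS, cS = cH * (2 ^ (n + 5) * s ^ 2 * (512 * s * (d + 1) + 1) * cH ^ (E + 1)) :=
    ⟨_, rfl⟩
  refine ⟨2 ^ (n + 5) + cS, eL + (eH + (1 + eH) * (E + 1)), ?_⟩
  intro K _ _ _ σ P hP K1 hK1 hPP r hr hRk S hSd hs b hb
  have hs0 : (1 : ℝ) ≤ s := by exact_mod_cast hs1
  obtain ⟨Θ, hΘ⟩ : ∃ Θ : ℝ, Θ = (r + 1) ^ r := ⟨_, rfl⟩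
  have hΘ1 : 1 ≤ Θ := by
    rw [hΘ]; exact one_le_pow₀ (by linarith [(Nat.cast_nonneg r : (0 : ℝ) ≤ r)])
  obtain ⟨Λ, hΛ⟩ : ∃ Λ : ℝ, Λ = K1 * Θ := ⟨_, rfl⟩
  have hΛ1 : 1 ≤ Λ := by rw [hΛ]; nlinarith
  have hKΛ : K1 ≤ Λ := by rw [hΛ]; nlinarith
  have hΘΛ : Θ ≤ Λ := by rw [hΛ]; nlinarith
  rw [← hΘ, ← hΛ]
  obtain ⟨D, hDdef⟩ : ∃ D : ℝ, D = 2 ^ (n + 3) * s ^ (2 * r) * K1 ^ ((1 + (d + 1) ^ n) * n) := ⟨_, rfl⟩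
  have hsr : (s : ℝ) ^ (2 * r) ≤ Λ ^ (2 * s) := by
    have : (s : ℝ) ^ (2 * r) ≤ Θ ^ (2 * s) := by rw [hΘ]; exact_mod_cast theta_a r s hr
    exact this.trans (pow_le_pow_left₀ (by linarith) hΘΛ _)
  have hAr : ∀ A : ℕ, ((A : ℝ) * r ^ 3 + 1) ^ r ≤ Λ ^ (A + 3) := by
    intro A
    have : ((A : ℝ) * r ^ 3 + 1) ^ r ≤ Θ ^ (A + 3) := by rw [hΘ]; exact_mod_cast theta_b r A hr
    exact this.trans (pow_le_pow_left₀ (by linarith) hΘΛ _)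
  have hDΛ : D ≤ 2 ^ (n + 3) * Λ ^ (E + 2 * s) := by
    rw [hDdef, ← hE]
    calc _ ≤ 2 ^ (n + 3) * Λ ^ (2 * s) * Λ ^ E := by gcongr
      _ = _ := by ring
  have hD1 : 1 ≤ D := by
    rw [hDdef]
    have h1 : (1 : ℝ) ≤ 2 ^ (n + 3) := one_le_pow₀ (by norm_num)
    have h2 : (1 : ℝ) ≤ s ^ (2 * r) := one_le_pow₀ hs0
    have h3 : (1 : ℝ) ≤ K1 ^ ((1 + (d + 1) ^ n) * n) := one_le_pow₀ hK1
    calc (1 : ℝ) = 1 * 1 * 1 := by norm_num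
      _ ≤ _ := by gcongr
  by_cases hNC : ∀ g ∈ P, ((P.filter fun p => hgt (p / g) ≤ 32 * r * s * (d + 1)).card : ℝ)
      ≤ 1 / D * P.card
  · obtain ⟨Q, hQ, hQ'⟩ := largeL P hP K1 hK1 hPP hr hRk S hSd hs hs1 b hb (1 / D) (by rw [hDdef]) hNC
    refine ⟨Q, fun i => ⟨(hQ i).1, ?_⟩, hQ' S subset_rfl⟩
    have h1 := (hQ i).2
    rw [one_div, inv_mul_le_iff₀ (by linarith)] at h1
    refine h1.trans ?_
    have h2 := hAr (512 * s * (d + 1))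
    have h3 : (2 * ((256 * r ^ 3 * s * (d + 1) : ℕ) : ℝ) + 1) ^ r ≤ Λ ^ (512 * s * (d + 1) + 3) := by
      refine le_trans (le_of_eq ?_) h2
      push_cast; ring
    calc D * (4 * K1 * (2 * ((256 * r ^ 3 * s * (d + 1) : ℕ) : ℝ) + 1) ^ r * (Q i).card)
        ≤ (2 ^ (n + 3) * Λ ^ (E + 2 * s)) * (4 * Λ * Λ ^ (512 * s * (d + 1) + 3) * (Q i).card) := by
          gcongr
      _ = 2 ^ (n + 5) * Λ ^ eL * (Q i).card := by rw [heL]; ring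
      _ ≤ _ := by
        gcongr ?_ * ?_ * _
        · push_cast; linarith [(Nat.cast_nonneg cS : (0 : ℝ) ≤ cS)]
        · exact pow_le_pow_right₀ hΛ1 (by omega)
  · push Not at hNC
    obtain ⟨g, hg, hgC⟩ := hNC
    rw [one_div, inv_mul_lt_iff₀ (by linarith)] at hgC
    obtain ⟨H, hHdef⟩ : ∃ H : ℝ,
      H = D * (2 * (2 * (64 * r ^ 3 * s * (d + 1) * Δ : ℕ) + 1) ^ r) * (8 * W + 1) := ⟨_, rfl⟩
    obtain ⟨Q, hQ, hQ'⟩ := smallB hs1 hT hΔ hW σ P K1 hK1 hPP hr hRk S hSd hs b hb D hD1 g hg hgC H hHdef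
    refine ⟨Q, fun i => ⟨(hQ i).1, ?_⟩, hQ'⟩
    have hH0 : 0 ≤ H := by rw [hHdef]; positivity
    have hHΛ : H ≤ cH * Λ ^ eH := by
      have h2 := hAr (128 * s * (d + 1) * Δ)
      have h3 : (2 * ((64 * r ^ 3 * s * (d + 1) * Δ : ℕ) : ℝ) + 1) ^ r ≤
          Λ ^ (128 * s * (d + 1) * Δ + 3) := by
        refine le_trans (le_of_eq ?_) h2
        push_cast; ring
      rw [hHdef]
      calc _ ≤ (2 ^ (n + 3) * Λ ^ (E + 2 * s)) * (2 * Λ ^ (128 * s * (d + 1) * Δ + 3)) * (8 * W + 1) := by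
            gcongr
        _ = _ := by rw [hcH, heH]; push_cast; ring
    refine (hQ i).2.trans ?_
    rw [← hE]
    calc _ ≤ (cH * Λ ^ eH) * (2 ^ (n + 5) * s ^ 2 * (512 * s * (d + 1) + 1) *
          (Λ * (cH * Λ ^ eH)) ^ (E + 1)) * (Q i).card := by gcongr
      _ = cS * Λ ^ (eH + (1 + eH) * (E + 1)) * (Q i).card := by
        have : Λ * (cH * Λ ^ eH) = cH * Λ ^ (1 + eH) := by ring
        rw [this, mul_pow, ← pow_mul, pow_add Λ eH, hcS]
        push_cast; ring
      _ ≤ _ := by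
        gcongr ?_ * ?_ * _
        · push_cast; 
          have : (0 : ℝ) ≤ 2 ^ (n + 5) := by positivity
          linarith
        · exact pow_le_pow_right₀ hΛ1 (by omega)

theorem fr_rpow_ge {u β : ℝ} (h0 : 0 ≤ u) (h1 : u ≤ 1) (hβ : 0 < β) (hβ1 : β ≤ 3 / 4) :
    u ≤ u ^ β := by
  rcases h0.eq_or_lt with h | h
  · rw [← h]; exact Real.rpow_nonneg le_rfl _
  · calc u = u ^ (1 : ℝ) := (Real.rpow_one u).symm
      _ ≤ u ^ β := Real.rpow_le_rpow_of_exponent_ge h h1 (by linarith)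

theorem fr_rpow_ge2 {u β ν : ℝ} (h0 : 0 ≤ u) (hν : 0 < ν) (hν1 : ν ≤ 1 / 2) (h1 : u ≤ 1 - ν)
    (hβ : 0 < β) (hβ1 : β ≤ 3 / 4) : (1 + ν / 5) * u ≤ u ^ β := by
  rcases h0.eq_or_lt with h | h
  · rw [← h]; simp; exact Real.rpow_nonneg le_rfl _
  · have e1 : u ^ (3 / 4 : ℝ) ≤ u ^ β := Real.rpow_le_rpow_of_exponent_ge h (by linarith) hβ1
    refine le_trans ?_ e1
    have e2 : 0 ≤ u ^ (3 / 4 : ℝ) := Real.rpow_nonneg h0 _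
    refine le_of_pow_le_pow_left₀ (n := 4) (by norm_num) e2 ?_
    have e3 : (u ^ (3 / 4 : ℝ)) ^ 4 = u ^ 3 := by
      rw [← Real.rpow_natCast, ← Real.rpow_mul h0]; norm_num
    rw [e3]
    have e4 : (1 + ν / 5) ^ 4 * u ≤ 1 := by
      calc (1 + ν / 5) ^ 4 * u ≤ (1 + ν / 5) ^ 4 * (1 - ν) := by gcongr
        _ ≤ (1 + ν) * (1 - ν) := by
            have : (1 + ν / 5) ^ 4 ≤ 1 + ν := by
              have h2 : ν ^ 2 ≤ ν / 2 := by nlinarith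
              have h3 : ν ^ 3 ≤ ν / 4 := by nlinarith
              have h4 : ν ^ 4 ≤ ν / 8 := by nlinarith [sq_nonneg ν]
              nlinarith
            have : 0 ≤ 1 - ν := by linarith
            gcongr
        _ ≤ 1 := by nlinarith [sq_nonneg ν]
    calc ((1 + ν / 5) * u) ^ 4 = ((1 + ν / 5) ^ 4 * u) * u ^ 3 := by ring
      _ ≤ 1 * u ^ 3 := by gcongr
      _ = u ^ 3 := one_mul _

theorem fr_mass {ι : Type*} (Y : Finset ι) (b : ι → ℝ) (p β ν ω : ℝ) (hp : 0 < p)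
    (hb0 : ∀ y ∈ Y, 0 ≤ b y) (hbp : ∀ y ∈ Y, b y ≤ p) (hβ : 0 < β) (hβ1 : β ≤ 3 / 4)
    (hν : 0 < ν) (hν1 : ν ≤ 1 / 2) (hsum : ∑ y ∈ Y, b y = 1)
    (h : ∑ y ∈ Y, (b y / p) ^ β ≤ (1 + ω) / p) :
    1 - 5 * ω / ν ≤ ∑ y ∈ Y with (1 - ν) * p ≤ b y, b y := by
  have key : ∀ y ∈ Y, b y / p + (if (1 - ν) * p ≤ b y then 0 else (ν / 5) * (b y / p)) ≤
      (b y / p) ^ β := by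
    intro y hy
    have h0 : 0 ≤ b y / p := div_nonneg (hb0 y hy) hp.le
    split_ifs with hc
    · rw [add_zero]
      exact fr_rpow_ge h0 ((div_le_one hp).mpr (hbp y hy)) hβ hβ1
    · have := fr_rpow_ge2 h0 hν hν1 ((div_le_iff₀ hp).mpr (not_le.mp hc).le) hβ hβ1
      linarith
  have h2 := (Finset.sum_le_sum key).trans h
  rw [Finset.sum_add_distrib, ← Finset.sum_div, hsum, Finset.sum_ite, Finset.sum_const_zero,
    zero_add, ← Finset.mul_sum, ← Finset.sum_div] at h2
  have h3 := Finset.sum_filter_add_sum_filter_not Y (fun y => (1 - ν) * p ≤ b y) b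
  rw [hsum] at h3
  have h4 : ν / 5 * (∑ y ∈ Y with ¬ (1 - ν) * p ≤ b y, b y) ≤ ω := by
    have e : (1 + ν / 5 * (∑ y ∈ Y with ¬ (1 - ν) * p ≤ b y, b y)) / p ≤ (1 + ω) / p := by
      calc _ = 1 / p + ν / 5 * ((∑ y ∈ Y with ¬ (1 - ν) * p ≤ b y, b y) / p) := by ring
        _ ≤ _ := h2
    have := (div_le_div_iff_of_pos_right hp).mp e
    linarith
  have h5 : (∑ y ∈ Y with ¬ (1 - ν) * p ≤ b y, b y) ≤ 5 * ω / ν := by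
    rw [le_div_iff₀ hν]; linarith
  linarith

theorem fr_core {Q : Type*} [CommGroup Q] [DecidableEq Q] (X Y : Finset Q) (a b : Q → ℝ) (β p : ℝ)
    (ha0 : ∀ x, 0 ≤ a x) (hb0 : ∀ x, 0 ≤ b x) (has : ∑ x ∈ X, a x = 1) (hbs : ∑ x ∈ Y, b x = 1)
    (hap : ∀ x, a x ≤ p) (hbp : ∀ x, b x ≤ p) (x0 : Q) (hx0 : a x0 = p) (hp : 0 < p)
    (hβ : 1 / 2 ≤ β) (hβ1 : β ≤ 3 / 4)
    (hpβ : p ≤ p ^ (2 * β) * (1 + 1 / 10 ^ 8))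
    (hdis : ∀ (Z : Finset Q) (x y : Q → Q), (∀ z ∈ Z, x z * y z = z) →
      ∑ z ∈ Z, (a (x z) * b (y z)) ^ β ≤ 1) :
    ∃ S T : Finset Q, S ⊆ X ∧ T ⊆ Y ∧ 1 - 1 / 128 ≤ ∑ x ∈ S, a x ∧ 1 - 1 / 128 ≤ ∑ x ∈ T, b x ∧
      ((S * T).card : ℝ) ≤ 11 / 10 * S.card ∧ ((S * T).card : ℝ) ≤ 11 / 10 * T.card := by
  have hβ0 : 0 < β := by linarith
  have hpp : p ^ (2 * β) = p ^ β * p ^ β := by rw [two_mul, Real.rpow_add hp]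
  have hpb : 0 < p ^ β := Real.rpow_pos_of_pos hp _
  -- first sum
  have h1 : ∑ y ∈ Y, (p * b y) ^ β ≤ 1 := by
    have := hdis (Y.image (fun y => x0 * y)) (fun _ => x0) (fun z => x0⁻¹ * z)
      (fun z _ => by simp)
    rw [Finset.sum_image (fun _ _ _ _ h => mul_left_cancel h)] at this
    simpa [hx0] using this
  have h1' : ∑ y ∈ Y, (b y / p) ^ β ≤ (1 + 1 / 10 ^ 8) / p := by
    have e : ∀ y ∈ Y, (b y / p) ^ β = (p * b y) ^ β / p ^ (2 * β) := by
      intro y _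
      rw [Real.div_rpow (hb0 y) hp.le, Real.mul_rpow hp.le (hb0 y), hpp]
      field_simp
    rw [Finset.sum_congr rfl e, ← Finset.sum_div]
    have : 0 < p ^ (2 * β) := Real.rpow_pos_of_pos hp _
    rw [div_le_div_iff₀ this hp]
    nlinarith
  have hT := fr_mass Y b p β (1 / 20000) (1 / 10 ^ 8) hp (fun y _ => hb0 y) (fun y _ => hbp y)
    hβ0 hβ1 (by norm_num) (by norm_num) hbs h1'
  set T := Y.filter (fun y => (1 - 1 / 20000) * p ≤ b y) with hTdef
  have hTn : T.Nonempty := by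
    by_contra hc
    rw [Finset.not_nonempty_iff_eq_empty] at hc
    rw [hc] at hT; norm_num at hT
  obtain ⟨y0, hy0⟩ := hTn
  have hq : (1 - 1 / 20000) * p ≤ b y0 := (Finset.mem_filter.mp hy0).2
  have h2 : ∑ x ∈ X, (a x * b y0) ^ β ≤ 1 := by
    have := hdis (X.image (fun y => y * y0)) (fun z => z * y0⁻¹) (fun _ => y0)
      (fun z _ => by simp)
    rw [Finset.sum_image (fun _ _ _ _ h => mul_right_cancel h)] at this
    simpa using this
  have hlow : ∀ c : ℝ, 0 < c → c ≤ 1 → c ≤ c ^ β := fun c h0 h1 => fr_rpow_ge h0.le h1 hβ0 hβ1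
  have h2' : ∑ x ∈ X, (a x / p) ^ β ≤ (1 + 1 / 13000) / p := by
    have e : ∀ x ∈ X, (a x / p) ^ β ≤
        (a x * b y0) ^ β / (p ^ (2 * β) * (1 - 1 / 20000)) := by
      intro x _
      rw [le_div_iff₀ (by positivity), Real.div_rpow (ha0 x) hp.le, hpp,
        Real.mul_rpow (ha0 x) (hb0 _)]
      have : p ^ β * (1 - 1 / 20000) ≤ b y0 ^ β := by
        calc p ^ β * (1 - 1 / 20000) ≤ p ^ β * (1 - 1 / 20000) ^ β := by
              gcongr; exact hlow _ (by norm_num) (by norm_num)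
          _ = ((1 - 1 / 20000) * p) ^ β := by
              rw [Real.mul_rpow (by norm_num) hp.le, mul_comm]
          _ ≤ _ := Real.rpow_le_rpow (by positivity) hq hβ0.le
      calc a x ^ β / p ^ β * (p ^ β * p ^ β * (1 - 1 / 20000))
          = a x ^ β * (p ^ β * (1 - 1 / 20000)) := by field_simp
        _ ≤ _ := by
          have := Real.rpow_nonneg (ha0 x) β
          gcongr
    refine (Finset.sum_le_sum e).trans ?_
    rw [← Finset.sum_div]
    have : 0 < p ^ (2 * β) := Real.rpow_pos_of_pos hp _
    rw [div_le_div_iff₀ (by positivity) hp]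
    nlinarith
  have hS := fr_mass X a p β (1 / 20) (1 / 13000) hp (fun y _ => ha0 y) (fun y _ => hap y)
    hβ0 hβ1 (by norm_num) (by norm_num) has h2'
  set S := X.filter (fun y => (1 - 1 / 20) * p ≤ a y) with hSdef
  have hST : ((S * T).card : ℝ) ≤ (53 / 50) / p := by
    have ex : ∀ z : Q, ∃ xy : Q × Q, z ∈ S * T → xy.1 ∈ S ∧ xy.2 ∈ T ∧ xy.1 * xy.2 = z := by
      intro z
      by_cases hz : z ∈ S * T
      · obtain ⟨x, hx, y, hy, h⟩ := Finset.mem_mul.mp hz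
        exact ⟨(x, y), fun _ => ⟨hx, hy, h⟩⟩
      · exact ⟨(1, 1), fun h => absurd h hz⟩
    choose f hf using ex
    have := hdis (S * T) (fun z => (f z).1) (fun z => (f z).2) (fun z hz => (hf z hz).2.2)
    have low : ∀ z ∈ S * T, p ^ (2 * β) * ((1 - 1 / 20) * (1 - 1 / 20000)) ≤
        (a (f z).1 * b (f z).2) ^ β := by
      intro z hz
      obtain ⟨g1, g2, -⟩ := hf z hz
      have g1 := (Finset.mem_filter.mp g1).2
      have g2 := (Finset.mem_filter.mp g2).2
      calc p ^ (2 * β) * ((1 - 1 / 20) * (1 - 1 / 20000))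
          ≤ p ^ (2 * β) * ((1 - 1 / 20) * (1 - 1 / 20000)) ^ β := by
            gcongr; exact hlow _ (by norm_num) (by norm_num)
        _ = (((1 - 1 / 20) * p) * ((1 - 1 / 20000) * p)) ^ β := by
            rw [hpp, Real.mul_rpow (by norm_num) (by norm_num), Real.mul_rpow (by positivity)
              (by positivity), Real.mul_rpow (by positivity)
              (by positivity), Real.mul_rpow (by positivity)
              (by positivity)]
            ring
        _ ≤ _ := by
            refine Real.rpow_le_rpow (by positivity) ?_ hβ0.le
            exact mul_le_mul g1 g2 (by positivity) (ha0 _)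
    have h3 := (Finset.card_nsmul_le_sum _ _ _ low).trans this
    rw [nsmul_eq_mul] at h3
    rw [le_div_iff₀ hp]
    have hc : (0 : ℝ) ≤ (S * T).card := Nat.cast_nonneg _
    generalize ((S * T).card : ℝ) = w at *
    have : w * p ≤ w * (p ^ (2 * β) * (1 + 1 / 10 ^ 8)) := by gcongr
    nlinarith
  have cS : (1 - 1 / 128) / p ≤ (S.card : ℝ) := by
    rw [div_le_iff₀ hp]
    have : ∑ x ∈ S, a x ≤ S.card • p := Finset.sum_le_card_nsmul _ _ _ (fun x _ => hap x)
    rw [nsmul_eq_mul] at this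
    norm_num at hS ⊢
    linarith
  have cT : (1 - 1 / 128) / p ≤ (T.card : ℝ) := by
    rw [div_le_iff₀ hp]
    have : ∑ x ∈ T, b x ≤ T.card • p := Finset.sum_le_card_nsmul _ _ _ (fun x _ => hbp x)
    rw [nsmul_eq_mul] at this
    norm_num at hT ⊢
    linarith
  have e : (53 / 50) / p ≤ 11 / 10 * ((1 - 1 / 128) / p) := by
    rw [← mul_div_assoc]
    gcongr; norm_num
  refine ⟨S, T, Finset.filter_subset _ _, Finset.filter_subset _ _, ?_, ?_, ?_, ?_⟩
  · norm_num at hS ⊢; linarith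
  · norm_num at hT ⊢; linarith
  · linarith
  · linarith

theorem fr_sub {Q : Type*} [CommGroup Q] [DecidableEq Q] (S T : Finset Q) (hSn : S.Nonempty)
    (hTn : T.Nonempty)
    (hsq : ∀ t ∈ T, ∀ t' ∈ T, t ^ 2 = t' ^ 2)
    (h1 : ((S * T).card : ℝ) ≤ 11 / 10 * S.card) (h2 : ((S * T).card : ℝ) ≤ 11 / 10 * T.card) :
    ∃ H : Subgroup Q, Finite H ∧ Nat.card H ≤ 2 * T.card ∧
      (∀ s ∈ S, ∀ s' ∈ S, s / s' ∈ H) ∧ (∀ s ∈ T, ∀ s' ∈ T, s / s' ∈ H) := by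
  obtain ⟨t0, ht0⟩ := hTn
  have hSp : (0 : ℝ) < S.card := by exact_mod_cast hSn.card_pos
  have hTp : (0 : ℝ) < T.card := by exact_mod_cast Finset.card_pos.mpr ⟨t0, ht0⟩
  have tri : ((T / T).card : ℝ) * S.card ≤ (S * T).card * (S * T).card := by
    have := Finset.ruzsa_triangle_inequality_div_mul_mul T S T
    rw [mul_comm T S] at this
    exact_mod_cast this
  have hdiv : ((T / T).card : ℝ) < 3 / 2 * T.card := by
    have : ((T / T).card : ℝ) * S.card ≤ (11 / 10 * T.card) * (11 / 10 * S.card) :=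
      tri.trans (mul_le_mul h2 h1 (Nat.cast_nonneg _) (by positivity))
    have : ((T / T).card : ℝ) ≤ 121 / 100 * T.card := by
      refine le_of_mul_le_mul_right ?_ hSp
      linarith
    linarith
  have hTT : (T * T).card ≤ (T / T).card := by
    have : T * T ⊆ (T / T).image (fun x => x * t0 ^ 2) := by
      intro z hz
      obtain ⟨x, hx, y, hy, rfl⟩ := Finset.mem_mul.mp hz
      refine Finset.mem_image.mpr ⟨x / y, Finset.div_mem_div hx hy, ?_⟩
      rw [← hsq y hy t0 ht0, pow_two, ← mul_assoc, div_mul_cancel]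
    exact (Finset.card_le_card this).trans Finset.card_image_le
  have hlt : ((T * T).card : ℚ) < (3 / 2 : ℚ) * T.card := by
    have : ((T * T).card : ℝ) < 3 / 2 * T.card := lt_of_le_of_lt (by exact_mod_cast hTT) hdiv
    have h3 : (((T * T).card : ℚ) : ℝ) < (((3 / 2 : ℚ) * T.card : ℚ) : ℝ) := by push_cast; exact this
    exact_mod_cast h3
  have hco := Finset.invMulSubgroup_eq_mul_inv T hlt
  generalize Finset.invMulSubgroup T hlt = H at hco
  have hco' : (H : Set Q) = ((T / T : Finset Q) : Set Q) := by
    rw [hco, div_eq_mul_inv, Finset.coe_mul, Finset.coe_inv]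
  have hTH : ∀ s ∈ T, ∀ s' ∈ T, s / s' ∈ H := by
    intro s hs s' hs'
    rw [← SetLike.mem_coe, hco']
    exact Finset.div_mem_div hs hs'
  refine ⟨H, ?_, ?_, ?_, hTH⟩
  · have : (H : Set Q).Finite := by rw [hco']; exact Finset.finite_toSet _
    exact this
  · have : Nat.card H = (T / T).card := by
      have : Nat.card (H : Set Q) = (T / T).card := by
        rw [hco', Nat.card_coe_set_eq, Set.ncard_coe_finset]
      exact this
    rw [this]
    have : ((T / T).card : ℝ) ≤ 2 * T.card := by linarith
    exact_mod_cast this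
  · intro s hs s' hs'
    by_contra hc
    have hd : Disjoint (T.image (fun t => s * t)) (T.image (fun t => s' * t)) := by
      rw [Finset.disjoint_left]
      intro z hz hz'
      obtain ⟨t, ht, rfl⟩ := Finset.mem_image.mp hz
      obtain ⟨t', ht', h⟩ := Finset.mem_image.mp hz'
      apply hc
      have : s / s' = t' / t := by
        rw [div_eq_div_iff_mul_eq_mul, mul_comm t' s', h]
      rw [this]; exact hTH _ ht' _ ht
    have hsub : T.image (fun t => s * t) ∪ T.image (fun t => s' * t) ⊆ S * T := by
      apply Finset.union_subset
      · intro z hz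
        obtain ⟨t, ht, rfl⟩ := Finset.mem_image.mp hz
        exact Finset.mul_mem_mul hs ht
      · intro z hz
        obtain ⟨t, ht, rfl⟩ := Finset.mem_image.mp hz
        exact Finset.mul_mem_mul hs' ht
    have := Finset.card_le_card hsub
    rw [Finset.card_union_of_disjoint hd,
      Finset.card_image_of_injective _ (mul_right_injective s),
      Finset.card_image_of_injective _ (mul_right_injective s')] at this
    have : (T.card + T.card : ℝ) ≤ (S * T).card := by exact_mod_cast this
    linarith

theorem fr_zero {β y z : ℝ} (hβ : 0 < β) (hβ1 : β ≤ 3 / 4) (hz0 : 0 ≤ z) (hzy : z ≤ y)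
    (hy : y ≤ 1 / 128)
    (h : ((1 - z) * (1 - y)) ^ β + ((1 - z) * y) ^ β ≤ 1) : y = 0 := by
  by_contra hne
  have hy0 : 0 < y := lt_of_le_of_ne (hz0.trans hzy) (Ne.symm hne)
  have e1 : (1 - z) * (1 - y) ≤ ((1 - z) * (1 - y)) ^ β :=
    fr_rpow_ge (by apply mul_nonneg <;> linarith) (by nlinarith) hβ hβ1
  have hu0 : 0 < (1 - z) * y := mul_pos (by linarith) hy0
  have hu1 : (1 - z) * y ≤ 1 / 128 := by nlinarith
  obtain ⟨u, hu⟩ : ∃ u, u = (1 - z) * y := ⟨_, rfl⟩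
  rw [← hu] at hu0 hu1 h
  have e2 : 3 * u ≤ u ^ β := by
    refine le_trans ?_ (Real.rpow_le_rpow_of_exponent_ge hu0 (by linarith) hβ1)
    refine le_of_pow_le_pow_left₀ (n := 4) (by norm_num) (Real.rpow_nonneg hu0.le _) ?_
    have e3 : (u ^ (3 / 4 : ℝ)) ^ 4 = u ^ 3 := by
      rw [← Real.rpow_natCast, ← Real.rpow_mul hu0.le]; norm_num
    rw [e3]
    have : 81 * u ≤ 1 := by linarith
    calc (3 * u) ^ 4 = (81 * u) * u ^ 3 := by ring
      _ ≤ 1 * u ^ 3 := by gcongr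
      _ = u ^ 3 := one_mul _
  nlinarith

def FStar {G : Type*} [CommGroup G] [DecidableEq G] (A B : Finset G) (β : ℝ) : Prop :=
  ∀ A1 ⊆ A, ∀ B1 ⊆ B, ((A * B).card : ℝ) * ((A1.card / A.card : ℝ) * (B1.card / B.card : ℝ)) ^ β ≤
    (A1 * B1).card

theorem FStar.symm {G : Type*} [CommGroup G] [DecidableEq G] {A B : Finset G} {β : ℝ}
    (h : FStar A B β) : FStar B A β := by
  intro A1 hA B1 hB
  have := h B1 hB A1 hA
  rwa [mul_comm B A, mul_comm A1 B1, mul_comm (_ / _ : ℝ)]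

theorem fstar_dis {G Q : Type*} [CommGroup G] [CommGroup Q] [DecidableEq G] [DecidableEq Q]
    (A B : Finset G) (hA : A.Nonempty) (hB : B.Nonempty) (β : ℝ) (h : FStar A B β) (f : G →* Q)
    (Z : Finset Q) (x y : Q → Q) (hxy : ∀ z ∈ Z, x z * y z = z) :
    ∑ z ∈ Z, (((A.filter (fun g => f g = x z)).card / A.card : ℝ) *
      ((B.filter (fun g => f g = y z)).card / B.card : ℝ)) ^ β ≤ 1 := by
  have hpos : (0 : ℝ) < (A * B).card := by exact_mod_cast (hA.mul hB).card_pos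
  refine le_of_mul_le_mul_left ?_ hpos
  rw [Finset.mul_sum, mul_one]
  refine (Finset.sum_le_sum (fun z _ => h _ (Finset.filter_subset _ _) _
    (Finset.filter_subset _ _))).trans ?_
  rw [← Nat.cast_sum, Nat.cast_le, ← Finset.card_biUnion]
  · apply Finset.card_le_card
    intro g hg
    obtain ⟨z, hz, hg⟩ := Finset.mem_biUnion.mp hg
    exact Finset.mul_subset_mul (Finset.filter_subset _ _) (Finset.filter_subset _ _) hg
  · intro z hz z' hz' hne
    rw [Function.onFun, Finset.disjoint_left]
    intro g hg hg'
    obtain ⟨a, ha, b, hb, rfl⟩ := Finset.mem_mul.mp hg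
    obtain ⟨a', ha', b', hb', he⟩ := Finset.mem_mul.mp hg'
    apply hne
    rw [← hxy z hz, ← hxy z' hz', ← (Finset.mem_filter.mp ha).2, ← (Finset.mem_filter.mp hb).2,
      ← (Finset.mem_filter.mp ha').2, ← (Finset.mem_filter.mp hb').2, ← map_mul, ← map_mul, he]

theorem fiber_sum {G Q : Type*} [DecidableEq Q] (A : Finset G) (f : G → Q) (S : Finset Q) :
    ∑ x ∈ S, ((A.filter (fun g => f g = x)).card : ℝ) = (A.filter (fun g => f g ∈ S)).card := by
  rw [Finset.card_eq_sum_card_fiberwise (f := f) (s := A.filter (fun g => f g ∈ S)) (t := S)]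
  · push_cast
    refine Finset.sum_congr rfl (fun x hx => ?_)
    congr 2
    ext g; simp only [Finset.mem_filter]
    constructor
    · rintro ⟨h1, h2⟩; exact ⟨⟨h1, h2 ▸ hx⟩, h2⟩
    · rintro ⟨⟨h1, _⟩, h2⟩; exact ⟨h1, h2⟩
  · intro g hg; exact (Finset.mem_filter.mp hg).2

theorem fr_full {G : Type*} [CommGroup G] [DecidableEq G]
    (A B A1 B1 : Finset G) (hA : A.Nonempty) (hB : B.Nonempty) (β : ℝ) (hβ : 0 < β)
    (hβ1 : β ≤ 3 / 4) (h : FStar A B β) (hA1 : A1 ⊆ A) (hB1 : B1 ⊆ B)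
    (mA : 1 - 1 / 128 ≤ (A1.card / A.card : ℝ)) (mB : 1 - 1 / 128 ≤ (B1.card / B.card : ℝ))
    (d1 : Disjoint (A1 * B1) (A1 * (B \ B1))) (d2 : Disjoint (A1 * B1) ((A \ A1) * B1)) :
    A1 = A ∧ B1 = B := by
  have hpos : (0 : ℝ) < (A * B).card := by exact_mod_cast (hA.mul hB).card_pos
  have hAp : (0 : ℝ) < A.card := by exact_mod_cast hA.card_pos
  have hBp : (0 : ℝ) < B.card := by exact_mod_cast hB.card_pos
  have eA : ((A \ A1).card / A.card : ℝ) = 1 - (A1.card / A.card : ℝ) := by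
    rw [Finset.cast_card_sdiff hA1]; field_simp
  have eB : ((B \ B1).card / B.card : ℝ) = 1 - (B1.card / B.card : ℝ) := by
    rw [Finset.cast_card_sdiff hB1]; field_simp
  have q1 : (((A1.card / A.card : ℝ) * (B1.card / B.card : ℝ)) ^ β +
      ((A1.card / A.card : ℝ) * (1 - B1.card / B.card : ℝ)) ^ β) ≤ 1 := by
    have h1 := h A1 hA1 B1 hB1
    have h2 := h A1 hA1 (B \ B1) Finset.sdiff_subset
    rw [eB] at h2
    have h3 : ((A1 * B1).card : ℝ) + (A1 * (B \ B1)).card ≤ (A * B).card := by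
      rw [← Nat.cast_add, Nat.cast_le, ← Finset.card_union_of_disjoint d1]
      exact Finset.card_le_card (Finset.union_subset (Finset.mul_subset_mul hA1 hB1)
        (Finset.mul_subset_mul hA1 Finset.sdiff_subset))
    refine le_of_mul_le_mul_left ?_ hpos
    rw [mul_add]; linarith
  have q2 : (((A1.card / A.card : ℝ) * (B1.card / B.card : ℝ)) ^ β +
      ((1 - A1.card / A.card : ℝ) * (B1.card / B.card : ℝ)) ^ β) ≤ 1 := by
    have h1 := h A1 hA1 B1 hB1
    have h2 := h (A \ A1) Finset.sdiff_subset B1 hB1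
    rw [eA] at h2
    have h3 : ((A1 * B1).card : ℝ) + ((A \ A1) * B1).card ≤ (A * B).card := by
      rw [← Nat.cast_add, Nat.cast_le, ← Finset.card_union_of_disjoint d2]
      exact Finset.card_le_card (Finset.union_subset (Finset.mul_subset_mul hA1 hB1)
        (Finset.mul_subset_mul Finset.sdiff_subset hB1))
    refine le_of_mul_le_mul_left ?_ hpos
    rw [mul_add]; linarith
  have lA : (A1.card / A.card : ℝ) ≤ 1 := by
    rw [div_le_one hAp]; exact_mod_cast Finset.card_le_card hA1
  have lB : (B1.card / B.card : ℝ) ≤ 1 := by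
    rw [div_le_one hBp]; exact_mod_cast Finset.card_le_card hB1
  obtain ⟨z, hz⟩ : ∃ z : ℝ, z = 1 - A1.card / A.card := ⟨_, rfl⟩
  obtain ⟨y, hy⟩ : ∃ y : ℝ, y = 1 - B1.card / B.card := ⟨_, rfl⟩
  have ez : (A1.card / A.card : ℝ) = 1 - z := by linarith
  have ey : (B1.card / B.card : ℝ) = 1 - y := by linarith
  have both : y = 0 ∧ z = 0 := by
    rw [ez, ey] at q1 q2
    simp only [sub_sub_cancel] at q1 q2
    rcases le_total z y with hc | hc
    · have := fr_zero hβ hβ1 (by linarith) hc (by linarith) q1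
      exact ⟨this, by linarith⟩
    · rw [mul_comm (1 - z) (1 - y), mul_comm z] at q2
      have := fr_zero hβ hβ1 (by linarith) hc (by linarith) q2
      exact ⟨by linarith, this⟩
  constructor
  · refine Finset.eq_of_subset_of_card_le hA1 ?_
    rw [both.2, sub_zero, div_eq_one_iff_eq hAp.ne'] at ez
    have : A1.card = A.card := by exact_mod_cast ez
    omega
  · refine Finset.eq_of_subset_of_card_le hB1 ?_
    rw [both.1, sub_zero, div_eq_one_iff_eq hBp.ne'] at ey
    have : B1.card = B.card := by exact_mod_cast ey
    omega

theorem fr_struct1 {G Q : Type*} [CommGroup G] [CommGroup Q] [DecidableEq G] [DecidableEq Q]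
    (A B : Finset G) (hA : A.Nonempty) (hB : B.Nonempty) (β M : ℝ) (hβ : 1 / 2 ≤ β)
    (hβ1 : β ≤ 3 / 4) (h : FStar A B β) (f : G →* Q) (hM1 : 1 ≤ M)
    (hM : ∀ p : ℝ, 1 / M ≤ p → p ≤ 1 → p ≤ p ^ (2 * β) * (1 + 1 / 10 ^ 8))
    (hBM : ((B.image f).card : ℝ) ≤ M)
    (hsq : ∀ t ∈ B, ∀ t' ∈ B, f t ^ 2 = f t' ^ 2) (x0 : Q)
    (hx0 : ∀ x, ((A.filter (fun g => f g = x)).card / A.card : ℝ) ≤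
      (A.filter (fun g => f g = x0)).card / A.card)
    (hy0 : ∀ x, ((B.filter (fun g => f g = x)).card / B.card : ℝ) ≤
      (A.filter (fun g => f g = x0)).card / A.card) :
    ∃ H : Subgroup Q, Finite H ∧ (Nat.card H : ℝ) ≤ 2 * M ∧
      (∀ s ∈ A, ∀ s' ∈ A, f s / f s' ∈ H) ∧ (∀ s ∈ B, ∀ s' ∈ B, f s / f s' ∈ H) := by
  have hAp : (0 : ℝ) < A.card := by exact_mod_cast hA.card_pos
  have hBp : (0 : ℝ) < B.card := by exact_mod_cast hB.card_pos
  have sA : ∀ S : Finset Q, ∑ x ∈ S, ((A.filter (fun g => f g = x)).card / A.card : ℝ) =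
      (A.filter (fun g => f g ∈ S)).card / A.card := by
    intro S; rw [← Finset.sum_div, fiber_sum A f S]
  have sB : ∀ S : Finset Q, ∑ x ∈ S, ((B.filter (fun g => f g = x)).card / B.card : ℝ) =
      (B.filter (fun g => f g ∈ S)).card / B.card := by
    intro S; rw [← Finset.sum_div, fiber_sum B f S]
  have tA : ∑ x ∈ A.image f, ((A.filter (fun g => f g = x)).card / A.card : ℝ) = 1 := by
    rw [sA, Finset.filter_true_of_mem (fun g hg => Finset.mem_image_of_mem f hg)]
    exact div_self hAp.ne'
  have tB : ∑ x ∈ B.image f, ((B.filter (fun g => f g = x)).card / B.card : ℝ) = 1 := by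
    rw [sB, Finset.filter_true_of_mem (fun g hg => Finset.mem_image_of_mem f hg)]
    exact div_self hBp.ne'
  obtain ⟨p, hp⟩ : ∃ p : ℝ, p = (A.filter (fun g => f g = x0)).card / A.card := ⟨_, rfl⟩
  have hpM : 1 / M ≤ p := by
    rw [div_le_iff₀ (by linarith), ← tB]
    refine (Finset.sum_le_card_nsmul _ _ _ (fun x _ => hy0 x)).trans ?_
    rw [nsmul_eq_mul, ← hp, mul_comm]
    have : 0 ≤ p := by rw [hp]; exact div_nonneg (Nat.cast_nonneg _) (Nat.cast_nonneg _)
    gcongr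
  have hp0 : 0 < p := lt_of_lt_of_le (by positivity) hpM
  have hp1 : p ≤ 1 := by
    rw [hp, div_le_one hAp]; exact_mod_cast Finset.card_le_card (Finset.filter_subset _ _)
  obtain ⟨S, T, hS, hT, mS, mT, c1, c2⟩ := fr_core (A.image f) (B.image f)
    (fun x => ((A.filter (fun g => f g = x)).card / A.card : ℝ))
    (fun x => ((B.filter (fun g => f g = x)).card / B.card : ℝ)) β p
    (fun x => div_nonneg (Nat.cast_nonneg _) (Nat.cast_nonneg _))
    (fun x => div_nonneg (Nat.cast_nonneg _) (Nat.cast_nonneg _)) tA tB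
    (fun x => hp ▸ hx0 x) (fun x => hp ▸ hy0 x) x0 hp.symm hp0 hβ hβ1 (hM p hpM hp1)
    (fun Z x y hxy => fstar_dis A B hA hB β h f Z x y hxy)
  have hSn : S.Nonempty := by
    by_contra hc
    rw [Finset.not_nonempty_iff_eq_empty] at hc
    rw [hc] at mS; norm_num at mS
  have hTn : T.Nonempty := by
    by_contra hc
    rw [Finset.not_nonempty_iff_eq_empty] at hc
    rw [hc] at mT; norm_num at mT
  obtain ⟨H, hf, hc, hSH, hTH⟩ := fr_sub S T hSn hTn (by
    intro t ht t' ht'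
    obtain ⟨b, hb, rfl⟩ := Finset.mem_image.mp (hT ht)
    obtain ⟨b', hb', rfl⟩ := Finset.mem_image.mp (hT ht')
    exact hsq b hb b' hb') c1 c2
  obtain ⟨x1, hx1⟩ := hSn
  obtain ⟨y1, hy1⟩ := hTn
  rw [sA] at mS
  rw [sB] at mT
  have key := fr_full A B (A.filter (fun g => f g / x1 ∈ H)) (B.filter (fun g => f g / y1 ∈ H))
    hA hB β (by linarith) hβ1 h (Finset.filter_subset _ _) (Finset.filter_subset _ _)
    (mS.trans (by
      gcongr with g hg
      intro hgS; exact hSH _ hgS _ hx1))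
    (mT.trans (by
      gcongr with g hg
      intro hgS; exact hTH _ hgS _ hy1))
    (by
      rw [Finset.disjoint_left]
      intro g hg hg'
      obtain ⟨a, ha, b, hb, rfl⟩ := Finset.mem_mul.mp hg
      obtain ⟨a', ha', b', hb', he⟩ := Finset.mem_mul.mp hg'
      have h1 := (Finset.mem_filter.mp ha).2
      have h2 := (Finset.mem_filter.mp hb).2
      have h3 := (Finset.mem_filter.mp ha').2
      obtain ⟨h4, h5⟩ := Finset.mem_sdiff.mp hb'
      apply h5
      refine Finset.mem_filter.mpr ⟨h4, ?_⟩
      have : f b' / y1 = (f a / x1) * (f b / y1) / (f a' / x1) := by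
        have e : f a' * f b' = f a * f b := by rw [← map_mul, ← map_mul, he]
        rw [div_mul_div_comm, ← e, mul_comm (f a'), mul_comm x1, ← div_mul_div_comm,
          mul_div_cancel_right]
      rw [this]; exact H.div_mem (H.mul_mem h1 h2) h3)
    (by
      rw [Finset.disjoint_left]
      intro g hg hg'
      obtain ⟨a, ha, b, hb, rfl⟩ := Finset.mem_mul.mp hg
      obtain ⟨a', ha', b', hb', he⟩ := Finset.mem_mul.mp hg'
      have h1 := (Finset.mem_filter.mp ha).2
      have h2 := (Finset.mem_filter.mp hb).2
      have h3 := (Finset.mem_filter.mp hb').2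
      obtain ⟨h4, h5⟩ := Finset.mem_sdiff.mp ha'
      apply h5
      refine Finset.mem_filter.mpr ⟨h4, ?_⟩
      have : f a' / x1 = (f a / x1) * (f b / y1) / (f b' / y1) := by
        have e : f a' * f b' = f a * f b := by rw [← map_mul, ← map_mul, he]
        rw [div_mul_div_comm, ← e, ← div_mul_div_comm,
          mul_div_cancel_right]
      rw [this]; exact H.div_mem (H.mul_mem h1 h2) h3)
  have kA : ∀ s ∈ A, f s / x1 ∈ H := fun s hs => by
    rw [← key.1] at hs; exact (Finset.mem_filter.mp hs).2
  have kB : ∀ s ∈ B, f s / y1 ∈ H := fun s hs => by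
    rw [← key.2] at hs; exact (Finset.mem_filter.mp hs).2
  refine ⟨H, hf, ?_, ?_, ?_⟩
  · have h1 : (Nat.card H : ℝ) ≤ 2 * T.card := by exact_mod_cast hc
    have h2 : (T.card : ℝ) ≤ (B.image f).card := by exact_mod_cast Finset.card_le_card hT
    linarith
  · intro s hs s' hs'
    have := H.div_mem (kA s hs) (kA s' hs')
    rwa [div_div_div_cancel_right] at this
  · intro s hs s' hs'
    have := H.div_mem (kB s hs) (kB s' hs')
    rwa [div_div_div_cancel_right] at this

theorem fr_struct {G Q : Type*} [CommGroup G] [CommGroup Q] [DecidableEq G] [DecidableEq Q]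
    (A B : Finset G) (hA : A.Nonempty) (hB : B.Nonempty) (β M : ℝ) (hβ : 1 / 2 ≤ β)
    (hβ1 : β ≤ 3 / 4) (h : FStar A B β) (f : G →* Q) (hM1 : 1 ≤ M)
    (hM : ∀ p : ℝ, 1 / M ≤ p → p ≤ 1 → p ≤ p ^ (2 * β) * (1 + 1 / 10 ^ 8))
    (hAM : ((A.image f).card : ℝ) ≤ M) (hBM : ((B.image f).card : ℝ) ≤ M)
    (hsqA : ∀ t ∈ A, ∀ t' ∈ A, f t ^ 2 = f t' ^ 2)
    (hsq : ∀ t ∈ B, ∀ t' ∈ B, f t ^ 2 = f t' ^ 2) :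
    ∃ H : Subgroup Q, Finite H ∧ (Nat.card H : ℝ) ≤ 2 * M ∧
      (∀ s ∈ A, ∀ s' ∈ A, f s / f s' ∈ H) ∧ (∀ s ∈ B, ∀ s' ∈ B, f s / f s' ∈ H) := by
  have mx : ∀ A : Finset G, A.Nonempty → ∃ x0, ∀ x,
      ((A.filter (fun g => f g = x)).card / A.card : ℝ) ≤
      (A.filter (fun g => f g = x0)).card / A.card := by
    intro A hA
    obtain ⟨x0, -, h0⟩ := Finset.exists_max_image (A.image f)
      (fun x => ((A.filter (fun g => f g = x)).card / A.card : ℝ)) (hA.image f)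
    refine ⟨x0, fun x => ?_⟩
    by_cases hx : x ∈ A.image f
    · exact h0 x hx
    · have : A.filter (fun g => f g = x) = ∅ := by
        rw [Finset.filter_eq_empty_iff]
        intro g hg he; exact hx (he ▸ Finset.mem_image_of_mem f hg)
      rw [this]; simp; positivity
  obtain ⟨x0, hx0⟩ := mx A hA
  obtain ⟨y0, hy0⟩ := mx B hB
  rcases le_total ((B.filter (fun g => f g = y0)).card / B.card : ℝ)
    ((A.filter (fun g => f g = x0)).card / A.card) with hc | hc
  · exact fr_struct1 A B hA hB β M hβ hβ1 h f hM1 hM hBM hsq x0 hx0 (fun x => (hy0 x).trans hc)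
  · obtain ⟨H, h1, h2, h3, h4⟩ := fr_struct1 B A hB hA β M hβ hβ1 h.symm f hM1 hM hAM hsqA y0 hy0
      (fun x => (hx0 x).trans hc)
    exact ⟨H, h1, h2, h4, h3⟩

theorem gens_log (H : Type*) [Group H] [Finite H] :
    ∃ s : Finset H, Subgroup.closure (s : Set H) = ⊤ ∧ 2 ^ s.card ≤ Nat.card H := by
  classical
  haveI := Fintype.ofFinite H
  obtain ⟨s, hs, hmax⟩ := Finset.exists_max_image
    ((Finset.univ : Finset (Finset H)).filter
      (fun s : Finset H => 2 ^ s.card ≤ Nat.card (Subgroup.closure (s : Set H)))) (fun s => s.card)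
    ⟨∅, by simp⟩
  have hs := (Finset.mem_filter.mp hs).2
  have htop : Subgroup.closure (s : Set H) = ⊤ := by
    by_contra hne
    obtain ⟨g, hg⟩ : ∃ g, g ∉ Subgroup.closure (s : Set H) := by
      by_contra hc; push Not at hc; exact hne (by ext; simp [hc])
    have hgs : g ∉ s := fun h => hg (Subgroup.subset_closure h)
    have hle : Subgroup.closure (s : Set H) ≤ Subgroup.closure ((insert g s : Finset H) : Set H) :=
      Subgroup.closure_mono (by simp)
    have hdvd := Subgroup.card_dvd_of_le hle
    have hlt : Nat.card (Subgroup.closure (s : Set H)) ≠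
        Nat.card (Subgroup.closure ((insert g s : Finset H) : Set H)) := by
      intro he
      have := Subgroup.eq_of_le_of_card_ge hle he.ge
      apply hg; rw [this]; exact Subgroup.subset_closure (by simp)
    have h2 : 2 * Nat.card (Subgroup.closure (s : Set H)) ≤
        Nat.card (Subgroup.closure ((insert g s : Finset H) : Set H)) := by
      obtain ⟨k, hk⟩ := hdvd
      have hpos : 0 < Nat.card (Subgroup.closure ((insert g s : Finset H) : Set H)) :=
        Nat.card_pos
      rcases k with _ | _ | k
      · omega
      · exact absurd (by simpa using hk.symm) hlt
      · rw [hk, mul_comm]; gcongr; omega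
    have := hmax (insert g s) (Finset.mem_filter.mpr ⟨Finset.mem_univ _, by
      rw [Finset.card_insert_of_notMem hgs, pow_succ]; omega⟩)
    rw [Finset.card_insert_of_notMem hgs] at this
    omega
  refine ⟨s, htop, ?_⟩
  rw [htop] at hs
  simpa using hs

theorem nak_pow {G : Type*} [CommGroup G] (X : Finset G) (Γ : Subgroup G)
    (h : ∀ x ∈ Subgroup.closure (X : Set G), ∃ y ∈ Subgroup.closure (X : Set G), x / y ^ 2 ∈ Γ) :
    ∃ N : ℕ, 0 < N ∧ ∀ x ∈ Subgroup.closure (X : Set G), x ^ N ∈ Γ := by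
  classical
  let g : G → Additive (G ⧸ Γ) := fun x => Additive.ofMul (QuotientGroup.mk' Γ x)
  have g1 : g 1 = 0 := by simp [g]
  have gm : ∀ x y, g (x * y) = g x + g y := fun x y => by simp [g]
  have gi : ∀ x, g x⁻¹ = - g x := fun x => by simp [g]
  have gp : ∀ x (k : ℕ), g (x ^ k) = k • g x := fun x k => by simp [g]
  have g0 : ∀ x, g x = 0 ↔ x ∈ Γ := fun x => by
    rw [← QuotientGroup.eq_one_iff]; rfl
  obtain ⟨N, hN⟩ : ∃ N : Submodule ℤ (Additive (G ⧸ Γ)), N = Submodule.span ℤ (g '' X) := ⟨_, rfl⟩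
  have hmem : ∀ x ∈ Subgroup.closure (X : Set G), g x ∈ N := by
    intro x hx
    induction hx using Subgroup.closure_induction with
    | mem x hx => rw [hN]; exact Submodule.subset_span ⟨x, hx, rfl⟩
    | one => rw [g1]; exact N.zero_mem
    | mul x y _ _ h1 h2 => rw [gm]; exact N.add_mem h1 h2
    | inv x _ h1 => rw [gi]; exact N.neg_mem h1
  have hfg : N.FG := by
    rw [hN]; exact Submodule.fg_span (X.finite_toSet.image g)
  have hle : N ≤ (Ideal.span {(2 : ℤ)}) • N := by
    conv_lhs => rw [hN]
    rw [Submodule.span_le]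
    rintro _ ⟨x, hx, rfl⟩
    obtain ⟨y, hy, hxy⟩ := h x (Subgroup.subset_closure hx)
    have e : g x = (2 : ℤ) • g y := by
      have := (g0 _).mpr hxy
      rw [div_eq_mul_inv, gm, gi, gp, add_neg_eq_zero] at this
      rw [this]; simp [two_smul]
    rw [e]
    exact Submodule.smul_mem_smul (Ideal.mem_span_singleton_self _) (hmem y hy)
  obtain ⟨r, hr, hr0⟩ := Submodule.exists_sub_one_mem_and_smul_eq_zero_of_fg_of_le_smul _ N hfg hle
  have hrne : r ≠ 0 := by
    rintro rfl
    rw [Ideal.mem_span_singleton] at hr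
    omega
  refine ⟨r.natAbs, by omega, fun x hx => ?_⟩
  rw [← g0, gp]
  have h0 := hr0 _ (hmem x hx)
  rcases Int.natAbs_eq r with he | he
  · rw [← natCast_zsmul, ← he]; exact h0
  · rw [← natCast_zsmul, show ((r.natAbs : ℕ) : ℤ) = -r by omega, neg_smul, h0, neg_zero]

theorem fr_classes {G Q : Type*} [CommGroup G] [CommGroup Q] [DecidableEq G] [DecidableEq Q]
    (h2 : ∀ A : Finset G, A.card ≤ 2 * (A.image (fun x => x ^ 2)).card)
    (A : Finset G) (f : G →* Q) (hsq : ∀ t ∈ A, ∀ t' ∈ A, f t ^ 2 = f t' ^ 2) :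
    (A.image f).card * A.card ≤ 2 * (A ^ 3).card := by
  have ex : ∀ y : Q, ∃ a : G, y ∈ A.image f → a ∈ A ∧ f a = y := by
    intro y
    by_cases hy : y ∈ A.image f
    · obtain ⟨a, ha, h⟩ := Finset.mem_image.mp hy
      exact ⟨a, fun _ => ⟨ha, h⟩⟩
    · exact ⟨1, fun h => absurd h hy⟩
  choose s hs using ex
  have hsub : ((A.image f).biUnion (fun y => (A.image (fun x => x ^ 2)).image (fun z => s y * z)))
      ⊆ A ^ 3 := by
    intro g hg
    obtain ⟨y, hy, hg⟩ := Finset.mem_biUnion.mp hg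
    obtain ⟨z, hz, rfl⟩ := Finset.mem_image.mp hg
    obtain ⟨c, hc, rfl⟩ := Finset.mem_image.mp hz
    have : s y * c ^ 2 = s y * c * c := by rw [pow_two, mul_assoc]
    show s y * c ^ 2 ∈ _
    rw [this, pow_succ, pow_two]
    exact Finset.mul_mem_mul (Finset.mul_mem_mul (hs y hy).1 hc) hc
  have hc := Finset.card_le_card hsub
  rw [Finset.card_biUnion] at hc
  · have : ∀ y ∈ A.image f, ((A.image (fun x => x ^ 2)).image (fun z => s y * z)).card =
        (A.image (fun x => x ^ 2)).card := fun y _ =>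
      Finset.card_image_of_injective _ (mul_right_injective _)
    rw [Finset.sum_congr rfl this, Finset.sum_const, smul_eq_mul] at hc
    calc (A.image f).card * A.card ≤ (A.image f).card * (2 * (A.image (fun x => x ^ 2)).card) :=
          Nat.mul_le_mul_left _ (h2 A)
      _ = 2 * ((A.image f).card * (A.image (fun x => x ^ 2)).card) := by ring
      _ ≤ _ := Nat.mul_le_mul_left _ hc
  · intro y hy y' hy' hne
    rw [Function.onFun, Finset.disjoint_left]
    intro g hg hg'
    obtain ⟨z, hz, rfl⟩ := Finset.mem_image.mp hg
    obtain ⟨c, hc, rfl⟩ := Finset.mem_image.mp hz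
    obtain ⟨z', hz', he⟩ := Finset.mem_image.mp hg'
    obtain ⟨c', hc', rfl⟩ := Finset.mem_image.mp hz'
    apply hne
    have e := congrArg f he
    simp only [map_mul, map_pow] at e
    rw [(hs y hy).2, (hs y' hy').2, hsq c' hc' c hc] at e
    exact (mul_right_cancel e).symm

theorem fr_rank {G : Type*} [CommGroup G] [DecidableEq G]
    (h2 : ∀ A : Finset G, A.card ≤ 2 * (A.image (fun x => x ^ 2)).card)
    (A B : Finset G) (hA : A.Nonempty) (hB : B.Nonempty) (β M : ℝ) (hβ : 1 / 2 ≤ β)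
    (hβ1 : β ≤ 3 / 4) (h : FStar A B β) (hM1 : 1 ≤ M)
    (hM : ∀ p : ℝ, 1 / M ≤ p → p ≤ 1 → p ≤ p ^ (2 * β) * (1 + 1 / 10 ^ 8))
    (hAM : 2 * ((A ^ 3).card : ℝ) ≤ M * A.card) (hBM : 2 * ((B ^ 3).card : ℝ) ≤ M * B.card)
    (r : ℕ) (hr : 2 * M < 2 ^ (r + 1)) : Rk A r := by
  classical
  have hAp : (0 : ℝ) < A.card := by exact_mod_cast hA.card_pos
  have hBp : (0 : ℝ) < B.card := by exact_mod_cast hB.card_pos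
  obtain ⟨X, hX⟩ : ∃ X : Finset G, X = A / A ∪ B / B := ⟨_, rfl⟩
  obtain ⟨Λ, hΛ⟩ : ∃ Λ : Subgroup G, Λ = Subgroup.closure (X : Set G) := ⟨_, rfl⟩
  have hAΛ : ∀ a ∈ A, ∀ a' ∈ A, a / a' ∈ Λ := fun a ha a' ha' => by
    rw [hΛ]; apply Subgroup.subset_closure; rw [hX]
    exact Finset.mem_coe.mpr (Finset.mem_union_left _ (Finset.div_mem_div ha ha'))
  have hBΛ : ∀ a ∈ B, ∀ a' ∈ B, a / a' ∈ Λ := fun a ha a' ha' => by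
    rw [hΛ]; apply Subgroup.subset_closure; rw [hX]
    exact Finset.mem_coe.mpr (Finset.mem_union_right _ (Finset.div_mem_div ha ha'))
  obtain ⟨P, hP⟩ : ∃ P : Subgroup G, P = Λ.map (powMonoidHom 2) := ⟨_, rfl⟩
  obtain ⟨f, hf⟩ : ∃ f : G →* G ⧸ P, f = QuotientGroup.mk' P := ⟨_, rfl⟩
  have hf1 : ∀ x, f x = 1 ↔ ∃ y ∈ Λ, y ^ 2 = x := by
    intro x
    rw [hf, QuotientGroup.mk'_apply, QuotientGroup.eq_one_iff, hP]
    simp [Subgroup.mem_map]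
  have hsqΛ : ∀ t t' : G, t / t' ∈ Λ → f t ^ 2 = f t' ^ 2 := by
    intro t t' ht
    rw [← div_eq_one, ← map_pow, ← map_pow, ← map_div, hf1]
    exact ⟨t / t', ht, div_pow _ _ _⟩
  have hsqA : ∀ t ∈ A, ∀ t' ∈ A, f t ^ 2 = f t' ^ 2 := fun t ht t' ht' => hsqΛ t t' (hAΛ t ht t' ht')
  have hsqB : ∀ t ∈ B, ∀ t' ∈ B, f t ^ 2 = f t' ^ 2 := fun t ht t' ht' => hsqΛ t t' (hBΛ t ht t' ht')
  have cA : ((A.image f).card : ℝ) ≤ M := by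
    have : ((A.image f).card : ℝ) * A.card ≤ 2 * (A ^ 3).card := by
      exact_mod_cast fr_classes h2 A f hsqA
    exact le_of_mul_le_mul_right (this.trans hAM) hAp
  have cB : ((B.image f).card : ℝ) ≤ M := by
    have : ((B.image f).card : ℝ) * B.card ≤ 2 * (B ^ 3).card := by
      exact_mod_cast fr_classes h2 B f hsqB
    exact le_of_mul_le_mul_right (this.trans hBM) hBp
  obtain ⟨H, hHf, hHc, hHA, hHB⟩ := fr_struct A B hA hB β M hβ hβ1 h f hM1 hM cA cB hsqA hsqB
  have hΛH : Λ.map f ≤ H := by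
    rw [Subgroup.map_le_iff_le_comap, hΛ, Subgroup.closure_le]
    intro x hx
    rw [hX] at hx
    rcases Finset.mem_union.mp (Finset.mem_coe.mp hx) with hx | hx
    · obtain ⟨a, ha, b, hb, rfl⟩ := Finset.mem_div.mp hx
      simpa using hHA a ha b hb
    · obtain ⟨a, ha, b, hb, rfl⟩ := Finset.mem_div.mp hx
      simpa using hHB a ha b hb
  haveI : Finite (Λ.map f) := Finite.of_injective _ (Subgroup.inclusion_injective hΛH)
  obtain ⟨s, hs, hsc⟩ := gens_log (Λ.map f)
  have hscr : s.card ≤ r := by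
    have h1 : Nat.card (Λ.map f) ≤ Nat.card H :=
      Nat.card_le_card_of_injective _ (Subgroup.inclusion_injective hΛH)
    have h3 : ((2 ^ s.card : ℕ) : ℝ) ≤ (Nat.card H : ℝ) := by exact_mod_cast hsc.trans h1
    have h4 : (2 : ℝ) ^ s.card < 2 ^ (r + 1) := by
      push_cast at h3; linarith
    have := (pow_lt_pow_iff_right₀ (by norm_num : (1 : ℝ) < 2)).mp h4
    omega
  have lift : ∀ x : Λ.map f, ∃ y ∈ Λ, f y = x := fun x => Subgroup.mem_map.mp x.2
  choose ℓ hℓ1 hℓ2 using lift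
  obtain ⟨hh, hhr⟩ : ∃ hh : Fin r → G, ∀ x ∈ s, ℓ x ∈ Set.range hh := by
    refine ⟨fun i => if hi : i.1 < s.card then ℓ (s.equivFin.symm ⟨i.1, hi⟩) else 1, ?_⟩
    intro x hx
    refine ⟨⟨(s.equivFin ⟨x, hx⟩).1, lt_of_lt_of_le (s.equivFin ⟨x, hx⟩).2 hscr⟩, ?_⟩
    simp
  obtain ⟨Γ, hΓ⟩ : ∃ Γ : Subgroup G, Γ = Subgroup.closure (Set.range hh) := ⟨_, rfl⟩
  have hgen : ∀ z : Λ.map f, ∃ γ ∈ Γ ⊓ Λ, f γ = z := by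
    intro z
    have hz : z ∈ Subgroup.closure (s : Set (Λ.map f)) := by rw [hs]; trivial
    induction hz using Subgroup.closure_induction with
    | mem x hx =>
      refine ⟨ℓ x, ⟨?_, hℓ1 x⟩, hℓ2 x⟩
      rw [hΓ]; exact Subgroup.subset_closure (hhr x hx)
    | one => exact ⟨1, one_mem _, by simp⟩
    | mul x y _ _ h1 h2 =>
      obtain ⟨a, ha, ha'⟩ := h1
      obtain ⟨b, hb, hb'⟩ := h2
      exact ⟨a * b, mul_mem ha hb, by simp [ha', hb']⟩
    | inv x _ h1 =>
      obtain ⟨a, ha, ha'⟩ := h1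
      exact ⟨a⁻¹, inv_mem ha, by simp [ha']⟩
  obtain ⟨N, hN, hNx⟩ := nak_pow X Γ (by
    rw [← hΛ]
    intro x hx
    obtain ⟨γ, hγ, he⟩ := hgen ⟨f x, Subgroup.mem_map_of_mem f hx⟩
    have : f (x / γ) = 1 := by rw [map_div, he]; simp
    obtain ⟨y, hy, hy2⟩ := (hf1 _).mp this
    refine ⟨y, hy, ?_⟩
    rw [hy2, div_div_cancel]
    exact hγ.1)
  rw [← hΛ] at hNx
  refine ⟨hh, fun p hp q hq => ⟨N, hN, ?_⟩⟩
  rw [← hΓ]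
  exact hNx _ (hAΛ p hp q hq)

theorem fr_min {G : Type*} [CommGroup G] [DecidableEq G] (A0 : Finset G) (hA0 : A0.Nonempty)
    (β : ℝ) (hβ : 0 < β) :
    ∃ A ⊆ A0, ∃ B ⊆ A0, A.Nonempty ∧ B.Nonempty ∧ FStar A B β ∧
      ((A * B).card : ℝ) ≤ (A0 * A0).card *
        ((A.card / A0.card : ℝ) * (B.card / A0.card : ℝ)) ^ β := by
  classical
  obtain ⟨⟨A, B⟩, hAB, hmin⟩ := Finset.exists_min_image
    ((A0.powerset.filter (fun A => A.Nonempty)) ×ˢ (A0.powerset.filter (fun A => A.Nonempty)))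
    (fun q => ((q.1 * q.2).card : ℝ) / ((q.1.card : ℝ) * q.2.card) ^ β)
    ⟨(A0, A0), by simp [hA0]⟩
  simp only [Finset.mem_product, Finset.mem_filter, Finset.mem_powerset] at hAB hmin
  obtain ⟨⟨hA, hAn⟩, hB, hBn⟩ := hAB
  have hAp : (0 : ℝ) < A.card := by exact_mod_cast hAn.card_pos
  have hBp : (0 : ℝ) < B.card := by exact_mod_cast hBn.card_pos
  have h0p : (0 : ℝ) < A0.card := by exact_mod_cast hA0.card_pos
  refine ⟨A, hA, B, hB, hAn, hBn, ?_, ?_⟩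
  · intro A1 hA1 B1 hB1
    rcases A1.eq_empty_or_nonempty with rfl | hA1n
    · simp [Real.zero_rpow hβ.ne']
    rcases B1.eq_empty_or_nonempty with rfl | hB1n
    · simp [Real.zero_rpow hβ.ne']
    have h1p : (0 : ℝ) < A1.card := by exact_mod_cast hA1n.card_pos
    have h2p : (0 : ℝ) < B1.card := by exact_mod_cast hB1n.card_pos
    have := hmin (A1, B1) ⟨⟨hA1.trans hA, hA1n⟩, hB1.trans hB, hB1n⟩
    rw [div_le_div_iff₀ (Real.rpow_pos_of_pos (by positivity) _)
      (Real.rpow_pos_of_pos (by positivity) _)] at this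
    rw [div_mul_div_comm, Real.div_rpow (by positivity) (by positivity), ← mul_div_assoc,
      div_le_iff₀ (Real.rpow_pos_of_pos (by positivity) _)]
    exact this
  · have := hmin (A0, A0) ⟨⟨subset_rfl, hA0⟩, subset_rfl, hA0⟩
    rw [div_le_div_iff₀ (Real.rpow_pos_of_pos (by positivity) _)
      (Real.rpow_pos_of_pos (by positivity) _)] at this
    rw [div_mul_div_comm, Real.div_rpow (by positivity) (by positivity), ← mul_div_assoc,
      le_div_iff₀ (Real.rpow_pos_of_pos (by positivity) _)]
    exact this

theorem fr_cube {G : Type*} [CommGroup G] [DecidableEq G] (A B : Finset G) (hA : A.Nonempty)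
    (hB : B.Nonempty) (K : ℝ) (hK : 1 ≤ K)
    (h : ((A * B).card : ℝ) ^ 2 ≤ K ^ 2 * (A.card * B.card)) :
    ((A ^ 3).card : ℝ) ≤ K ^ 8 * A.card := by
  have hAp : (0 : ℝ) < A.card := by exact_mod_cast hA.card_pos
  have hBp : (0 : ℝ) < B.card := by exact_mod_cast hB.card_pos
  have hAle : (A.card : ℝ) ≤ (A * B).card := by
    exact_mod_cast Finset.card_le_card_mul_right hB
  have hBle : (B.card : ℝ) ≤ (A * B).card := by
    exact_mod_cast Finset.card_le_card_mul_left hA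
  have hAB : (A.card : ℝ) ≤ K ^ 2 * B.card := by
    refine le_of_mul_le_mul_right ?_ hAp
    nlinarith
  have hBA : (B.card : ℝ) ≤ K ^ 2 * A.card := by
    refine le_of_mul_le_mul_right ?_ hBp
    nlinarith
  have h1 : ((A * B).card : ℝ) / B.card ≤ K ^ 2 := by
    rw [div_le_iff₀ hBp]
    refine le_of_pow_le_pow_left₀ (n := 2) (by norm_num) (by positivity) (h.trans ?_)
    calc K ^ 2 * (A.card * B.card) ≤ K ^ 2 * ((K ^ 2 * B.card) * B.card) := by gcongr
      _ = _ := by ring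
  have pl := (NNRat.cast_le (K := ℝ)).mpr (Finset.pluennecke_ruzsa_inequality_pow_mul hB A 3)
  push_cast at pl
  rw [mul_comm B A] at pl
  calc ((A ^ 3).card : ℝ) ≤ (((A * B).card : ℝ) / B.card) ^ 3 * B.card := pl
    _ ≤ (K ^ 2) ^ 3 * (K ^ 2 * A.card) := by
        have : (0 : ℝ) ≤ ((A * B).card : ℝ) / B.card :=
          div_nonneg (Nat.cast_nonneg _) (Nat.cast_nonneg _)
        gcongr
    _ = K ^ 8 * A.card := by ring

set_option maxHeartbeats 1000000 in
theorem freiman {G : Type*} [CommGroup G] [DecidableEq G]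
    (h2 : ∀ A : Finset G, A.card ≤ 2 * (A.image (fun x => x ^ 2)).card)
    (A0 : Finset G) (hA0 : A0.Nonempty) (K : ℝ) (hK : 1 ≤ K)
    (hAA : ((A0 * A0).card : ℝ) ≤ K * A0.card) :
    ∃ A ⊆ A0, A.Nonempty ∧
      (A0.card : ℝ) ≤ A.card * (2 : ℝ) ^ (16 * 10 ^ 8 * (Real.logb 2 (2 * K)) ^ 2) ∧
      ∃ r : ℕ, 1 ≤ r ∧ (r : ℝ) ≤ 11 * Real.logb 2 (2 * K) ∧ Rk A r := by
  have h0p : (0 : ℝ) < A0.card := by exact_mod_cast hA0.card_pos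
  have hK0 : 0 < K := by linarith
  obtain ⟨lk, hlk⟩ : ∃ lk, lk = Real.logb 2 K := ⟨_, rfl⟩
  have hlk0 : 0 ≤ lk := by rw [hlk]; exact Real.logb_nonneg (by norm_num) hK
  have hKlk : K = (2 : ℝ) ^ lk := by
    rw [hlk, Real.rpow_logb (by norm_num) (by norm_num) hK0]
  have hL : Real.logb 2 (2 * K) = 1 + lk := by
    rw [Real.logb_mul (by norm_num) hK0.ne', Real.logb_self_eq_one (by norm_num), hlk]
  rw [hL]
  clear hlk hL
  obtain ⟨L, hLd⟩ : ∃ L, L = 1 + lk := ⟨_, rfl⟩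
  rw [← hLd]
  have hL1 : 1 ≤ L := by linarith
  obtain ⟨W, hW⟩ : ∃ W : ℝ, W = 10 ^ 8 := ⟨_, rfl⟩
  rw [← hW]
  have hW1 : 1 ≤ W := by rw [hW]; norm_num
  have hWM : ∀ p β : ℝ, p ≤ p ^ (2 * β) * (1 + 1 / W) → p ≤ p ^ (2 * β) * (1 + 1 / 10 ^ 8) := by
    intro p β h; rw [← hW]; exact h
  clear hW
  obtain ⟨κ, hκ⟩ : ∃ κ : ℝ, κ = 1 / W / (16 * L) := ⟨_, rfl⟩
  have hκ0 : 0 < κ := by rw [hκ]; positivity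
  have hκL : κ * (16 * L) = 1 / W := by rw [hκ]; field_simp
  have hκ1 : κ ≤ 1 / 4 := by
    have : 1 / W ≤ 1 := by rw [div_le_one (by linarith)]; exact hW1
    nlinarith
  obtain ⟨A, hA, B, hB, hAn, hBn, hst, hmin⟩ := fr_min A0 hA0 (1 / 2 + κ) (by linarith)
  have hAp : (0 : ℝ) < A.card := by exact_mod_cast hAn.card_pos
  have hBp : (0 : ℝ) < B.card := by exact_mod_cast hBn.card_pos
  obtain ⟨a, ha⟩ : ∃ a : ℝ, a = A.card / A0.card := ⟨_, rfl⟩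
  obtain ⟨b, hb⟩ : ∃ b : ℝ, b = B.card / A0.card := ⟨_, rfl⟩
  have ha0 : 0 < a := by rw [ha]; positivity
  have hb0 : 0 < b := by rw [hb]; positivity
  have ha1 : a ≤ 1 := by rw [ha, div_le_one h0p]; exact_mod_cast Finset.card_le_card hA
  have hb1 : b ≤ 1 := by rw [hb, div_le_one h0p]; exact_mod_cast Finset.card_le_card hB
  have eA : (A.card : ℝ) = a * A0.card := by
    rw [ha]; exact (div_mul_cancel₀ _ h0p.ne').symm
  have eB : (B.card : ℝ) = b * A0.card := by
    rw [hb]; exact (div_mul_cancel₀ _ h0p.ne').symm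
  rw [← ha, ← hb] at hmin
  clear ha hb
  have hab0 : 0 < a * b := mul_pos ha0 hb0
  have hab1 : a * b ≤ 1 := by nlinarith
  have hABle : ((A * B).card : ℝ) ≤ K * A0.card * (a * b) ^ (1 / 2 + κ) := by
    refine hmin.trans ?_
    gcongr
  have hsq : ((a * b) ^ (1 / 2 + κ)) ^ 2 = (a * b) * (a * b) ^ (2 * κ) := by
    rw [← Real.rpow_natCast, ← Real.rpow_mul hab0.le]
    rw [show (1 / 2 + κ) * ((2 : ℕ) : ℝ) = 1 + 2 * κ by push_cast; ring, Real.rpow_add hab0,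
      Real.rpow_one]
  have hAB2 : ((A * B).card : ℝ) ^ 2 ≤
      K ^ 2 * (A.card * B.card) * (a * b) ^ (2 * κ) := by
    calc ((A * B).card : ℝ) ^ 2 ≤ (K * A0.card * (a * b) ^ (1 / 2 + κ)) ^ 2 := by gcongr
      _ = K ^ 2 * A0.card ^ 2 * (((a * b) ^ (1 / 2 + κ)) ^ 2) := by ring
      _ = _ := by rw [hsq, eA, eB]; ring
  have hpow1 : (a * b) ^ (2 * κ) ≤ 1 := Real.rpow_le_one hab0.le hab1 (by linarith)
  have hAB2' : ((A * B).card : ℝ) ^ 2 ≤ K ^ 2 * (A.card * B.card) := by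
    refine hAB2.trans ?_
    have : 0 ≤ K ^ 2 * ((A.card : ℝ) * B.card) := by positivity
    nlinarith
  have cubA := fr_cube A B hAn hBn K hK hAB2'
  have cubB := fr_cube B A hBn hAn K hK (by rw [mul_comm B A, mul_comm (B.card : ℝ)]; exact hAB2')
  have hAle : (A.card : ℝ) ≤ (A * B).card := by
    exact_mod_cast Finset.card_le_card_mul_right hBn
  have hBle : (B.card : ℝ) ≤ (A * B).card := by
    exact_mod_cast Finset.card_le_card_mul_left hAn
  -- size
  have hsize : 1 ≤ K ^ 2 * (a * b) ^ (2 * κ) := by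
    have h1 : (A.card : ℝ) * B.card ≤ ((A * B).card : ℝ) ^ 2 := by
      rw [pow_two]; gcongr
    have h3 := h1.trans hAB2
    have hp : (0 : ℝ) < A.card * B.card := by positivity
    refine le_of_mul_le_mul_left ?_ hp
    linarith
  have hsize2 : 1 ≤ K * a ^ κ := by
    have h1 : K ^ 2 * (a * b) ^ (2 * κ) = (K * (a * b) ^ κ) ^ 2 := by
      rw [mul_pow, ← Real.rpow_natCast ((a * b) ^ κ), ← Real.rpow_mul hab0.le]
      congr 2; push_cast; ring
    rw [h1] at hsize
    have h3 : 1 ≤ K * (a * b) ^ κ := by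
      have : 0 ≤ K * (a * b) ^ κ := mul_nonneg hK0.le (Real.rpow_nonneg hab0.le _)
      nlinarith
    refine h3.trans ?_
    gcongr
    nlinarith
  have hsize3 : 1 ≤ a * (2 : ℝ) ^ (16 * W * L ^ 2) := by
    have h1 : (1 : ℝ) ≤ (K * a ^ κ) ^ (1 / κ) := Real.one_le_rpow hsize2 (by positivity)
    rw [Real.mul_rpow hK0.le (Real.rpow_nonneg ha0.le _), ← Real.rpow_mul ha0.le,
      mul_one_div_cancel hκ0.ne', Real.rpow_one, hKlk, ← Real.rpow_mul (by norm_num)] at h1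
    rw [mul_comm]
    refine h1.trans ?_
    refine mul_le_mul_of_nonneg_right (Real.rpow_le_rpow_of_exponent_le (by norm_num) ?_) ha0.le
    · have : 1 / κ = 16 * W * L := by rw [hκ]; field_simp
      rw [this]
      have h5 : lk * (16 * W * L) ≤ L * (16 * W * L) := by
        have : 0 ≤ 16 * W * L := by positivity
        have : lk ≤ L := by linarith only [hLd]
        gcongr
      linarith only [h5]
  -- M
  have hM1 : (1 : ℝ) ≤ 2 * K ^ 8 := by
    have : (1 : ℝ) ≤ K ^ 8 := one_le_pow₀ hK
    linarith only [this]
  have hMlog : 2 * K ^ 8 = (2 : ℝ) ^ (1 + 8 * lk) := by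
    rw [Real.rpow_add (by norm_num), Real.rpow_one, mul_comm 8 lk, Real.rpow_mul (by norm_num),
      ← hKlk]
    norm_cast
  refine ⟨A, hA, hAn, ?_, ⌈2 + 8 * lk⌉₊, ?_, ?_, ?_⟩
  · calc (A0.card : ℝ) = 1 * A0.card := (one_mul _).symm
      _ ≤ (a * (2 : ℝ) ^ (16 * W * L ^ 2)) * A0.card := by gcongr
      _ = _ := by rw [eA]; ring
  · rw [Nat.one_le_ceil_iff]; linarith
  · have := Nat.ceil_lt_add_one (show 0 ≤ 2 + 8 * lk by linarith)
    rw [hLd]; linarith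
  · refine fr_rank h2 A B hAn hBn (1 / 2 + κ) (2 * K ^ 8) (by linarith) (by linarith) hst hM1 ?_
      (by linarith only [cubA]) (by linarith only [cubB]) _ ?_
    · intro p hp hp1
      have hp0 : 0 < p := lt_of_lt_of_le (by positivity) hp
      apply hWM
      rw [show 2 * (1 / 2 + κ) = 1 + 2 * κ by ring, Real.rpow_add hp0, Real.rpow_one, mul_assoc]
      refine le_mul_of_one_le_right hp0.le ?_
      have h1 : (1 : ℝ) ≤ (2 * K ^ 8 * p) ^ (2 * κ) := by
        apply Real.one_le_rpow _ (by linarith)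
        rw [div_le_iff₀ (by linarith)] at hp
        linarith
      rw [Real.mul_rpow (by positivity) hp0.le, hMlog, ← Real.rpow_mul (by norm_num)] at h1
      refine h1.trans ?_
      rw [mul_comm]
      have : 0 ≤ p ^ (2 * κ) := Real.rpow_nonneg hp0.le _
      gcongr
      have h3 : (2 : ℝ) ^ ((1 + 8 * lk) * (2 * κ)) ≤ (2 : ℝ) ^ (1 / W : ℝ) := by
        apply Real.rpow_le_rpow_of_exponent_le (by norm_num)
        rw [← hκL]; nlinarith
      refine h3.trans ?_
      have := rpow_one_add_le_one_add_mul_self (s := 1) (p := 1 / W) (by norm_num)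
        (by positivity) (by rw [div_le_one (by linarith)]; exact hW1)
      rw [mul_one, one_add_one_eq_two] at this
      exact this
    · rw [hMlog, ← Real.rpow_natCast]
      have : (2 : ℝ) * 2 ^ (1 + 8 * lk) = 2 ^ (2 + 8 * lk) := by
        rw [show 2 + 8 * lk = 1 + (1 + 8 * lk) by ring, Real.rpow_add two_pos 1 (1 + 8 * lk),
          Real.rpow_one]
      rw [this]
      apply Real.rpow_lt_rpow_of_exponent_lt (by norm_num)
      push_cast
      have := Nat.le_ceil (2 + 8 * lk)
      linarith

theorem span_int {n : ℕ} (S : Set (Fin n →₀ ℕ))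
    (hspan : Submodule.span ℚ ((fun (m : Fin n →₀ ℕ) (i : Fin n) => (m i : ℚ)) '' S) = ⊤)
    (v : Fin n → ℚ) :
    ∃ D : ℕ, 0 < D ∧ ∃ w ∈ AddSubgroup.closure ((fun (m : Fin n →₀ ℕ) (i : Fin n) => (m i : ℤ)) '' S),
      ∀ j, (D : ℚ) * v j = (w j : ℤ) := by
  have hv : v ∈ Submodule.span ℚ ((fun (m : Fin n →₀ ℕ) (i : Fin n) => (m i : ℚ)) '' S) := by
    rw [hspan]; trivial
  induction hv using Submodule.span_induction with
  | mem x hx =>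
    obtain ⟨m, hm, rfl⟩ := hx
    exact ⟨1, one_pos, _, AddSubgroup.subset_closure ⟨m, hm, rfl⟩, fun j => by simp⟩
  | zero => exact ⟨1, one_pos, 0, zero_mem _, fun j => by simp⟩
  | add x y _ _ h1 h2 =>
    obtain ⟨D1, hD1, w1, hw1, e1⟩ := h1
    obtain ⟨D2, hD2, w2, hw2, e2⟩ := h2
    refine ⟨D1 * D2, Nat.mul_pos hD1 hD2, D2 • w1 + D1 • w2,
      add_mem (nsmul_mem hw1 _) (nsmul_mem hw2 _), fun j => ?_⟩
    have h1 := e1 j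
    have h2 := e2 j
    rw [show (D2 • w1 + D1 • w2) j = (D2 • w1) j + (D1 • w2) j from rfl, Pi.add_apply]
    rw [Pi.smul_apply, Pi.smul_apply, nsmul_eq_mul, nsmul_eq_mul]
    push_cast
    rw [← h1, ← h2]; ring
  | smul a x _ h1 =>
    obtain ⟨D1, hD1, w1, hw1, e1⟩ := h1
    refine ⟨D1 * a.den, Nat.mul_pos hD1 a.den_pos, a.num • w1, zsmul_mem hw1 _, fun j => ?_⟩
    have h1 := e1 j
    simp only [Pi.smul_apply, smul_eq_mul]
    push_cast
    rw [← h1]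
    have : (a.den : ℚ) * a = a.num := by rw [mul_comm]; exact Rat.mul_den_eq_num a
    rw [← this]; ring

theorem span_pow {n : ℕ} (S : Set (Fin n →₀ ℕ))
    (hspan : Submodule.span ℚ ((fun (m : Fin n →₀ ℕ) (i : Fin n) => (m i : ℚ)) '' S) = ⊤) :
    ∃ D : ℕ, 0 < D ∧ ∀ (G : Type) [CommGroup G] (p q : Fin n → G),
      (∀ m ∈ S, mon m p = mon m q) → ∀ i, p i ^ D = q i ^ D := by
  choose D hD w hw e using fun i : Fin n => span_int S hspan (Pi.single i 1)
  refine ⟨∏ i, D i, Finset.prod_pos (fun i _ => hD i), fun G _ p q h i => ?_⟩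
  have key : ∀ w ∈ AddSubgroup.closure ((fun (m : Fin n →₀ ℕ) (i : Fin n) => (m i : ℤ)) '' S),
      ∏ j, p j ^ (w j) = ∏ j, q j ^ (w j) := by
    intro w hw
    induction hw using AddSubgroup.closure_induction with
    | mem x hx =>
      obtain ⟨m, hm, rfl⟩ := hx
      have := h m hm
      simpa [mon, zpow_natCast] using this
    | zero => simp
    | add x y _ _ h1 h2 => simp [zpow_add, Finset.prod_mul_distrib, h1, h2]
    | neg x _ h1 => simp [h1]
  have hk := key _ (hw i)
  have hwi : ∀ j, w i j = if j = i then (D i : ℤ) else 0 := by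
    intro j
    have := e i j
    by_cases hj : j = i
    · subst hj; simp at this ⊢; exact_mod_cast this.symm
    · simp [hj] at this ⊢; exact_mod_cast this.symm
  have single : ∀ g : Fin n → G, ∏ j, g j ^ (w i j) = g i ^ (D i) := by
    intro g
    rw [Finset.prod_eq_single i]
    · rw [hwi]; simp
    · intro j _ hj; rw [hwi]; simp [hj]
    · simp
  rw [single, single] at hk
  obtain ⟨k, hkk⟩ := Finset.dvd_prod_of_mem D (Finset.mem_univ i)
  rw [hkk, pow_mul, pow_mul, hk]

theorem units_pow_fiber {K : Type} [Field K] (Q : Finset Kˣ) (D : ℕ) (hD : 0 < D) (c : Kˣ) :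
    (Q.filter (fun x => x ^ D = c)).card ≤ D := by
  have h1 : ((Q.filter (fun x => x ^ D = c)).image (fun x : Kˣ => (x : K))).card =
      (Q.filter (fun x => x ^ D = c)).card :=
    Finset.card_image_of_injective _ Units.val_injective
  rw [← h1]
  have h2 : (Q.filter (fun x => x ^ D = c)).image (fun x : Kˣ => (x : K)) ⊆
      (Polynomial.nthRoots D (c : K)).toFinset := by
    intro y hy
    obtain ⟨x, hx, rfl⟩ := Finset.mem_image.mp hy
    rw [Multiset.mem_toFinset, Polynomial.mem_nthRoots hD, ← (Finset.mem_filter.mp hx).2]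
    simp
  exact (Finset.card_le_card h2).trans ((Multiset.toFinset_card_le _).trans
    (Polynomial.card_nthRoots _ _))

theorem units_sq {K : Type} [Field K] [DecidableEq Kˣ] (A : Finset Kˣ) :
    A.card ≤ 2 * (A.image (fun x => x ^ 2)).card := by
  refine Finset.card_le_mul_card_image A 2 (fun c _ => ?_)
  convert units_pow_fiber A 2 (by norm_num) c

theorem exists_D (n d : ℕ) : ∃ D : ℕ, ∀ S : Finset (Fin n →₀ ℕ), (∀ m ∈ S, ∑ j, m j ≤ d) →
    Submodule.span ℚ ((fun (m : Fin n →₀ ℕ) (i : Fin n) => (m i : ℚ)) '' (S : Set (Fin n →₀ ℕ))) = ⊤ →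
    S.card ≤ D ∧ ∃ D0 : ℕ, 0 < D0 ∧ D0 ≤ D ∧ ∀ (G : Type) [CommGroup G] (p q : Fin n → G),
      (∀ m ∈ S, mon m p = mon m q) → ∀ i, p i ^ D0 = q i ^ D0 := by
  have ex : ∀ S : Finset (Fin n →₀ ℕ), ∃ D0 : ℕ,
    Submodule.span ℚ ((fun (m : Fin n →₀ ℕ) (i : Fin n) => (m i : ℚ)) '' (S : Set (Fin n →₀ ℕ))) = ⊤ →
    0 < D0 ∧ ∀ (G : Type) [CommGroup G] (p q : Fin n → G),
      (∀ m ∈ S, mon m p = mon m q) → ∀ i, p i ^ D0 = q i ^ D0 := by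
    intro S
    by_cases h : Submodule.span ℚ
      ((fun (m : Fin n →₀ ℕ) (i : Fin n) => (m i : ℚ)) '' (S : Set (Fin n →₀ ℕ))) = ⊤
    · obtain ⟨D, h1, h2⟩ := span_pow _ h
      exact ⟨D, fun _ => ⟨h1, fun G _ p q hh => h2 G p q hh⟩⟩
    · exact ⟨0, fun h' => absurd h' h⟩
  choose D0 hD0 using ex
  let E : Finset (Fin n →₀ ℕ) := Finset.Icc 0 (Finsupp.equivFunOnFinite.symm (fun _ => d))
  refine ⟨E.card + ∑ S ∈ E.powerset, D0 S, fun S hS hspan => ?_⟩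
  have hSE : S ⊆ E := by
    intro m hm
    refine Finset.mem_Icc.mpr ⟨zero_le, fun j => ?_⟩
    have := hS m hm
    have h2 : m j ≤ ∑ j, m j := Finset.single_le_sum (fun _ _ => Nat.zero_le _) (Finset.mem_univ j)
    simpa using h2.trans this
  refine ⟨(Finset.card_le_card hSE).trans (Nat.le_add_right _ _), D0 S, (hD0 S hspan).1, ?_,
    (hD0 S hspan).2⟩
  exact (Finset.single_le_sum (f := D0) (fun _ _ => Nat.zero_le _)
    (Finset.mem_powerset.mpr hSE)).trans (Nat.le_add_left _ _)

theorem box_image {n : ℕ} {K : Type} [Field K] (Q : Fin n → Finset Kˣ) (D0 : ℕ) (hD0 : 0 < D0)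
    (f : (Fin n → Kˣ) → K)
    (h : ∀ p q, (∀ i, p i ∈ Q i) → (∀ i, q i ∈ Q i) → f p = f q → ∀ i, p i ^ D0 = q i ^ D0) :
    ∏ i, (Q i).card ≤ D0 ^ n * ((Fintype.piFinset Q).image f).card := by
  rw [← Fintype.card_piFinset]
  refine Finset.card_le_mul_card_image _ _ (fun c hc => ?_)
  obtain ⟨p, hp, rfl⟩ := Finset.mem_image.mp hc
  have hsub : ((Fintype.piFinset Q).filter (fun q => f q = f p)) ⊆
      Fintype.piFinset (fun i => (Q i).filter (fun x => x ^ D0 = p i ^ D0)) := by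
    intro q hq
    obtain ⟨hq1, hq2⟩ := Finset.mem_filter.mp hq
    rw [Fintype.mem_piFinset] at hq1 hp ⊢
    exact fun i => Finset.mem_filter.mpr ⟨hq1 i, h q p hq1 hp hq2 i⟩
  refine (Finset.card_le_card hsub).trans ?_
  rw [Fintype.card_piFinset]
  refine (Finset.prod_le_pow_card _ _ D0 (fun i _ => units_pow_fiber _ _ hD0 _)).trans ?_
  simp

theorem freiman_ex : ∃ C1 : ℝ, 0 < C1 ∧ ∀ (G : Type) [CommGroup G] [DecidableEq G]
    (_ : ∀ A : Finset G, A.card ≤ 2 * (A.image (fun x => x ^ 2)).card) (P : Finset G) (_ : P.Nonempty)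
    (κ : ℝ) (_ : 1 ≤ κ) (_ : ((P * P).card : ℝ) ≤ κ * P.card),
    ∃ A ⊆ P, A.Nonempty ∧ (P.card : ℝ) ≤ A.card * (2 : ℝ) ^ (C1 * (Real.logb 2 (2 * κ)) ^ 2) ∧
      ∃ r : ℕ, 1 ≤ r ∧ (r : ℝ) ≤ 11 * Real.logb 2 (2 * κ) ∧ Rk A r := by
  obtain ⟨C1, hC1⟩ : ∃ C1 : ℝ, C1 = 16 * 10 ^ 8 := ⟨_, rfl⟩
  refine ⟨C1, by rw [hC1]; norm_num, ?_⟩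
  intro G _ _ h2 P hP κ hκ hPP
  obtain ⟨A, h1, h2, h3, h4⟩ := freiman h2 P hP κ hκ hPP
  rw [← hC1] at h3
  exact ⟨A, h1, h2, h3, h4⟩

theorem freiman_units : ∃ C1 : ℝ, 0 < C1 ∧ ∀ (K : Type) [Field K] (P : Finset Kˣ) (_ : P.Nonempty)
    (κ : ℝ) (_ : 1 ≤ κ) (_ : ((P * P).card : ℝ) ≤ κ * P.card),
    ∃ A ⊆ P, A.Nonempty ∧ (P.card : ℝ) ≤ A.card * (2 : ℝ) ^ (C1 * (Real.logb 2 (2 * κ)) ^ 2) ∧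
      ∃ r : ℕ, 1 ≤ r ∧ (r : ℝ) ≤ 11 * Real.logb 2 (2 * κ) ∧ Rk A r := by
  obtain ⟨C1, h, hf⟩ := freiman_ex
  refine ⟨C1, h, ?_⟩
  intro K _ P hP κ hκ hPP
  exact hf Kˣ (fun A => units_sq A) P hP κ hκ hPP

set_option maxHeartbeats 400000 in
theorem nf_thm (n d : ℕ) : ∃ c0 C0 : ℝ, 0 < c0 ∧ 0 < C0 ∧ ∀ (K : Type) [Field K] [NumberField K]
    (P : Finset Kˣ) (_ : P.Nonempty) (κ : ℝ) (_ : 1 ≤ κ)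
    (_ : ((P * P).card : ℝ) ≤ κ * P.card) (S : Finset (Fin (n + 1) →₀ ℕ))
    (_ : ∀ m ∈ S, ∑ j, m j ≤ d)
    (_ : Submodule.span ℚ ((fun (m : Fin (n + 1) →₀ ℕ) (i : Fin (n + 1)) => (m i : ℚ)) ''
      (S : Set (Fin (n + 1) →₀ ℕ))) = ⊤)
    (b : (Fin (n + 1) →₀ ℕ) → K) (_ : ∀ m ∈ S, b m ≠ 0),
    (P.card : ℝ) ^ (n + 1) ≤ c0 * (2 : ℝ) ^ (C0 * (Real.logb 2 (2 * κ)) ^ 2) *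
      ((Fintype.piFinset (fun _ : Fin (n + 1) => P)).image
        (fun p => ∑ m ∈ S, b m * ((mon m p : Kˣ) : K))).card := by
  obtain ⟨D, hD⟩ := exists_D (n + 1) d
  obtain ⟨c, e, hbox⟩ := box_thm n d (D + 1) (by omega)
  obtain ⟨C1, hC10, hfr⟩ := freiman_units
  refine ⟨(D * c + 1) ^ (n + 1), (C1 + e * (C1 + 122)) * (n + 1), by positivity, by positivity, ?_⟩
  intro K _ _ P hP κ hκ hPP S hSd hspan b hb
  obtain ⟨A, hA, hAn, hAc, r, hr1, hrL, hRk⟩ := hfr K P hP κ hκ hPP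
  obtain ⟨L, hL⟩ : ∃ L, L = Real.logb 2 (2 * κ) := ⟨_, rfl⟩
  rw [← hL] at hAc hrL ⊢
  have hL1 : 1 ≤ L := by
    rw [hL, Real.le_logb_iff_rpow_le (by norm_num) (by linarith)]; norm_num; linarith
  have hκL : κ ≤ (2 : ℝ) ^ L := by
    rw [hL, Real.rpow_logb (by norm_num) (by norm_num) (by linarith)]; linarith
  clear hL
  have hLL : L ≤ L ^ 2 := by nlinarith
  have hAp : (0 : ℝ) < A.card := by exact_mod_cast hAn.card_pos
  have hPp : (0 : ℝ) < P.card := by exact_mod_cast hP.card_pos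
  have h2L : (1 : ℝ) ≤ (2 : ℝ) ^ (C1 * L ^ 2) := Real.one_le_rpow (by norm_num) (by positivity)
  have hK1 : ((A * A).card : ℝ) ≤ (κ * (2 : ℝ) ^ (C1 * L ^ 2)) * A.card := by
    calc ((A * A).card : ℝ) ≤ ((P * P).card : ℝ) := by
          exact_mod_cast Finset.card_le_card (Finset.mul_subset_mul hA hA)
      _ ≤ κ * P.card := hPP
      _ ≤ κ * (A.card * (2 : ℝ) ^ (C1 * L ^ 2)) := by gcongr
      _ = _ := by ring
  obtain ⟨hSD, D0, hD00, hD0D, hD0⟩ := hD S hSd hspan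
  have σ : K →+* ℂ := Classical.choice inferInstance
  obtain ⟨Q, hQ, hinj⟩ := hbox K σ A hAn (κ * (2 : ℝ) ^ (C1 * L ^ 2)) (by nlinarith) hK1 r hr1 hRk S
    hSd (by omega) b hb
  have himg := box_image Q D0 hD00 (fun p => ∑ m ∈ S, b m * ((mon m p : Kˣ) : K)) (by
    intro p q hp hq he
    apply hD0 Kˣ p q
    apply hinj p q hp hq
    simp only [mul_sub, Finset.sum_sub_distrib]
    exact sub_eq_zero.mpr he)
  have hsub : (Fintype.piFinset Q).image (fun p => ∑ m ∈ S, b m * ((mon m p : Kˣ) : K)) ⊆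
      (Fintype.piFinset (fun _ : Fin (n + 1) => P)).image
        (fun p => ∑ m ∈ S, b m * ((mon m p : Kˣ) : K)) := by
    apply Finset.image_subset_image
    exact Fintype.piFinset_subset _ _ (fun i => (hQ i).1.trans hA)
  have himg2 := himg.trans (Nat.mul_le_mul_left _ (Finset.card_le_card hsub))
  generalize ((Fintype.piFinset (fun _ : Fin (n + 1) => P)).image
        (fun p => ∑ m ∈ S, b m * ((mon m p : Kˣ) : K))).card = I at himg2 ⊢
  have hΘ : κ * (2 : ℝ) ^ (C1 * L ^ 2) * ((r : ℝ) + 1) ^ r ≤ (2 : ℝ) ^ ((C1 + 122) * L ^ 2) := by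
    have h1 : ((r : ℝ) + 1) ^ r ≤ (2 : ℝ) ^ (121 * L ^ 2) := by
      have h2 : (r : ℝ) + 1 ≤ 2 ^ r := by exact_mod_cast Nat.lt_two_pow_self (n := r)
      calc ((r : ℝ) + 1) ^ r ≤ (2 ^ r) ^ r := by gcongr
        _ = (2 : ℝ) ^ ((r : ℝ) * r) := by
            rw [← pow_mul, ← Real.rpow_natCast]; push_cast; rfl
        _ ≤ _ := by
            apply Real.rpow_le_rpow_of_exponent_le (by norm_num)
            have : (0 : ℝ) ≤ r := Nat.cast_nonneg _
            nlinarith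
    have h3 : κ ≤ (2 : ℝ) ^ (L ^ 2) :=
      hκL.trans (Real.rpow_le_rpow_of_exponent_le (by norm_num) hLL)
    calc κ * (2 : ℝ) ^ (C1 * L ^ 2) * ((r : ℝ) + 1) ^ r
        ≤ (2 : ℝ) ^ (L ^ 2) * (2 : ℝ) ^ (C1 * L ^ 2) * (2 : ℝ) ^ (121 * L ^ 2) := by gcongr
      _ = _ := by
          rw [← Real.rpow_add (by norm_num), ← Real.rpow_add (by norm_num)]; congr 1; ring
  obtain ⟨E, hE⟩ : ∃ E : ℝ, E = (2 : ℝ) ^ ((C1 + e * (C1 + 122)) * L ^ 2) := ⟨_, rfl⟩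
  have hE0 : 0 < E := by rw [hE]; positivity
  have hPQ : ∀ i, (P.card : ℝ) ≤ c * E * (Q i).card := by
    intro i
    have h0 : 0 ≤ κ * (2 : ℝ) ^ (C1 * L ^ 2) * ((r : ℝ) + 1) ^ r := by positivity
    calc (P.card : ℝ) ≤ A.card * (2 : ℝ) ^ (C1 * L ^ 2) := hAc
      _ ≤ (c * (κ * (2 : ℝ) ^ (C1 * L ^ 2) * ((r : ℝ) + 1) ^ r) ^ e * (Q i).card) *
          (2 : ℝ) ^ (C1 * L ^ 2) := by gcongr; exact (hQ i).2
      _ ≤ (c * ((2 : ℝ) ^ ((C1 + 122) * L ^ 2)) ^ e * (Q i).card) *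
          (2 : ℝ) ^ (C1 * L ^ 2) := by gcongr
      _ = _ := by
          rw [hE, ← Real.rpow_natCast ((2 : ℝ) ^ ((C1 + 122) * L ^ 2)) e, ← Real.rpow_mul (by norm_num),
            show (C1 + e * (C1 + 122)) * L ^ 2 = C1 * L ^ 2 + (C1 + 122) * L ^ 2 * e by ring,
            Real.rpow_add (by norm_num)]
          ring
  have hfin : (P.card : ℝ) ^ (n + 1) ≤ (c * E) ^ (n + 1) * ((∏ i, (Q i).card : ℕ) : ℝ) := by
    push_cast
    calc (P.card : ℝ) ^ (n + 1) = ∏ _i : Fin (n + 1), (P.card : ℝ) := by simp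
      _ ≤ ∏ i, (c * E * (Q i).card) := Finset.prod_le_prod (fun _ _ => hPp.le) (fun i _ => hPQ i)
      _ = _ := by rw [Finset.prod_mul_distrib]; simp
  have hEpow : (2 : ℝ) ^ ((C1 + e * (C1 + 122)) * (n + 1) * L ^ 2) = E ^ (n + 1) := by
    rw [hE, ← Real.rpow_natCast ((2 : ℝ) ^ ((C1 + e * (C1 + 122)) * L ^ 2)) (n + 1),
      ← Real.rpow_mul (by norm_num)]
    congr 1; push_cast; ring
  rw [hEpow]
  have hI : ((∏ i, (Q i).card : ℕ) : ℝ) ≤ (D : ℝ) ^ (n + 1) * I := by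
    have : ((∏ i, (Q i).card : ℕ) : ℝ) ≤ (D0 : ℝ) ^ (n + 1) * I := by exact_mod_cast himg2
    refine this.trans ?_
    gcongr
  calc (P.card : ℝ) ^ (n + 1) ≤ (c * E) ^ (n + 1) * ((D : ℝ) ^ (n + 1) * I) :=
        hfin.trans (by gcongr)
    _ = (D * c : ℝ) ^ (n + 1) * E ^ (n + 1) * I := by ring
    _ ≤ _ := by gcongr; linarith

theorem spec (X : Finset ℂ) : ∃ (K : Type) (_ : Field K) (_ : NumberField K) (R : Subring ℂ)
    (φ : R →+* K), ∀ x ∈ X, ∃ h : x ∈ R, x ≠ 0 → φ ⟨x, h⟩ ≠ 0 := by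
  let R : Subalgebra ℚ ℂ := Algebra.adjoin ℚ ((X ∪ X.image (fun x => x⁻¹) : Finset ℂ) : Set ℂ)
  have hft : Algebra.FiniteType ℚ R :=
    (Subalgebra.fg_iff_finiteType R).mp ⟨_, rfl⟩
  obtain ⟨m, hm⟩ := Ideal.exists_maximal R
  letI : Field (R ⧸ m) := Ideal.Quotient.field m
  have hfin : Module.Finite ℚ (R ⧸ m) := finite_of_finite_type_of_isJacobsonRing ℚ (R ⧸ m)
  have hc : CharZero (R ⧸ m) := algebraRat.charZero (R ⧸ m)
  have hnf : NumberField (R ⧸ m) := by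
    refine @NumberField.mk _ _ hc ?_
    convert hfin
    exact Subsingleton.elim _ _
  refine ⟨R ⧸ m, inferInstance, hnf, R.toSubring, Ideal.Quotient.mk m, fun x hx => ?_⟩
  have h1 : x ∈ R := Algebra.subset_adjoin (by simp [hx])
  have h2 : x⁻¹ ∈ R := Algebra.subset_adjoin (by simp [hx])
  refine ⟨h1, fun hx0 h0 => ?_⟩
  have h3 : (⟨x, h1⟩ : R) * ⟨x⁻¹, h2⟩ = 1 := Subtype.ext (mul_inv_cancel₀ hx0)
  have h4 := congrArg (Ideal.Quotient.mk m) h3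
  rw [map_mul, map_one] at h4
  rw [show Ideal.Quotient.mk m (⟨x, h1⟩ : R) = 0 from h0, zero_mul] at h4
  exact zero_ne_one h4

theorem spec2 (X : Finset ℂ) : ∃ (K : Type) (_ : Field K) (_ : NumberField K) (T : Subring (ℂ × K)),
    (∀ x y y', (x, y) ∈ T → (x, y') ∈ T → y = y') ∧
    ∀ x ∈ X, ∃ y, (x, y) ∈ T ∧ (x ≠ 0 → y ≠ 0) := by
  obtain ⟨K, i1, i2, R, φ, h⟩ := spec X
  refine ⟨K, i1, i2, (RingHom.prod R.subtype φ).range, ?_, ?_⟩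
  · rintro x y y' ⟨r, hr⟩ ⟨r', hr'⟩
    simp only [RingHom.prod_apply, Prod.mk.injEq] at hr hr'
    have : r = r' := Subtype.ext (hr.1.trans hr'.1.symm)
    rw [← hr.2, ← hr'.2, this]
  · intro x hx
    obtain ⟨hxR, h0⟩ := h x hx
    exact ⟨φ ⟨x, hxR⟩, ⟨⟨x, hxR⟩, rfl⟩, h0⟩

theorem cx_thm (n d : ℕ) : ∃ c0 C0 : ℝ, 0 < c0 ∧ 0 < C0 ∧ ∀ F : MvPolynomial (Fin (n + 1)) ℂ,
    dF F = n + 1 → F.totalDegree = d → ∀ κ : ℝ, 1 ≤ κ → ∀ A : Finset ℂ, A.Nonempty → 0 ∉ A →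
    ((A * A).card : ℝ) ≤ κ * (A.card : ℝ) →
    (A.card : ℝ) ^ (n + 1) ≤ c0 * (2 : ℝ) ^ (C0 * (Real.logb 2 (2 * κ)) ^ 2) *
      ((polyImage F A).card : ℝ) := by
  obtain ⟨c0, C0, hc0, hC0, H⟩ := nf_thm n d
  refine ⟨c0, C0, hc0, hC0, fun F hF hFd κ hκ A hA h0A hAA => ?_⟩
  obtain ⟨K, i1, i2, T, hT, hX⟩ := spec2 (A ∪ F.support.image (fun m => coeff m F) ∪
    (A ×ˢ A).image (fun p => p.1 - p.2))
  have hu : ∀ a : ℂ, ∃ v : Kˣ, a ∈ A → (a, (v : K)) ∈ T := by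
    intro a
    by_cases ha : a ∈ A
    · obtain ⟨y, hy, hy0⟩ := hX a (by simp [ha])
      exact ⟨Units.mk0 y (hy0 (fun h => h0A (h ▸ ha))), fun _ => hy⟩
    · exact ⟨1, fun h => absurd h ha⟩
  choose u hu using hu
  have hb : ∀ m : Fin (n + 1) →₀ ℕ, ∃ v : K, m ∈ F.support → v ≠ 0 ∧ (coeff m F, v) ∈ T := by
    intro m
    by_cases hm : m ∈ F.support
    · obtain ⟨y, hy, hy0⟩ := hX (coeff m F) (by
        refine Finset.mem_union_left _ (Finset.mem_union_right _ ?_)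
        exact Finset.mem_image_of_mem _ hm)
      exact ⟨y, fun _ => ⟨hy0 (mem_support_iff.mp hm), hy⟩⟩
    · exact ⟨0, fun h => absurd h hm⟩
  choose b hb using hb
  have hinj : Set.InjOn u A := by
    intro a ha a' ha' he
    by_contra hne
    obtain ⟨y, hy, hy0⟩ := hX (a - a') (by
      refine Finset.mem_union_right _ (Finset.mem_image.mpr ⟨(a, a'), ?_, rfl⟩)
      exact Finset.mem_product.mpr ⟨ha, ha'⟩)
    have h1 := T.sub_mem (hu a ha) (hu a' ha')
    rw [Prod.mk_sub_mk, he, sub_self] at h1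
    exact hy0 (sub_ne_zero.mpr hne) (hT _ _ _ hy h1)
  have hcard : (A.image u).card = A.card := Finset.card_image_of_injOn hinj
  have hPP : ((A.image u * A.image u).card : ℝ) ≤ κ * (A.image u).card := by
    rw [hcard]
    refine le_trans ?_ hAA
    have e1 : A.image u * A.image u = (A ×ˢ A).image (fun p => u p.1 * u p.2) := by
      ext y
      simp only [Finset.mem_mul, Finset.mem_image, Finset.mem_product, Prod.exists]
      constructor
      · rintro ⟨_, ⟨a, ha, rfl⟩, _, ⟨a', ha', rfl⟩, rfl⟩
        exact ⟨a, a', ⟨ha, ha'⟩, rfl⟩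
      · rintro ⟨a, a', ⟨ha, ha'⟩, rfl⟩
        exact ⟨_, ⟨a, ha, rfl⟩, _, ⟨a', ha', rfl⟩, rfl⟩
    have e2 : A * A = (A ×ˢ A).image (fun p => p.1 * p.2) := rfl
    rw [e1, e2]
    refine Nat.cast_le.mpr (card_image_le_of_factor _ _ _ ?_)
    intro p hp q hq he
    obtain ⟨hp1, hp2⟩ := Finset.mem_product.mp hp
    obtain ⟨hq1, hq2⟩ := Finset.mem_product.mp hq
    have h1 := T.mul_mem (hu _ hp1) (hu _ hp2)
    have h2 := T.mul_mem (hu _ hq1) (hu _ hq2)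
    rw [Prod.mk_mul_mk] at h1 h2
    rw [show p.1 * p.2 = q.1 * q.2 from he] at h1
    have := hT _ _ _ h1 h2
    apply Units.ext
    simpa using this
  have heval : ∀ a : Fin (n + 1) → ℂ, (∀ i, a i ∈ A) →
      (eval a F, ∑ m ∈ F.support, b m * ((mon m (fun i => u (a i)) : Kˣ) : K)) ∈ T := by
    intro a ha
    have : (eval a F, ∑ m ∈ F.support, b m * ((mon m (fun i => u (a i)) : Kˣ) : K)) =
        ∑ m ∈ F.support, (coeff m F, b m) * ∏ i, (a i, ((u (a i) : Kˣ) : K)) ^ m i := by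
      rw [eval_eq']
      apply Prod.ext
      · simp [Prod.fst_sum, Prod.fst_prod]
      · simp [Prod.snd_sum, Prod.snd_prod, mon]
    rw [this]
    exact sum_mem (fun m hm => T.mul_mem (hb m hm).2
      (prod_mem (fun i _ => pow_mem (hu _ (ha i)) _)))
  have hspan : Submodule.span ℚ ((fun (m : Fin (n + 1) →₀ ℕ) (i : Fin (n + 1)) => (m i : ℚ)) ''
      (F.support : Set (Fin (n + 1) →₀ ℕ))) = ⊤ := by
    apply Submodule.eq_top_of_finrank_eq
    rw [Module.finrank_fin_fun]
    exact hF
  have hdeg : ∀ m ∈ F.support, ∑ j, m j ≤ d := by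
    intro m hm
    have := le_totalDegree hm
    rw [hFd, Finsupp.sum_fintype _ _ (fun _ => rfl)] at this
    exact this
  have hmain := H K (A.image u) (hA.image u) κ hκ hPP F.support hdeg hspan b
    (fun m hm => (hb m hm).1)
  rw [hcard] at hmain
  refine hmain.trans ?_
  have hle : ((Fintype.piFinset (fun _ : Fin (n + 1) => A.image u)).image
        (fun p => ∑ m ∈ F.support, b m * ((mon m p : Kˣ) : K))).card ≤ (polyImage F A).card := by
    have e1 : (Fintype.piFinset (fun _ : Fin (n + 1) => A.image u)).image
        (fun p => ∑ m ∈ F.support, b m * ((mon m p : Kˣ) : K)) =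
        (Fintype.piFinset (fun _ : Fin (n + 1) => A)).image
        (fun a => ∑ m ∈ F.support, b m * ((mon m (fun i => u (a i)) : Kˣ) : K)) := by
      ext y
      simp only [Finset.mem_image, Fintype.mem_piFinset]
      constructor
      · rintro ⟨p, hp, rfl⟩
        choose a ha hap using hp
        refine ⟨a, ha, ?_⟩
        rw [show (fun i => u (a i)) = p from funext hap]
      · rintro ⟨a, ha, rfl⟩
        exact ⟨fun i => u (a i), fun i => ⟨a i, ha i, rfl⟩, rfl⟩
    rw [e1]
    refine card_image_le_of_factor _ _ _ ?_
    intro p hp q hq he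
    rw [Fintype.mem_piFinset] at hp hq
    have h1 := heval p hp
    rw [show eval p F = eval q F from he] at h1
    exact hT _ _ _ h1 (heval q hq)
  gcongr

theorem stmt0 (d n : ℕ) (ε : ℝ) (hε : 0 < ε) :
    ∃ C c : ℝ, 0 < C ∧ 0 < c ∧
      ∀ F : MvPolynomial (Fin n) ℂ, dF F = n → F.totalDegree = d →
        ∀ K : ℝ, 1 ≤ K → ∀ A : Finset ℂ, A.Nonempty →
          ((A * A).card : ℝ) ≤ K * (A.card : ℝ) →
          c * (A.card : ℝ) ^ n * (2 : ℝ) ^ (-(C * (Real.logb 2 (2 * K)) ^ (3 + ε)))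
            ≤ ((polyImage F A).card : ℝ) := by
  have hpi : ∀ (k : ℕ) (F : MvPolynomial (Fin k) ℂ) (A : Finset ℂ), A.Nonempty →
      (1 : ℝ) ≤ ((polyImage F A).card : ℝ) := by
    intro k F A hA
    have : (polyImage F A).Nonempty :=
      Finset.Nonempty.image (Fintype.piFinset_nonempty.mpr (fun _ => hA)) _
    exact_mod_cast this.card_pos
  have hLge : ∀ K : ℝ, 1 ≤ K → 1 ≤ Real.logb 2 (2 * K) := by
    intro K hK
    rw [Real.le_logb_iff_rpow_le (by norm_num) (by linarith)]
    norm_num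
    linarith
  have hle1 : ∀ C K : ℝ, 0 < C → 1 ≤ K →
      (2 : ℝ) ^ (-(C * (Real.logb 2 (2 * K)) ^ (3 + ε))) ≤ 1 := by
    intro C K hC hK
    apply Real.rpow_le_one_of_one_le_of_nonpos (by norm_num)
    have : 0 ≤ (Real.logb 2 (2 * K)) ^ (3 + ε) := Real.rpow_nonneg (by linarith [hLge K hK]) _
    nlinarith
  rcases n with _ | n
  · refine ⟨1, 1, one_pos, one_pos, fun F _ _ K hK A hA _ => ?_⟩
    refine le_trans ?_ (hpi _ F A hA)
    rw [pow_zero, one_mul, one_mul]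
    exact hle1 1 K one_pos hK
  obtain ⟨c0, C0, hc0, hC0, H⟩ := cx_thm n d
  have hc2 : (0 : ℝ) < 2 ^ (n + 1) * (c0 + 1) := by positivity
  refine ⟨4 * C0, (2 ^ (n + 1) * (c0 + 1))⁻¹, by positivity, by positivity,
    fun F hF hFd K hK A hA hAA => ?_⟩
  have hL := hLge K hK
  have hE1 := hle1 (4 * C0) K (by positivity) hK
  by_cases hA0 : (A.erase 0).Nonempty
  · have hcard : (A.card : ℝ) ≤ 2 * (A.erase 0).card := by
      have h1 : A.card ≤ (A.erase 0).card + 1 := by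
        have := Finset.pred_card_le_card_erase (s := A) (a := 0)
        omega
      have h2 := hA0.card_pos
      have : A.card ≤ 2 * (A.erase 0).card := by omega
      exact_mod_cast this
    have hsub : A.erase 0 ⊆ A := Finset.erase_subset _ _
    have hAA' : ((A.erase 0 * A.erase 0).card : ℝ) ≤ (2 * K) * ((A.erase 0).card : ℝ) := by
      calc ((A.erase 0 * A.erase 0).card : ℝ) ≤ ((A * A).card : ℝ) := by
            exact_mod_cast Finset.card_le_card (Finset.mul_subset_mul hsub hsub)
        _ ≤ K * (A.card : ℝ) := hAA
        _ ≤ K * (2 * (A.erase 0).card) := by gcongr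
        _ = _ := by ring
    have hm := H F hF hFd (2 * K) (by linarith) (A.erase 0) hA0 (Finset.notMem_erase 0 A) hAA'
    have hpsub : ((polyImage F (A.erase 0)).card : ℝ) ≤ ((polyImage F A).card : ℝ) := by
      have : polyImage F (A.erase 0) ⊆ polyImage F A :=
        Finset.image_subset_image (Fintype.piFinset_subset _ _ (fun _ => hsub))
      exact_mod_cast Finset.card_le_card this
    have hlog : Real.logb 2 (2 * (2 * K)) = 1 + Real.logb 2 (2 * K) := by
      rw [Real.logb_mul (by norm_num) (by linarith), Real.logb_self_eq_one (by norm_num)]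
    rw [hlog] at hm
    generalize Real.logb 2 (2 * K) = L at *
    have hL2 : (1 + L) ^ 2 ≤ 4 * L ^ (3 + ε) := by
      have h1 : L ^ (2 : ℝ) ≤ L ^ (3 + ε) := Real.rpow_le_rpow_of_exponent_le hL (by linarith)
      rw [Real.rpow_two] at h1
      nlinarith
    have hexp : (2 : ℝ) ^ (C0 * (1 + L) ^ 2) ≤ (2 : ℝ) ^ (4 * C0 * L ^ (3 + ε)) := by
      apply Real.rpow_le_rpow_of_exponent_le (by norm_num)
      nlinarith
    rw [Real.rpow_neg (by norm_num)]
    obtain ⟨E, hE⟩ : ∃ E, E = (2 : ℝ) ^ (4 * C0 * L ^ (3 + ε)) := ⟨_, rfl⟩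
    have hE0 : 0 < E := by rw [hE]; positivity
    rw [← hE] at hexp ⊢
    have hfin : (A.card : ℝ) ^ (n + 1) ≤ (2 ^ (n + 1) * (c0 + 1)) * E * (polyImage F A).card := by
      calc (A.card : ℝ) ^ (n + 1) ≤ (2 * (A.erase 0).card) ^ (n + 1) := by gcongr
        _ = 2 ^ (n + 1) * ((A.erase 0).card : ℝ) ^ (n + 1) := mul_pow _ _ _
        _ ≤ 2 ^ (n + 1) * (c0 * (2 : ℝ) ^ (C0 * (1 + L) ^ 2) * (polyImage F (A.erase 0)).card) := by
            gcongr
        _ ≤ 2 ^ (n + 1) * ((c0 + 1) * E * (polyImage F A).card) := by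
            gcongr
            linarith
        _ = _ := by ring
    rw [← div_eq_mul_inv, div_le_iff₀ hE0, inv_mul_le_iff₀ hc2]
    linarith
  · have hA1 : A.card = 1 := by
      rw [Finset.not_nonempty_iff_eq_empty] at hA0
      have := Finset.pred_card_le_card_erase (s := A) (a := 0)
      rw [hA0, Finset.card_empty] at this
      have := hA.card_pos
      omega
    refine le_trans ?_ (hpi _ F A hA)
    rw [hA1, Nat.cast_one, one_pow, mul_one]
    have h1 : (2 ^ (n + 1) * (c0 + 1))⁻¹ ≤ 1 := by
      apply inv_le_one_of_one_le₀
      have : (1 : ℝ) ≤ 2 ^ (n + 1) := one_le_pow₀ (by norm_num)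
      nlinarith
    exact mul_le_one₀ h1 (by positivity) hE1
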